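/- arXiv:2602.17292 — 2 statements merged into one kernel-verified Lean document; each statement's English description precedes it below -/
import Mathlib

section
/- Let K be a Hermitian H-operator-valued kernel on X admitting a Krein space linearisation. For every positive semidefinite kernel L with −L ≤ K ≤ L, fix a minimal Hilbert space linearisation (𝒦_L, W) of L, and let G_K ∈ B(𝒦_L) be the unique selfadjoint contraction satisfying ⟨K(x,y)h, k⟩_{H_x} = ⟨G_K W(y)h, W(x)k⟩_{𝒦_L} for all x,y ∈ X, h ∈ H_y, k ∈ H_x (the Gram operator of K with respect to L). Then the following are equivalent: (i) K has a unique minimal Krein space linearisation modulo unitary equivalence; (ii) for every positive semidefinite kernel L with −L ≤ K ≤ L there exists ε > 0 such that either (−ε, 0) ⊆ ρ(G_K) or (0, ε) ⊆ ρ(G_K), where ρ denotes the resolvent set. -/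
open scoped InnerProductSpace

noncomputable section

universe u v w w'

variable {𝕜 : Type u} [RCLike 𝕜] {X : Type v} {H : X → Type w}
  [∀ x, NormedAddCommGroup (H x)] [∀ x, InnerProductSpace 𝕜 (H x)]
  [∀ x, CompleteSpace (H x)]

/-- `K` is a Hermitian `H`-operator valued kernel: `K(x,y)* = K(y,x)`.
Here `K y x : H x →L[𝕜] H y` is the operator `K(y,x)`. -/
def IsHermitianK (K : ∀ y x : X, H x →L[𝕜] H y) : Prop :=
  ∀ x y : X, ContinuousLinearMap.adjoint (K x y) = K y x

/-- `K` is a positive semidefinite kernel. -/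
def IsPSDK (K : ∀ y x : X, H x →L[𝕜] H y) : Prop :=
  IsHermitianK K ∧ ∀ (n : ℕ) (x : Fin n → X) (h : ∀ i, H (x i)),
    0 ≤ RCLike.re (∑ i, ∑ j, ⟪K (x j) (x i) (h i), h j⟫_𝕜)

/-- The order on Hermitian kernels: `K ≤ L` iff `L - K` is positive
semidefinite. -/
def KLE (K L : ∀ y x : X, H x →L[𝕜] H y) : Prop :=
  IsPSDK (fun y x => L y x - K y x)

/-- Two positive semidefinite kernels are disjoint if the only positive
semidefinite kernel dominated by both is zero. -/
def DisjointK (K₁ K₂ : ∀ y x : X, H x →L[𝕜] H y) : Prop :=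
  ∀ P : ∀ y x : X, H x →L[𝕜] H y,
    IsPSDK P → KLE P K₁ → KLE P K₂ → ∀ y x : X, P y x = 0

/-- A bundled Krein space over `𝕜`: a Hilbert space together with a
fundamental symmetry `J` (`J* = J`, `J² = I`); the indefinite inner product is
`[h, k] = ⟪J h, k⟫`. -/
structure KSp (𝕜 : Type u) [RCLike 𝕜] : Type (max u (w' + 1)) where
  carrier : Type w'
  [ng : NormedAddCommGroup carrier]
  [ip : InnerProductSpace 𝕜 carrier]
  [cs : CompleteSpace carrier]
  J : carrier →L[𝕜] carrier
  J_adj : ContinuousLinearMap.adjoint J = J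
  J_sq : J.comp J = ContinuousLinearMap.id 𝕜 carrier

attribute [instance] KSp.ng KSp.ip KSp.cs

/-- `(𝒦, J, V)` is a Krein space linearisation of `K`:
`K(x,y) = V(x)* J V(y)`. -/
def IsKreinLin (K : ∀ y x : X, H x →L[𝕜] H y) (𝒦 : KSp.{u, w'} 𝕜)
    (V : ∀ x : X, H x →L[𝕜] 𝒦.carrier) : Prop :=
  ∀ x y : X, K x y = (ContinuousLinearMap.adjoint (V x)).comp (𝒦.J.comp (V y))

/-- Minimality of a Krein space linearisation. -/
def IsMinimalKLin (𝒦 : KSp.{u, w'} 𝕜) (V : ∀ x : X, H x →L[𝕜] 𝒦.carrier) :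
    Prop :=
  Dense (↑(Submodule.span 𝕜 (⋃ x : X, Set.range (V x))) : Set 𝒦.carrier)

universe w''

/-- A bundled Hilbert space over `𝕜`. -/
structure HSp (𝕜 : Type u) [RCLike 𝕜] : Type (max u (w'' + 1)) where
  carrier : Type w''
  [ng : NormedAddCommGroup carrier]
  [ip : InnerProductSpace 𝕜 carrier]
  [cs : CompleteSpace carrier]

attribute [instance] HSp.ng HSp.ip HSp.cs

section SelfAdjointCalculus

variable {E : Type*} [NormedAddCommGroup E] [InnerProductSpace 𝕜 E] [CompleteSpace E]

theorem inner_comm_of_isSelfAdjoint {B : E →L[𝕜] E} (hB : IsSelfAdjoint B) (x y : E) :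
    ⟪B x, y⟫_𝕜 = ⟪x, B y⟫_𝕜 := by
  rw [← ContinuousLinearMap.adjoint_inner_right, hB.adjoint_eq]

/-- The norm of a selfadjoint operator, up to sign, belongs to its spectrum. -/
theorem norm_or_neg_norm_mem_spectrum [Nontrivial E] {B : E →L[𝕜] E} (hB : IsSelfAdjoint B) :
    ((‖B‖ : ℝ) : 𝕜) ∈ spectrum 𝕜 B ∨ ((-‖B‖ : ℝ) : 𝕜) ∈ spectrum 𝕜 B := by
  rcases eq_or_ne B 0 with rfl | hB0
  · left
    simp
  by_contra! hcon
  obtain ⟨h1, h2⟩ := hcon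
  rw [spectrum.notMem_iff] at h1 h2
  set b := ‖B‖ with hb
  have hbpos : 0 < b := norm_pos_iff.mpr hB0
  have hunit := h1.mul h2
  obtain ⟨u, hu⟩ := hunit
  set C : E →L[𝕜] E := ↑u⁻¹ with hC
  have hCu : ∀ x, C ((u : E →L[𝕜] E) x) = x := fun x => by
    have := u.inv_mul
    exact congrArg (fun T : E →L[𝕜] E => T x) this
  have hux : ∀ x, (u : E →L[𝕜] E) x = B (B x) - ((b : 𝕜) * b) • x := fun x => by
    rw [hu]
    simp [Algebra.algebraMap_eq_smul_one, smul_smul, smul_sub]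
    module
  have hre : ∀ x, ‖(u : E →L[𝕜] E) x‖ ^ 2 ≤ 2 * b ^ 2 * (b ^ 2 * ‖x‖ ^ 2 - ‖B x‖ ^ 2) := fun x => by
    have hB2 : ‖B (B x)‖ ≤ b * (b * ‖x‖) :=
      (B.le_opNorm _).trans (by gcongr; exact B.le_opNorm _)
    have hB3 : ‖B (B x)‖ ^ 2 ≤ (b * (b * ‖x‖)) ^ 2 := by gcongr
    have hin : RCLike.re ⟪B (B x), ((b : 𝕜) * b) • x⟫_𝕜 = b ^ 2 * ‖B x‖ ^ 2 := by
      rw [inner_smul_right, inner_comm_of_isSelfAdjoint hB, inner_self_eq_norm_sq_to_K]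
      norm_cast
      ring
    rw [hux, @norm_sub_sq 𝕜, hin, norm_smul]
    simp only [norm_mul, RCLike.norm_ofReal, abs_of_pos hbpos]
    nlinarith
  have hCpos : 0 ≤ ‖C‖ := norm_nonneg _
  have hlow : ∀ x, ‖x‖ ^ 2 ≤ (‖C‖ + 1) ^ 2 * (2 * b ^ 2 * (b ^ 2 * ‖x‖ ^ 2 - ‖B x‖ ^ 2)) := fun x => by
    have h3 : ‖x‖ ≤ (‖C‖ + 1) * ‖(u : E →L[𝕜] E) x‖ := by
      calc ‖x‖ = ‖C ((u : E →L[𝕜] E) x)‖ := by rw [hCu]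
        _ ≤ ‖C‖ * ‖(u : E →L[𝕜] E) x‖ := C.le_opNorm _
        _ ≤ _ := by gcongr; linarith
    calc ‖x‖ ^ 2 ≤ ((‖C‖ + 1) * ‖(u : E →L[𝕜] E) x‖) ^ 2 := by gcongr
      _ = (‖C‖ + 1) ^ 2 * ‖(u : E →L[𝕜] E) x‖ ^ 2 := by ring
      _ ≤ _ := by gcongr; exact hre x
  set D := (‖C‖ + 1) ^ 2 * (2 * b ^ 2) with hD
  have hDpos : 0 < D := by positivity
  have hbound : ∀ x, ‖B x‖ ^ 2 ≤ (b ^ 2 - 1 / D) * ‖x‖ ^ 2 := fun x => by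
    have h4 : ‖x‖ ^ 2 ≤ D * (b ^ 2 * ‖x‖ ^ 2 - ‖B x‖ ^ 2) := by
      have := hlow x
      rw [hD]; linarith
    have h5 : ‖x‖ ^ 2 / D ≤ b ^ 2 * ‖x‖ ^ 2 - ‖B x‖ ^ 2 := by
      rw [div_le_iff₀ hDpos]; linarith
    have h6 : (b ^ 2 - 1 / D) * ‖x‖ ^ 2 = b ^ 2 * ‖x‖ ^ 2 - ‖x‖ ^ 2 / D := by ring
    linarith
  have hfin : b ≤ √(b ^ 2 - 1 / D) := by
    refine B.opNorm_le_bound (Real.sqrt_nonneg _) fun x => ?_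
    have h7 := Real.sqrt_le_sqrt (hbound x)
    rw [Real.sqrt_sq (norm_nonneg _), Real.sqrt_mul' _ (by positivity),
      Real.sqrt_sq (norm_nonneg _)] at h7
    exact h7
  have h8 : √(b ^ 2 - 1 / D) < b := by
    rw [Real.sqrt_lt' hbpos]
    have : 0 < 1 / D := by positivity
    linarith
  linarith

theorem isUnit_sq_add_sq {B : E →L[𝕜] E} (hB : IsSelfAdjoint B) {c : ℝ} (hc : c ≠ 0) :
    IsUnit (B * B + algebraMap 𝕜 (E →L[𝕜] E) ((c ^ 2 : ℝ) : 𝕜)) := by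
  refine ContinuousLinearMap.isUnit_of_forall_le_norm_inner_map _ (c := ⟨c ^ 2, sq_nonneg c⟩)
    (by have := sq_pos_of_ne_zero hc; exact this) fun x => ?_
  refine le_trans ?_ (RCLike.re_le_norm _)
  have h : ⟪(B * B + algebraMap 𝕜 (E →L[𝕜] E) ((c ^ 2 : ℝ) : 𝕜)) x, x⟫_𝕜
      = ((‖B x‖ ^ 2 + c ^ 2 * ‖x‖ ^ 2 : ℝ) : 𝕜) := by
    rw [add_apply, ContinuousLinearMap.algebraMap_apply, mul_apply_eq_comp, inner_add_left,
      inner_comm_of_isSelfAdjoint hB, inner_smul_left, RCLike.conj_ofReal,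
      inner_self_eq_norm_sq_to_K, inner_self_eq_norm_sq_to_K]
    push_cast
    ring
  rw [h, RCLike.ofReal_re]
  change ‖x‖ ^ 2 * c ^ 2 ≤ _
  nlinarith [sq_nonneg ‖B x‖]

/-- Evaluation of polynomials with real coefficients at an operator. -/
def realPolyEval (G : E →L[𝕜] E) : Polynomial ℝ →+* (E →L[𝕜] E) :=
  (Polynomial.aeval G : Polynomial 𝕜 →ₐ[𝕜] (E →L[𝕜] E)).toRingHom.comp
    (Polynomial.mapRingHom (algebraMap ℝ 𝕜))

theorem realPolyEval_X (G : E →L[𝕜] E) : realPolyEval G Polynomial.X = G := by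
  simp [realPolyEval]

theorem realPolyEval_C (G : E →L[𝕜] E) (c : ℝ) :
    realPolyEval G (Polynomial.C c) = algebraMap 𝕜 (E →L[𝕜] E) (c : 𝕜) := by
  simp [realPolyEval]

theorem isSelfAdjoint_algebraMap_ofReal (c : ℝ) :
    IsSelfAdjoint (algebraMap 𝕜 (E →L[𝕜] E) (c : 𝕜)) := by
  rw [IsSelfAdjoint, ← algebraMap_star_comm]
  simp

theorem isSelfAdjoint_realPolyEval {G : E →L[𝕜] E} (hG : IsSelfAdjoint G) (p : Polynomial ℝ) :
    IsSelfAdjoint (realPolyEval G p) := by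
  induction p using Polynomial.induction_on' with
  | add p q hp hq => rw [map_add]; exact hp.add hq
  | monomial n a =>
    rw [← Polynomial.C_mul_X_pow_eq_monomial, map_mul, map_pow, realPolyEval_C, realPolyEval_X,
      IsSelfAdjoint, star_mul, (hG.pow n).star_eq, (isSelfAdjoint_algebraMap_ofReal a).star_eq,
      Algebra.commutes]

/-- If `p(G)` is not invertible then `p` vanishes at some real spectral point of `G`. -/
theorem exists_root_of_not_isUnit {G : E →L[𝕜] E} (hG : IsSelfAdjoint G) :
    ∀ (n : ℕ) (p : Polynomial ℝ), p.natDegree ≤ n → p ≠ 0 → ¬ IsUnit (realPolyEval G p) →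
      ∃ t : ℝ, (t : 𝕜) ∈ spectrum 𝕜 G ∧ p.eval t = 0 := by
  intro n
  induction n with
  | zero =>
    intro p hp hp0 hu
    rw [Polynomial.eq_C_of_natDegree_le_zero hp] at hu hp0
    refine absurd ?_ hu
    rw [realPolyEval_C]
    refine IsUnit.map _ (IsUnit.mk0 _ ?_)
    simpa using hp0
  | succ n ih =>
    intro p hp hp0 hu
    by_cases hdeg : p.natDegree = 0
    · exact ih p (by omega) hp0 hu
    have hdeg' : (p.map (algebraMap ℝ ℂ)).degree ≠ 0 := by
      rw [Polynomial.degree_map, Polynomial.degree_eq_natDegree hp0]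
      exact_mod_cast hdeg
    obtain ⟨z, hz⟩ := Complex.exists_root (f := p.map (algebraMap ℝ ℂ))
      (by
        rw [Polynomial.degree_map]
        exact Polynomial.natDegree_pos_iff_degree_pos.mp (Nat.pos_of_ne_zero hdeg))
    have hz0 : Polynomial.aeval z p = 0 := by
      rwa [Polynomial.IsRoot.def, Polynomial.eval_map_algebraMap] at hz
    have key : ∀ d q : Polynomial ℝ, p = d * q → 0 < d.natDegree →
        IsUnit (realPolyEval G d) → ∃ t : ℝ, (t : 𝕜) ∈ spectrum 𝕜 G ∧ p.eval t = 0 := by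
      intro d q hpq hd hdu
      have hd0 : d ≠ 0 := fun h => hp0 (by rw [hpq, h, zero_mul])
      have hq0 : q ≠ 0 := fun h => hp0 (by rw [hpq, h, mul_zero])
      have hnat : p.natDegree = d.natDegree + q.natDegree := by
        rw [hpq, Polynomial.natDegree_mul hd0 hq0]
      obtain ⟨t, ht, hqt⟩ := ih q (by omega) hq0 (fun hqu => hu (by
        rw [hpq, map_mul]; exact hdu.mul hqu))
      exact ⟨t, ht, by rw [hpq, Polynomial.eval_mul, hqt, mul_zero]⟩
    by_cases him : z.im = 0
    · have hzre : z = (z.re : ℂ) := Complex.ext rfl (by simpa using him)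
      have hroot : p.IsRoot z.re := by
        rw [hzre] at hz0
        have : Polynomial.aeval (algebraMap ℝ ℂ z.re) p = 0 := hz0
        rw [Polynomial.aeval_algebraMap_apply] at this
        simpa using this
      by_cases hmem : ((z.re : ℝ) : 𝕜) ∈ spectrum 𝕜 G
      · exact ⟨z.re, hmem, hroot⟩
      obtain ⟨q, hq⟩ := Polynomial.dvd_iff_isRoot.mpr hroot
      refine key _ q hq (by simp) ?_
      rw [spectrum.notMem_iff] at hmem
      rw [map_sub, realPolyEval_X, realPolyEval_C, ← neg_sub]
      exact hmem.neg
    · obtain ⟨q, hq⟩ := p.quadratic_dvd_of_aeval_eq_zero_im_ne_zero hz0 him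
      refine key _ q hq ?_ ?_
      · have : (Polynomial.X ^ 2 - Polynomial.C (2 * z.re) * Polynomial.X
            + Polynomial.C (‖z‖ ^ 2) : Polynomial ℝ).natDegree = 2 := by
          compute_degree!
        omega
      · have h1 : IsSelfAdjoint (G - algebraMap 𝕜 (E →L[𝕜] E) ((z.re : ℝ) : 𝕜)) :=
          hG.sub (isSelfAdjoint_algebraMap_ofReal _)
        have h2 : (Polynomial.X ^ 2 - Polynomial.C (2 * z.re) * Polynomial.X
            + Polynomial.C (‖z‖ ^ 2) : Polynomial ℝ) =
            (Polynomial.X - Polynomial.C z.re) * (Polynomial.X - Polynomial.C z.re)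
              + Polynomial.C (z.im ^ 2) := by
          rw [← Complex.normSq_eq_norm_sq, Complex.normSq_apply]
          simp only [map_mul, map_add, map_pow, map_ofNat]
          ring
        rw [h2, map_add, map_mul, map_sub, realPolyEval_X, realPolyEval_C, realPolyEval_C]
        exact isUnit_sq_add_sq h1 him

theorem exists_norm_realPolyEval_eq [Nontrivial E] {G : E →L[𝕜] E} (hG : IsSelfAdjoint G)
    (p : Polynomial ℝ) :
    ∃ t : ℝ, (t : 𝕜) ∈ spectrum 𝕜 G ∧ |p.eval t| = ‖realPolyEval G p‖ := by
  have key : ∀ s : ℝ, (s : 𝕜) ∈ spectrum 𝕜 (realPolyEval G p) →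
      ∃ t : ℝ, (t : 𝕜) ∈ spectrum 𝕜 G ∧ p.eval t = s := by
    intro s hs
    by_cases hp : p - Polynomial.C s = 0
    · rw [sub_eq_zero] at hp
      rcases norm_or_neg_norm_mem_spectrum hG with h | h
      · exact ⟨_, h, by rw [hp, Polynomial.eval_C]⟩
      · exact ⟨_, h, by rw [hp, Polynomial.eval_C]⟩
    · obtain ⟨t, ht, hpt⟩ := exists_root_of_not_isUnit hG _ _ le_rfl hp (by
        rw [spectrum.mem_iff] at hs
        intro hu
        apply hs
        rw [map_sub, realPolyEval_C] at hu
        rw [← neg_sub]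
        exact hu.neg)
      exact ⟨t, ht, by simpa [sub_eq_zero] using hpt⟩
  rcases norm_or_neg_norm_mem_spectrum (isSelfAdjoint_realPolyEval hG p) with h | h
  · obtain ⟨t, ht, h'⟩ := key _ h
    exact ⟨t, ht, by rw [h', abs_of_nonneg (norm_nonneg _)]⟩
  · obtain ⟨t, ht, h'⟩ := key _ h
    exact ⟨t, ht, by rw [h', abs_neg, abs_of_nonneg (norm_nonneg _)]⟩

/-- The real points of the spectrum of an operator. -/
def realSpectrum (G : E →L[𝕜] E) : Set ℝ := {t | (t : 𝕜) ∈ spectrum 𝕜 G}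

theorem isCompact_realSpectrum (G : E →L[𝕜] E) : IsCompact (realSpectrum G) := by
  refine Metric.isCompact_of_isClosed_isBounded
    ((spectrum.isClosed G).preimage RCLike.continuous_ofReal) ?_
  refine isBounded_iff_forall_norm_le.mpr ⟨‖G‖ * ‖(1 : E →L[𝕜] E)‖, fun t ht => ?_⟩
  have := spectrum.norm_le_norm_mul_of_mem (show (t : 𝕜) ∈ spectrum 𝕜 G from ht)
  simpa using this

/-- A continuous functional calculus for the operator `G`, given by real continuous functions. -/
structure IsCalculus (G : E →L[𝕜] E) (Φ : C(ℝ, ℝ) →+* (E →L[𝕜] E)) : Prop where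
  isSelfAdjoint : ∀ f, IsSelfAdjoint (Φ f)
  map_id : Φ (ContinuousMap.id ℝ) = G
  map_const : ∀ c : ℝ, Φ (ContinuousMap.const ℝ c) = algebraMap 𝕜 (E →L[𝕜] E) (c : 𝕜)
  congr : ∀ f g : C(ℝ, ℝ), (∀ t ∈ realSpectrum G, f t = g t) → Φ f = Φ g

/-- Continuous functional calculus, with real continuous functions, for a selfadjoint operator on a
real or complex Hilbert space. -/
theorem exists_isCalculus {G : E →L[𝕜] E} (hG : IsSelfAdjoint G) :
    ∃ Φ : C(ℝ, ℝ) →+* (E →L[𝕜] E), IsCalculus G Φ := by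
  have : CompactSpace (realSpectrum G) := isCompact_iff_compactSpace.mp (isCompact_realSpectrum G)
  let _ : NormedSpace ℝ (E →L[𝕜] E) := NormedSpace.restrictScalars ℝ 𝕜 (E →L[𝕜] E)
  have hsmul : ∀ (c : ℝ) (T : E →L[𝕜] E), c • T = algebraMap 𝕜 (E →L[𝕜] E) (c : 𝕜) * T :=
    fun c T => (Algebra.smul_def (c : 𝕜) T)
  let e : Polynomial ℝ →ₗ[ℝ] C(realSpectrum G, ℝ) :=
    (Polynomial.toContinuousMapOnAlgHom (realSpectrum G)).toLinearMap
  let f : Polynomial ℝ →ₗ[ℝ] (E →L[𝕜] E) :=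
    { toFun := realPolyEval G
      map_add' := map_add _
      map_smul' := fun c p => by
        rw [Polynomial.smul_eq_C_mul, map_mul, realPolyEval_C, RingHom.id_apply, hsmul] }
  have hdense : DenseRange e := by
    have h := polynomialFunctions.topologicalClosure (realSpectrum G)
    have h' := congrArg (fun S : Subalgebra ℝ C(realSpectrum G, ℝ) => (S : Set C(realSpectrum G, ℝ))) h
    simp only [Subalgebra.topologicalClosure_coe, polynomialFunctions_coe, Algebra.coe_top] at h'
    exact dense_iff_closure_eq.mpr h'
  have hnorm : ∀ p, ‖f p‖ ≤ 1 * ‖e p‖ := fun p => by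
    rw [one_mul]
    rcases subsingleton_or_nontrivial E with hE | hE
    · rw [Subsingleton.elim (f p) 0, norm_zero]
      exact norm_nonneg _
    obtain ⟨t, ht, hpt⟩ := exists_norm_realPolyEval_eq hG p
    change ‖realPolyEval G p‖ ≤ _
    rw [← hpt]
    exact (e p).norm_coe_le_norm ⟨t, ht⟩
  let F : C(realSpectrum G, ℝ) →L[ℝ] (E →L[𝕜] E) := f.extendOfNorm e
  have hF : ∀ p, F (e p) = realPolyEval G p := fun p =>
    LinearMap.extendOfNorm_eq hdense ⟨1, hnorm⟩ p
  have heC : ∀ c : ℝ, e (Polynomial.C c) = ContinuousMap.const _ c := fun c => by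
    ext t; simp [e]
  have hFone : F 1 = 1 := by
    have := hF (Polynomial.C 1)
    rw [heC, realPolyEval_C] at this
    simpa using this
  have hFmul : ∀ a b, F (a * b) = F a * F b := by
    intro a b
    refine hdense.induction_on₂ (p := fun a b => F (a * b) = F a * F b) ?_ ?_ a b
    · exact isClosed_eq (by fun_prop) (by fun_prop)
    · intro p q
      have : e p * e q = e (p * q) := (map_mul (Polynomial.toContinuousMapOnAlgHom _) p q).symm
      rw [this, hF, hF, hF, map_mul]
  have hFsa : ∀ a, IsSelfAdjoint (F a) := by
    intro a
    refine hdense.induction_on a ?_ ?_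
    · exact isClosed_eq (by fun_prop) (by fun_prop)
    · intro p
      rw [hF]
      exact isSelfAdjoint_realPolyEval hG p
  let Φ : C(ℝ, ℝ) →+* (E →L[𝕜] E) :=
    { toFun := fun g => F (g.restrict (realSpectrum G))
      map_one' := hFone
      map_mul' := fun a b => hFmul (a.restrict _) (b.restrict _)
      map_zero' := map_zero F
      map_add' := fun a b => map_add F (a.restrict _) (b.restrict _) }
  refine ⟨Φ, fun g => hFsa _, ?_, fun c => ?_, fun g h hgh => ?_⟩
  · have h1 := hF Polynomial.X
    rw [realPolyEval_X] at h1
    rw [← h1]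
    exact congrArg F (by ext t; simp [e])
  · rw [← realPolyEval_C G c, ← hF, heC]
    rfl
  · exact congrArg F (ContinuousMap.ext fun t => hgh t t.2)

end SelfAdjointCalculus

namespace IsCalculus

variable {E : Type*} [NormedAddCommGroup E] [InnerProductSpace 𝕜 E] [CompleteSpace E]
  {G : E →L[𝕜] E} {Φ : C(ℝ, ℝ) →+* (E →L[𝕜] E)}

theorem map_mul_apply (_ : IsCalculus G Φ) (f g : C(ℝ, ℝ)) (x : E) :
    Φ (f * g) x = Φ f (Φ g x) := by
  rw [map_mul]; rfl

theorem inner_comm (hΦ : IsCalculus G Φ) (f : C(ℝ, ℝ)) (x y : E) :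
    ⟪Φ f x, y⟫_𝕜 = ⟪x, Φ f y⟫_𝕜 :=
  inner_comm_of_isSelfAdjoint (hΦ.isSelfAdjoint f) x y

theorem re_inner_nonneg (hΦ : IsCalculus G Φ) {f : C(ℝ, ℝ)}
    (hf : ∀ t ∈ realSpectrum G, 0 ≤ f t) (x : E) : 0 ≤ RCLike.re ⟪Φ f x, x⟫_𝕜 := by
  let r : C(ℝ, ℝ) := ⟨fun t => √(f t), by fun_prop⟩
  have h : Φ f = Φ (r * r) := hΦ.congr _ _ fun t ht => (Real.mul_self_sqrt (hf t ht)).symm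
  rw [h, hΦ.map_mul_apply, hΦ.inner_comm]
  exact inner_self_nonneg

theorem re_inner_mono (hΦ : IsCalculus G Φ) {f g : C(ℝ, ℝ)}
    (hfg : ∀ t ∈ realSpectrum G, f t ≤ g t) (x : E) :
    RCLike.re ⟪Φ f x, x⟫_𝕜 ≤ RCLike.re ⟪Φ g x, x⟫_𝕜 := by
  have h := hΦ.re_inner_nonneg (f := g - f) (fun t ht => sub_nonneg.mpr (hfg t ht)) x
  rw [map_sub, sub_apply, inner_sub_left, map_sub] at h
  linarith

theorem apply_eq_zero (hΦ : IsCalculus G Φ) {f : C(ℝ, ℝ)} (hf : Φ f = 0) {t : ℝ}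
    (ht : t ∈ realSpectrum G) : f t = 0 := by
  by_contra hne
  let d : C(ℝ, ℝ) := ContinuousMap.id ℝ - ContinuousMap.const ℝ t
  have hpos : ∀ s, (f * f + d * d) s ≠ 0 := fun s => by
    have h1 : (f * f + d * d) s = f s * f s + (s - t) * (s - t) := rfl
    rw [h1]
    rcases eq_or_ne s t with rfl | hs
    · simpa using hne
    · have h2 := mul_self_pos.mpr (sub_ne_zero.mpr hs)
      have h3 := mul_self_nonneg (f s)
      linarith
  let r : C(ℝ, ℝ) := ⟨fun s => ((f * f + d * d) s)⁻¹, (map_continuous _).inv₀ hpos⟩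
  have h1 : (f * f + d * d) * r = 1 := ContinuousMap.ext fun s => mul_inv_cancel₀ (hpos s)
  have h2 : Φ d * (Φ d * Φ r) = 1 := by
    rw [← mul_assoc, ← map_mul, ← map_mul, ← map_one Φ, ← h1, add_mul, map_add, mul_assoc f f r,
      map_mul Φ f, hf, zero_mul, zero_add]
  have h3 : (Φ r * Φ d) * Φ d = 1 := by
    rw [← h2, ← map_mul, ← map_mul, ← map_mul, ← map_mul]
    congr 1
    ring
  have hu : IsUnit (Φ d) := isUnit_iff_exists_and_exists.mpr ⟨⟨_, h2⟩, ⟨_, h3⟩⟩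
  have h4 : Φ d = G - algebraMap 𝕜 (E →L[𝕜] E) (t : 𝕜) := by
    rw [map_sub, hΦ.map_id, hΦ.map_const]
  rw [h4, ← neg_sub] at hu
  exact (spectrum.mem_iff.mp ht) (by simpa using hu.neg)

end IsCalculus

section GapImpliesEquivalence

variable {E F : Type*} [NormedAddCommGroup E] [InnerProductSpace 𝕜 E] [CompleteSpace E]
  [NormedAddCommGroup F] [InnerProductSpace 𝕜 F] [CompleteSpace F]

theorem norm_apply_of_symmetry {J : F →L[𝕜] F} (hJ : ContinuousLinearMap.adjoint J = J)
    (hJ2 : J.comp J = ContinuousLinearMap.id 𝕜 F) (x : F) : ‖J x‖ = ‖x‖ := by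
  have h : ⟪J x, J x⟫_𝕜 = ⟪x, x⟫_𝕜 := by
    rw [← ContinuousLinearMap.adjoint_inner_right, hJ]
    exact congrArg (fun T : F →L[𝕜] F => ⟪x, T x⟫_𝕜) hJ2
  rw [inner_self_eq_norm_sq_to_K, inner_self_eq_norm_sq_to_K] at h
  have hsq : ‖J x‖ ^ 2 = ‖x‖ ^ 2 := by exact_mod_cast h
  exact (sq_eq_sq₀ (norm_nonneg _) (norm_nonneg _)).mp hsq

/-- A spectral gap on the right of zero splits a selfadjoint operator into a uniformly positive and
a nonpositive part. -/
theorem exists_split_of_gap {G : E →L[𝕜] E} (hG : IsSelfAdjoint G) {ε : ℝ} (hε : 0 < ε)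
    (hgap : ∀ t ∈ Set.Ioo 0 ε, t ∉ realSpectrum G) :
    ∃ P s r : E →L[𝕜] E, (∀ x y, ⟪s x, s y⟫_𝕜 = ⟪G (P x), y⟫_𝕜) ∧
      (∀ x y, ⟪r x, r y⟫_𝕜 = -⟪G (x - P x), y⟫_𝕜) ∧ ∀ x, ε * ‖P x‖ ^ 2 ≤ ‖s x‖ ^ 2 := by
  obtain ⟨Φ, hΦ⟩ := exists_isCalculus hG
  let χ : C(ℝ, ℝ) := ⟨fun t => min 1 (max 0 (t / ε)), by fun_prop⟩
  have hχ : ∀ t ∈ realSpectrum G, (t ≤ 0 ∧ χ t = 0) ∨ (ε ≤ t ∧ χ t = 1) := fun t ht => by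
    rcases le_or_gt t 0 with h | h
    · left
      refine ⟨h, ?_⟩
      change min 1 (max 0 (t / ε)) = 0
      rw [max_eq_left (div_nonpos_of_nonpos_of_nonneg h hε.le)]
      simp
    · right
      have h2 : ε ≤ t := by
        by_contra! h3
        exact hgap t ⟨h, h3⟩ ht
      refine ⟨h2, ?_⟩
      change min 1 (max 0 (t / ε)) = 1
      have h3 : 1 ≤ t / ε := by rwa [one_le_div hε]
      exact min_eq_left (h3.trans (le_max_right _ _))
  let s : C(ℝ, ℝ) := ⟨fun t => √(t * χ t), by fun_prop⟩
  let r : C(ℝ, ℝ) := ⟨fun t => √(-(t * (1 - χ t))), by fun_prop⟩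
  have hs : Φ (s * s) = Φ (ContinuousMap.id ℝ * χ) := hΦ.congr _ _ fun t ht => by
    refine Real.mul_self_sqrt ?_
    rcases hχ t ht with ⟨h, h'⟩ | ⟨h, h'⟩ <;> rw [h']
    · simp
    · linarith
  have hr : Φ (r * r) = -Φ (ContinuousMap.id ℝ * (1 - χ)) := by
    rw [← map_neg]
    refine hΦ.congr _ _ fun t ht => Real.mul_self_sqrt ?_
    rcases hχ t ht with ⟨h, h'⟩ | ⟨h, h'⟩ <;> rw [h']
    · linarith
    · simp
  refine ⟨Φ χ, Φ s, Φ r, fun x y => ?_, fun x y => ?_, fun x => ?_⟩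
  · rw [← hΦ.inner_comm, ← hΦ.map_mul_apply, hs, hΦ.map_mul_apply, hΦ.map_id]
  · rw [← hΦ.inner_comm, ← hΦ.map_mul_apply, hr, neg_apply, hΦ.map_mul_apply, hΦ.map_id,
      inner_neg_left, map_sub, map_one]
    rfl
  · have h := hΦ.re_inner_mono (f := ContinuousMap.const ℝ ε * (χ * χ)) (g := s * s)
      (fun t ht => by
        change ε * (χ t * χ t) ≤ √(t * χ t) * √(t * χ t)
        rcases hχ t ht with ⟨h, h'⟩ | ⟨h, h'⟩ <;> rw [h']
        · simp
        · rw [Real.mul_self_sqrt (by linarith)]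
          linarith) x
    rw [hΦ.map_mul_apply, hΦ.map_const, ContinuousLinearMap.algebraMap_apply, inner_smul_left,
      RCLike.conj_ofReal, RCLike.re_ofReal_mul, hΦ.map_mul_apply, hΦ.map_mul_apply,
      hΦ.inner_comm χ (Φ χ x), hΦ.inner_comm s (Φ s x), inner_self_eq_norm_sq, inner_self_eq_norm_sq] at h
    exact h

/-- Two-sided control of the norm of an induced Krein space in terms of the Gram operator. -/
theorem exists_norm_equiv_of_split {J : F →L[𝕜] F} (hJ : ContinuousLinearMap.adjoint J = J)
    (hJ2 : J.comp J = ContinuousLinearMap.id 𝕜 F) {G P s r : E →L[𝕜] E} {A : E →L[𝕜] F}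
    (hA : DenseRange A) (hAG : ∀ x y, ⟪J (A x), A y⟫_𝕜 = ⟪G x, y⟫_𝕜) {ε : ℝ} (hε : 0 < ε)
    (hs : ∀ x y, ⟪s x, s y⟫_𝕜 = ⟪G (P x), y⟫_𝕜)
    (hr : ∀ x y, ⟪r x, r y⟫_𝕜 = -⟪G (x - P x), y⟫_𝕜)
    (hP : ∀ x, ε * ‖P x‖ ^ 2 ≤ ‖s x‖ ^ 2) :
    ∃ C : ℝ, 0 ≤ C ∧ ∀ x, ‖A x‖ ^ 2 ≤ C * (‖s x‖ ^ 2 + ‖r x‖ ^ 2) ∧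
      ‖s x‖ ^ 2 + ‖r x‖ ^ 2 ≤ C * ‖A x‖ ^ 2 := by
  have hJn := norm_apply_of_symmetry hJ hJ2
  set a := ‖A‖ ^ 2 / ε with ha
  have ha0 : 0 ≤ a := by positivity
  have hAP : ∀ x, ‖A (P x)‖ ^ 2 ≤ a * ‖s x‖ ^ 2 := fun x => by
    calc ‖A (P x)‖ ^ 2 ≤ (‖A‖ * ‖P x‖) ^ 2 := by gcongr; exact A.le_opNorm _
      _ = a * (ε * ‖P x‖ ^ 2) := by rw [ha]; field_simp
      _ ≤ a * ‖s x‖ ^ 2 := by gcongr; exact hP x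
  have hsA : ∀ x, ‖s x‖ ^ 2 ≤ a * ‖A x‖ ^ 2 := fun x => by
    have h1 : ‖s x‖ ^ 2 ≤ ‖A (P x)‖ * ‖A x‖ := by
      rw [← inner_self_eq_norm_sq (𝕜 := 𝕜), hs, ← hAG, ← hJn (A (P x))]
      exact (RCLike.re_le_norm _).trans (norm_inner_le_norm _ _)
    have h2 : (‖s x‖ ^ 2) ^ 2 ≤ a * ‖s x‖ ^ 2 * ‖A x‖ ^ 2 := by
      calc (‖s x‖ ^ 2) ^ 2 ≤ (‖A (P x)‖ * ‖A x‖) ^ 2 := by gcongr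
        _ = ‖A (P x)‖ ^ 2 * ‖A x‖ ^ 2 := by ring
        _ ≤ _ := by gcongr; exact hAP x
    rcases (sq_nonneg ‖s x‖).eq_or_lt with h3 | h3
    · rw [← h3]; positivity
    · exact le_of_mul_le_mul_left (by linarith : ‖s x‖ ^ 2 * ‖s x‖ ^ 2 ≤ ‖s x‖ ^ 2 * (a * ‖A x‖ ^ 2)) h3
  have hrA : ∀ x, ‖r x‖ ^ 2 ≤ (a + 1) * ‖A x‖ ^ 2 := fun x => by
    have h1 : ‖r x‖ ^ 2 = ‖s x‖ ^ 2 - RCLike.re ⟪J (A x), A x⟫_𝕜 := by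
      rw [← inner_self_eq_norm_sq (𝕜 := 𝕜), hr, ← inner_self_eq_norm_sq (𝕜 := 𝕜) (s x), hs, hAG,
        map_sub, inner_sub_left, map_neg, map_sub]
      ring
    have h2 : |RCLike.re ⟪J (A x), A x⟫_𝕜| ≤ ‖A x‖ * ‖A x‖ := by
      nth_rewrite 1 [← hJn (A x)]
      exact (RCLike.abs_re_le_norm _).trans (norm_inner_le_norm _ _)
    have h3 := hsA x
    have h4 := neg_le_of_abs_le h2
    nlinarith
  have hAQ : ∀ x, ‖A (x - P x)‖ ≤ √(a + 1) * ‖r x‖ := fun x => by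
    have h1 : ∀ y : F, ‖⟪J (A (x - P x)), y⟫_𝕜‖ ≤ √(a + 1) * ‖r x‖ * ‖y‖ := by
      intro y
      refine hA.induction_on y (isClosed_le (by fun_prop) (by fun_prop)) fun z => ?_
      have h2 : ‖r z‖ ≤ √(a + 1) * ‖A z‖ := by
        have := Real.sqrt_le_sqrt (hrA z)
        rwa [Real.sqrt_sq (norm_nonneg _), Real.sqrt_mul' _ (by positivity),
          Real.sqrt_sq (norm_nonneg _)] at this
      calc ‖⟪J (A (x - P x)), A z⟫_𝕜‖ = ‖⟪r x, r z⟫_𝕜‖ := by rw [hAG, hr, norm_neg]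
        _ ≤ ‖r x‖ * ‖r z‖ := norm_inner_le_norm _ _
        _ ≤ ‖r x‖ * (√(a + 1) * ‖A z‖) := by gcongr
        _ = _ := by ring
    have h2 := h1 (J (A (x - P x)))
    rw [inner_self_eq_norm_sq_to_K, norm_pow, RCLike.norm_ofReal, abs_norm, hJn, sq] at h2
    rcases (norm_nonneg (A (x - P x))).eq_or_lt with h3 | h3
    · rw [← h3]; positivity
    · exact le_of_mul_le_mul_right h2 h3
  refine ⟨2 * (a + 1), by positivity, fun x => ⟨?_, ?_⟩⟩
  · have h1 : ‖A x‖ ≤ ‖A (P x)‖ + ‖A (x - P x)‖ := by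
      have : A x = A (P x) + A (x - P x) := by rw [← map_add]; simp
      rw [this]
      exact norm_add_le _ _
    have h2 : ‖A (x - P x)‖ ^ 2 ≤ (a + 1) * ‖r x‖ ^ 2 := by
      calc ‖A (x - P x)‖ ^ 2 ≤ (√(a + 1) * ‖r x‖) ^ 2 := by gcongr; exact hAQ x
        _ = _ := by rw [mul_pow, Real.sq_sqrt (by positivity)]
    have h3 : ‖A x‖ ^ 2 ≤ (‖A (P x)‖ + ‖A (x - P x)‖) ^ 2 := by gcongr
    have h4 := hAP x
    nlinarith [sq_nonneg (‖A (P x)‖ - ‖A (x - P x)‖), sq_nonneg ‖s x‖]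
  · have h1 := hsA x
    have h2 := hrA x
    nlinarith [sq_nonneg ‖A x‖]

theorem bijective_of_norm_sq_le {A : E →L[𝕜] F} (hA : DenseRange A) {c : ℝ}
    (h : ∀ x, ‖x‖ ^ 2 ≤ c * ‖A x‖ ^ 2) : Function.Bijective A := by
  rw [ContinuousLinearMap.bijective_iff_dense_range_and_antilipschitz]
  refine ⟨?_, ⟨√c, by positivity⟩, ?_⟩
  · exact SetLike.ext' (by simpa using! hA.closure_eq)
  · refine AddMonoidHomClass.antilipschitz_of_bound _ fun x => ?_
    have := Real.sqrt_le_sqrt (h x)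
    rwa [Real.sqrt_sq (norm_nonneg _), Real.sqrt_mul' _ (by positivity),
      Real.sqrt_sq (norm_nonneg _)] at this

theorem realSpectrum_neg (G : E →L[𝕜] E) (t : ℝ) : t ∈ realSpectrum (-G) ↔ -t ∈ realSpectrum G := by
  change (t : 𝕜) ∈ spectrum 𝕜 (-G) ↔ ((-t : ℝ) : 𝕜) ∈ spectrum 𝕜 G
  rw [← spectrum.neg_eq, Set.mem_neg, RCLike.ofReal_neg]

/-- With a one-sided spectral gap of the Gram operator at zero, two jointly isometric
factorisations of the Gram operator through Krein spaces are both bijective. -/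
theorem bijective_of_gap {F₂ : Type*} [NormedAddCommGroup F₂] [InnerProductSpace 𝕜 F₂]
    [CompleteSpace F₂] {J : F →L[𝕜] F} (hJ : ContinuousLinearMap.adjoint J = J)
    (hJ2 : J.comp J = ContinuousLinearMap.id 𝕜 F) {J₂ : F₂ →L[𝕜] F₂}
    (hJ' : ContinuousLinearMap.adjoint J₂ = J₂)
    (hJ2' : J₂.comp J₂ = ContinuousLinearMap.id 𝕜 F₂) {G : E →L[𝕜] E} (hG : IsSelfAdjoint G)
    {A : E →L[𝕜] F} {A₂ : E →L[𝕜] F₂} (hA : DenseRange A) (hA₂ : DenseRange A₂)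
    (hAG : ∀ x y, ⟪J (A x), A y⟫_𝕜 = ⟪G x, y⟫_𝕜)
    (hAG₂ : ∀ x y, ⟪J₂ (A₂ x), A₂ y⟫_𝕜 = ⟪G x, y⟫_𝕜)
    (hnorm : ∀ x, ‖x‖ ^ 2 = ‖A x‖ ^ 2 + ‖A₂ x‖ ^ 2) {ε : ℝ} (hε : 0 < ε)
    (hgap : ∀ t ∈ Set.Ioo 0 ε, t ∉ realSpectrum G) :
    Function.Bijective A ∧ Function.Bijective A₂ := by
  obtain ⟨P, s, r, hs, hr, hP⟩ := exists_split_of_gap hG hε hgap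
  obtain ⟨C, hC, h⟩ := exists_norm_equiv_of_split hJ hJ2 hA hAG hε hs hr hP
  obtain ⟨C₂, hC₂, h₂⟩ := exists_norm_equiv_of_split hJ' hJ2' hA₂ hAG₂ hε hs hr hP
  refine ⟨bijective_of_norm_sq_le hA (c := 1 + C₂ * C) fun x => ?_,
    bijective_of_norm_sq_le hA₂ (c := 1 + C * C₂) fun x => ?_⟩
  · have h1 := mul_le_mul_of_nonneg_left (h x).2 hC₂
    have h2 := (h₂ x).1
    rw [hnorm]
    linarith
  · have h1 := mul_le_mul_of_nonneg_left (h₂ x).2 hC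
    have h2 := (h x).1
    rw [hnorm]
    linarith

end GapImpliesEquivalence

section HyperbolicPerturbation

variable {E F : Type*} [NormedAddCommGroup E] [InnerProductSpace 𝕜 E]
  [NormedAddCommGroup F] [InnerProductSpace 𝕜 F]

/-- The difference between the hyperbolic rotation `e ↦ c e + s f`, `f ↦ s e + c f` in the plane
spanned by `e` and `f` and the identity. -/
def hyperbolicDiff (e f : F) (c s : 𝕜) : F →L[𝕜] F :=
  InnerProductSpace.rankOne 𝕜 ((c - 1) • e + s • f) e +
    InnerProductSpace.rankOne 𝕜 (s • e + (c - 1) • f) f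

theorem hyperbolicDiff_apply (e f : F) (c s : 𝕜) (x : F) : hyperbolicDiff e f c s x =
    ⟪e, x⟫_𝕜 • ((c - 1) • e + s • f) + ⟪f, x⟫_𝕜 • (s • e + (c - 1) • f) := by
  simp only [hyperbolicDiff, add_apply, InnerProductSpace.rankOne_apply]

variable [CompleteSpace E] [CompleteSpace F]

theorem inner_hyperbolicDiff {J : F →L[𝕜] F} (hJ : ContinuousLinearMap.adjoint J = J) {e f : F}
    (he : ‖e‖ = 1) (hf : ‖f‖ = 1) (hef : ⟪e, f⟫_𝕜 = 0) (hJe : J e = e) (hJf : J f = -f)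
    {c s : ℝ} (hcs : c ^ 2 = 1 + s ^ 2) (x y : F) :
    ⟪J (x + hyperbolicDiff e f (c : 𝕜) (s : 𝕜) x), y + hyperbolicDiff e f (c : 𝕜) (s : 𝕜) y⟫_𝕜 =
      ⟪J x, y⟫_𝕜 := by
  have hxe : ⟪J x, e⟫_𝕜 = ⟪x, e⟫_𝕜 := by
    rw [← ContinuousLinearMap.adjoint_inner_right, hJ, hJe]
  have hxf : ⟪J x, f⟫_𝕜 = -⟪x, f⟫_𝕜 := by
    rw [← ContinuousLinearMap.adjoint_inner_right, hJ, hJf, inner_neg_right]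
  have hfe : ⟪f, e⟫_𝕜 = 0 := inner_eq_zero_symm.mp hef
  have hee : ⟪e, e⟫_𝕜 = 1 := by rw [inner_self_eq_norm_sq_to_K, he]; simp
  have hff : ⟪f, f⟫_𝕜 = 1 := by rw [inner_self_eq_norm_sq_to_K, hf]; simp
  have hcsK : (c : 𝕜) ^ 2 = 1 + (s : 𝕜) ^ 2 := by exact_mod_cast congrArg (fun r : ℝ => (r : 𝕜)) hcs
  simp only [hyperbolicDiff_apply, map_add, map_smul, hJe, hJf, inner_add_left, inner_add_right,
    inner_smul_left, inner_smul_right, inner_neg_left, hxe, hxf, hfe, hef, hee, hff,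
    inner_conj_symm, map_sub, map_one, RCLike.conj_ofReal]
  linear_combination (⟪x, e⟫_𝕜 * ⟪e, y⟫_𝕜 - ⟪x, f⟫_𝕜 * ⟪f, y⟫_𝕜) * hcsK

/-- A factorisation of a Gram operator through a Krein space admits an inequivalent one if its range
contains suitable sequences of positive and negative vectors that are small for the Gram form. -/
theorem exists_inequivalent_factorisation {J : F →L[𝕜] F}
    (hJ : ContinuousLinearMap.adjoint J = J) {S : E →L[𝕜] F} (hS : DenseRange S)
    {e f : ℕ → F} {g k : ℕ → E} (hg : ∀ n, S (g n) = e n) (hk : ∀ n, S (k n) = f n)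
    (hJe : ∀ n, J (e n) = e n) (hJf : ∀ n, J (f n) = -f n) (he : Orthonormal 𝕜 e)
    (hf : Orthonormal 𝕜 f)
    (hSe : ∀ n, ‖ContinuousLinearMap.adjoint S (e n)‖ ≤ (1 / 4) ^ n)
    (hSf : ∀ n, ‖ContinuousLinearMap.adjoint S (f n)‖ ≤ (1 / 4) ^ n) :
    ∃ T : E →L[𝕜] F, DenseRange T ∧ (∀ x y, ⟪J (T x), T y⟫_𝕜 = ⟪J (S x), S y⟫_𝕜) ∧
      ∀ U : F →L[𝕜] F, ¬ ∀ x, U (S x) = T x := by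
  have hef : ∀ m n, ⟪e m, f n⟫_𝕜 = 0 := fun m n => by
    have h : ⟪e m, f n⟫_𝕜 = -⟪e m, f n⟫_𝕜 := by
      nth_rewrite 1 [← hJe m]
      rw [← ContinuousLinearMap.adjoint_inner_right, hJ, hJf, inner_neg_right]
    exact self_eq_neg.mp h
  have hfe : ∀ m n, ⟪f m, e n⟫_𝕜 = 0 := fun m n => inner_eq_zero_symm.mp (hef n m)
  let s : ℕ → ℝ := fun n => 2 ^ n
  let c : ℕ → ℝ := fun n => √(1 + s n ^ 2)
  have hs0 : ∀ n, 0 < s n := fun n => by positivity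
  have hcs : ∀ n, c n ^ 2 = 1 + s n ^ 2 := fun n => Real.sq_sqrt (by positivity)
  have hc1 : ∀ n, 0 ≤ c n - 1 := fun n => by
    have : 1 ≤ c n := Real.one_le_sqrt.mpr (by nlinarith [hs0 n])
    linarith
  have hc2 : ∀ n, c n - 1 ≤ s n := fun n => by
    have : c n ≤ 1 + s n := Real.sqrt_le_iff.mpr ⟨by linarith [hs0 n], by nlinarith [hs0 n]⟩
    linarith
  have hcnorm : ∀ n, ‖(c n : 𝕜) - 1‖ ≤ s n := fun n => by
    have : (c n : 𝕜) - 1 = ((c n - 1 : ℝ) : 𝕜) := by push_cast; rfl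
    rw [this, RCLike.norm_ofReal, abs_of_nonneg (hc1 n)]
    exact hc2 n
  have hsnorm : ∀ n, ‖(s n : 𝕜)‖ = s n := fun n => by
    rw [RCLike.norm_ofReal, abs_of_pos (hs0 n)]
  let M : ℕ → F →L[𝕜] F := fun n => hyperbolicDiff (e n) (f n) (c n : 𝕜) (s n : 𝕜)
  have hMS : ∀ n, ‖(M n).comp S‖ ≤ 4 * (1 / 2) ^ n := fun n => by
    refine ContinuousLinearMap.opNorm_le_bound _ (by positivity) fun x => ?_
    have h1 : ‖(c n - 1 : 𝕜) • e n + (s n : 𝕜) • f n‖ ≤ 2 * s n := by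
      refine (norm_add_le _ _).trans ?_
      rw [norm_smul, norm_smul, he.1, hf.1, hsnorm]
      linarith [hcnorm n]
    have h2 : ‖(s n : 𝕜) • e n + (c n - 1 : 𝕜) • f n‖ ≤ 2 * s n := by
      refine (norm_add_le _ _).trans ?_
      rw [norm_smul, norm_smul, he.1, hf.1, hsnorm]
      linarith [hcnorm n]
    have h3 : ‖⟪e n, S x⟫_𝕜‖ ≤ (1 / 4) ^ n * ‖x‖ := by
      rw [← ContinuousLinearMap.adjoint_inner_left]
      exact (norm_inner_le_norm _ _).trans (by gcongr; exact hSe n)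
    have h4 : ‖⟪f n, S x⟫_𝕜‖ ≤ (1 / 4) ^ n * ‖x‖ := by
      rw [← ContinuousLinearMap.adjoint_inner_left]
      exact (norm_inner_le_norm _ _).trans (by gcongr; exact hSf n)
    have h5 : (1 / 4 : ℝ) ^ n * 2 ^ n = (1 / 2) ^ n := by rw [← mul_pow]; norm_num
    calc ‖(M n).comp S x‖ ≤ ((1 / 4) ^ n * ‖x‖) * (2 * s n) + ((1 / 4) ^ n * ‖x‖) * (2 * s n) := by
          change ‖hyperbolicDiff (e n) (f n) (c n : 𝕜) (s n : 𝕜) (S x)‖ ≤ _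
          rw [hyperbolicDiff_apply]
          refine (norm_add_le _ _).trans ?_
          rw [norm_smul, norm_smul]
          gcongr
      _ = 4 * ((1 / 4) ^ n * 2 ^ n) * ‖x‖ := by simp only [s]; ring
      _ = _ := by rw [h5]
  have hsum : Summable fun n => (M n).comp S :=
    Summable.of_norm_bounded (summable_geometric_two.mul_left 4) hMS
  let T : E →L[𝕜] F := S + ∑' n, (M n).comp S
  have hTs : ∀ x, HasSum (fun n => M n (S x)) (T x - S x) := fun x => by
    have h := hsum.hasSum.mapL (ContinuousLinearMap.apply 𝕜 F x)
    have hT : T x - S x = (∑' n, (M n).comp S) x := by simp [T]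
    rw [hT]
    exact h
  have hMe : ∀ m n, M m (e n) = if m = n then (c m - 1 : 𝕜) • e m + (s m : 𝕜) • f m else 0 := by
    intro m n
    have := orthonormal_iff_ite.mp he m n
    simp only [M, hyperbolicDiff_apply, hfe, this, zero_smul, add_zero, ite_smul, one_smul]
  have hMf : ∀ m n, M m (f n) = if m = n then (s m : 𝕜) • e m + (c m - 1 : 𝕜) • f m else 0 := by
    intro m n
    have := orthonormal_iff_ite.mp hf m n
    simp only [M, hyperbolicDiff_apply, hef, this, zero_smul, zero_add, ite_smul, one_smul]
  have hTg : ∀ n, T (g n) = (c n : 𝕜) • e n + (s n : 𝕜) • f n := fun n => by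
    have h := hTs (g n)
    simp only [hg, hMe] at h
    have h' := h.unique (hasSum_single n fun m hm => if_neg hm)
    rw [if_pos rfl, sub_eq_iff_eq_add] at h'
    rw [h']
    module
  have hTk : ∀ n, T (k n) = (s n : 𝕜) • e n + (c n : 𝕜) • f n := fun n => by
    have h := hTs (k n)
    simp only [hk, hMf] at h
    have h' := h.unique (hasSum_single n fun m hm => if_neg hm)
    rw [if_pos rfl, sub_eq_iff_eq_add] at h'
    rw [h']
    module
  refine ⟨T, ?_, fun x y => ?_, fun U hU => ?_⟩
  · have hmem : ∀ x, T x ∈ T.range.topologicalClosure := fun x =>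
      T.range.le_topologicalClosure ⟨x, rfl⟩
    have hcs' : ∀ n, (c n : 𝕜) ^ 2 = 1 + (s n : 𝕜) ^ 2 := fun n => by
      exact_mod_cast congrArg (fun r : ℝ => (r : 𝕜)) (hcs n)
    have hemem : ∀ n, e n ∈ T.range.topologicalClosure := fun n => by
      have h : e n = (c n : 𝕜) • T (g n) - (s n : 𝕜) • T (k n) := by
        rw [hTg, hTk]
        match_scalars
        · linear_combination -hcs' n
        · ring
      rw [h]
      exact sub_mem (Submodule.smul_mem _ _ (hmem _)) (Submodule.smul_mem _ _ (hmem _))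
    have hfmem : ∀ n, f n ∈ T.range.topologicalClosure := fun n => by
      have h : f n = (c n : 𝕜) • T (k n) - (s n : 𝕜) • T (g n) := by
        rw [hTg, hTk]
        match_scalars
        · linear_combination -hcs' n
        · ring
      rw [h]
      exact sub_mem (Submodule.smul_mem _ _ (hmem _)) (Submodule.smul_mem _ _ (hmem _))
    have hSmem : ∀ x, S x ∈ T.range.topologicalClosure := fun x => by
      have h1 : T x - S x ∈ T.range.topologicalClosure := by
        refine T.range.isClosed_topologicalClosure.mem_of_tendsto (hTs x)
          (Filter.Eventually.of_forall fun t => sum_mem fun n _ => ?_)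
        simp only [M, hyperbolicDiff_apply]
        exact add_mem (Submodule.smul_mem _ _ (add_mem (Submodule.smul_mem _ _ (hemem n))
          (Submodule.smul_mem _ _ (hfmem n)))) (Submodule.smul_mem _ _ (add_mem
          (Submodule.smul_mem _ _ (hemem n)) (Submodule.smul_mem _ _ (hfmem n))))
      have h2 := sub_mem (hmem x) h1
      rwa [sub_sub_cancel] at h2
    have hsub : Set.range S ⊆ closure (Set.range T) := by
      rintro _ ⟨x, rfl⟩
      exact hSmem x
    intro y
    exact closure_minimal hsub isClosed_closure (hS y)
  · let Tn : ℕ → E → F := fun N x => S x + ∑ n ∈ Finset.range N, M n (S x)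
    have hlim : ∀ x, Filter.Tendsto (fun N => Tn N x) Filter.atTop (nhds (T x)) := fun x => by
      have h := (hTs x).tendsto_sum_nat.const_add (S x)
      rwa [add_sub_cancel] at h
    have hMM : ∀ m n, m ≠ n → ∀ x, M m (M n x) = 0 := fun m n hmn x => by
      have h1 := hMe m n
      have h2 := hMf m n
      rw [if_neg hmn] at h1 h2
      change M m (hyperbolicDiff (e n) (f n) (c n : 𝕜) (s n : 𝕜) x) = 0
      simp only [hyperbolicDiff_apply, map_add, map_smul, h1, h2, smul_zero, add_zero]
    have hstep : ∀ N x, Tn (N + 1) x = Tn N x + M N (Tn N x) := fun N x => by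
      simp only [Tn, Finset.sum_range_succ, map_add, map_sum]
      rw [Finset.sum_eq_zero fun n hn => hMM N n (Finset.mem_range.mp hn).ne' (S x)]
      abel
    have hconst : ∀ N, ⟪J (Tn N x), Tn N y⟫_𝕜 = ⟪J (S x), S y⟫_𝕜 := fun N => by
      induction N with
      | zero => simp [Tn]
      | succ N ih =>
        rw [hstep, hstep, ← ih]
        exact inner_hyperbolicDiff hJ (he.1 N) (hf.1 N) (hef N N) (hJe N) (hJf N) (hcs N) _ _
    have h1 := ((J.continuous.tendsto _).comp (hlim x)).inner (𝕜 := 𝕜) (hlim y)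
    refine tendsto_nhds_unique h1 ?_
    simp only [Function.comp_def, hconst]
    exact tendsto_const_nhds
  · have hbound : ∀ n : ℕ, (2 : ℝ) ^ n ≤ ‖U‖ := fun n => by
      have h1 : U (e n) = (c n : 𝕜) • e n + (s n : 𝕜) • f n := by rw [← hg, hU, hTg, hg]
      have h2 : ⟪f n, U (e n)⟫_𝕜 = (s n : 𝕜) := by
        rw [h1, inner_add_right, inner_smul_right, inner_smul_right, hfe,
          inner_self_eq_norm_sq_to_K, hf.1]
        simp
      have h3 : ‖⟪f n, U (e n)⟫_𝕜‖ ≤ ‖f n‖ * (‖U‖ * ‖e n‖) :=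
        (norm_inner_le_norm _ _).trans (by gcongr; exact U.le_opNorm _)
      rw [h2, hf.1, he.1, hsnorm, one_mul, mul_one] at h3
      exact h3
    obtain ⟨n, hn⟩ := pow_unbounded_of_one_lt ‖U‖ (one_lt_two : (1 : ℝ) < 2)
    exact absurd (hbound n) (not_le.mpr hn)

end HyperbolicPerturbation

section TwoSidedAccumulation

variable {E : Type w'} [NormedAddCommGroup E] [InnerProductSpace 𝕜 E] [CompleteSpace E]

/-- Two selfadjoint operators with product zero give a Krein space factorisation of the difference
of their squares. -/
theorem exists_krein_factorisation {A B : E →L[𝕜] E} (hA : IsSelfAdjoint A) (hB : IsSelfAdjoint B)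
    (hAB : ∀ x, A (B x) = 0) :
    ∃ (𝒦 : KSp.{u, w'} 𝕜) (ι : 𝒦.carrier →ₗᵢ[𝕜] E) (S : E →L[𝕜] 𝒦.carrier), DenseRange S ∧
      (∀ x, ι (S x) = A x + B x) ∧ ∀ x, ι (𝒦.J (S x)) = A x - B x := by
  have hA' := inner_comm_of_isSelfAdjoint hA
  have hB' := inner_comm_of_isSelfAdjoint hB
  let Q : Submodule 𝕜 E := A.range.topologicalClosure
  let N : Submodule 𝕜 E := (A + B).range.topologicalClosure
  have hN : IsClosed (N : Set E) := Submodule.isClosed_topologicalClosure _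
  have hQ : IsClosed (Q : Set E) := Submodule.isClosed_topologicalClosure _
  have : CompleteSpace N := hN.completeSpace_coe
  have : CompleteSpace Q := hQ.completeSpace_coe
  have hSN : ∀ x, A x + B x ∈ N := fun x => Submodule.le_topologicalClosure _ ⟨x, rfl⟩
  have hRA : ∀ x, Q.reflection (A x) = A x := fun x =>
    Submodule.reflection_mem_subspace_eq_self (Submodule.le_topologicalClosure _ ⟨x, rfl⟩)
  have hRB : ∀ x, Q.reflection (B x) = -B x := fun x => by
    refine Submodule.reflection_mem_subspace_orthogonalComplement_eq_neg ?_
    rw [Submodule.orthogonal_closure, Submodule.mem_orthogonal]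
    rintro _ ⟨y, rfl⟩
    change ⟪A y, B x⟫_𝕜 = 0
    rw [hA', hAB, inner_zero_right]
  have hAN : ∀ x, A x ∈ N := fun x => by
    rw [← Submodule.orthogonal_orthogonal N, Submodule.mem_orthogonal]
    intro z hz
    rw [Submodule.orthogonal_closure, Submodule.mem_orthogonal] at hz
    have h1 : A z + B z = 0 := by
      refine ext_inner_left 𝕜 fun y => ?_
      rw [inner_zero_right, inner_add_right, ← hA', ← hB', ← inner_add_left]
      exact hz _ ⟨y, rfl⟩
    have h2 : A (A z) = 0 := by
      have := congrArg A h1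
      rwa [map_add, hAB, add_zero, map_zero] at this
    have h3 : A z = 0 := by
      rw [← inner_self_eq_zero (𝕜 := 𝕜), hA', h2, inner_zero_right]
    rw [← hA', h3, inner_zero_left]
  have hBN : ∀ x, B x ∈ N := fun x => by
    have := sub_mem (hSN x) (hAN x)
    rwa [add_sub_cancel_left] at this
  have hRN : ∀ x ∈ N, Q.reflection x ∈ N := by
    intro x hx
    refine closure_minimal (t := Q.reflection ⁻¹' (N : Set E)) ?_
      (hN.preimage Q.reflection.continuous) hx
    rintro _ ⟨y, rfl⟩
    change Q.reflection (A y + B y) ∈ N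
    rw [map_add, hRA, hRB]
    exact add_mem (hAN y) (neg_mem (hBN y))
  let R : E →L[𝕜] E := Q.reflection.toContinuousLinearEquiv
  let J : N →L[𝕜] N := (R.comp N.subtypeL).codRestrict N fun x => hRN x x.2
  have hJc : ∀ x : N, ((J x : N) : E) = Q.reflection x := fun x => rfl
  let S : E →L[𝕜] N := (A + B).codRestrict N hSN
  refine ⟨{ carrier := N, J := J, J_adj := ?_, J_sq := ?_ }, N.subtypeₗᵢ, S, ?_, fun x => rfl,
    fun x => ?_⟩
  · refine ((ContinuousLinearMap.eq_adjoint_iff J J).mpr fun x y => ?_).symm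
    rw [Submodule.coe_inner, Submodule.coe_inner, hJc, hJc, ← Q.reflection.inner_map_map,
      Submodule.reflection_reflection]
  · ext x
    change Q.reflection (Q.reflection x) = x
    exact Submodule.reflection_reflection _ _
  · intro x
    rw [Topology.IsInducing.subtypeVal.closure_eq_preimage_closure_image]
    change (x : E) ∈ closure _
    rw [← Set.range_comp]
    exact x.2
  · change Q.reflection (A x + B x) = _
    rw [map_add, hRA, hRB, sub_eq_add_neg]

/-- A tent function supported around `t`, away from zero. -/
def tent (t : ℝ) : C(ℝ, ℝ) := ⟨fun x => max 0 (|t| / 2 - |x - t|), by fun_prop⟩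

theorem tent_apply (t x : ℝ) : tent t x = max 0 (|t| / 2 - |x - t|) := rfl

theorem abs_bounds_of_tent_ne_zero {t x : ℝ} (h : tent t x ≠ 0) :
    |x - t| < |t| / 2 ∧ |t| / 2 < |x| ∧ |x| < 2 * |t| := by
  have h1 : |x - t| < |t| / 2 := by
    by_contra hc
    exact h (max_eq_left (by linarith))
  have h2 := abs_sub_abs_le_abs_sub x t
  have h3 := abs_sub_abs_le_abs_sub t x
  rw [abs_sub_comm t x] at h3
  have h4 := abs_nonneg t
  exact ⟨h1, by linarith, by linarith⟩

theorem tent_mul_tent {s t : ℝ} (h : 3 * |s| ≤ |t|) : tent s * tent t = 0 := by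
  ext x
  by_contra hc
  change tent s x * tent t x ≠ 0 at hc
  have h1 := (abs_bounds_of_tent_ne_zero (left_ne_zero_of_mul hc)).1
  have h2 := (abs_bounds_of_tent_ne_zero (right_ne_zero_of_mul hc)).2.1
  have h3 := abs_sub_abs_le_abs_sub x s
  linarith

/-- The square root of the absolute value. -/
def sqrtAbs : C(ℝ, ℝ) := ⟨fun x => √|x|, by fun_prop⟩

/-- Approximate eigenvectors given by the functional calculus. -/
theorem IsCalculus.exists_tent_vector {G : E →L[𝕜] E} {Φ : C(ℝ, ℝ) →+* (E →L[𝕜] E)}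
    (hΦ : IsCalculus G Φ) {t : ℝ} (ht : t ∈ realSpectrum G) (ht0 : t ≠ 0) :
    ∃ u g : E, ‖Φ (tent t) u‖ = 1 ∧ Φ sqrtAbs g = Φ (tent t) u ∧
      (∀ r : C(ℝ, ℝ), r * tent t = 0 → Φ r g = 0) ∧
      ‖Φ sqrtAbs (Φ (tent t) u)‖ ^ 2 ≤ 2 * |t| := by
  have htpos : 0 < |t| := abs_pos.mpr ht0
  have hne : Φ (tent t) ≠ 0 := fun h => by
    have := hΦ.apply_eq_zero h ht
    rw [tent_apply, sub_self, abs_zero, sub_zero, max_eq_right (by positivity)] at this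
    linarith
  obtain ⟨u₀, hu₀⟩ : ∃ u, Φ (tent t) u ≠ 0 := by
    by_contra! hc
    exact hne (ContinuousLinearMap.ext hc)
  set u : E := ((‖Φ (tent t) u₀‖⁻¹ : ℝ) : 𝕜) • u₀ with hu
  have hnorm : ‖Φ (tent t) u‖ = 1 := by
    rw [hu, map_smul, norm_smul, RCLike.norm_ofReal, abs_of_nonneg (by positivity),
      inv_mul_cancel₀ (norm_ne_zero_iff.mpr hu₀)]
  have hpos : ∀ x : ℝ, 0 < √(max |x| (|t| / 2)) := fun x =>
    Real.sqrt_pos.mpr (lt_max_of_lt_right (by positivity))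
  let ρ : C(ℝ, ℝ) := ⟨fun x => (√(max |x| (|t| / 2)))⁻¹,
    Continuous.inv₀ (by fun_prop) fun x => (hpos x).ne'⟩
  refine ⟨u, Φ (ρ * tent t) u, hnorm, ?_, fun r hr => ?_, ?_⟩
  · rw [← hΦ.map_mul_apply]
    congr 2
    ext x
    change √|x| * ((√(max |x| (|t| / 2)))⁻¹ * tent t x) = tent t x
    by_cases hx : tent t x = 0
    · simp [hx]
    have h := abs_bounds_of_tent_ne_zero hx
    have hx0 : 0 < √|x| := Real.sqrt_pos.mpr (by linarith)
    rw [max_eq_left h.2.1.le]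
    field_simp
  · rw [← hΦ.map_mul_apply, mul_left_comm, hr, mul_zero, map_zero,
      zero_apply]
  · have h1 : ‖Φ sqrtAbs (Φ (tent t) u)‖ ^ 2 =
        RCLike.re ⟪Φ ((sqrtAbs * tent t) * (sqrtAbs * tent t)) u, u⟫_𝕜 := by
      rw [← hΦ.map_mul_apply, hΦ.map_mul_apply (sqrtAbs * tent t), hΦ.inner_comm,
        inner_self_eq_norm_sq]
    have h2 : 2 * |t| = RCLike.re
        ⟪Φ (ContinuousMap.const ℝ (2 * |t|) * (tent t * tent t)) u, u⟫_𝕜 := by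
      rw [hΦ.map_mul_apply, hΦ.map_const, hΦ.map_mul_apply (tent t)]
      rw [Algebra.algebraMap_eq_smul_one]
      simp only [smul_apply, one_apply_eq_self]
      rw [inner_smul_left, RCLike.conj_ofReal, RCLike.re_ofReal_mul, hΦ.inner_comm,
        inner_self_eq_norm_sq, hnorm, one_pow, mul_one]
    rw [h1, h2]
    refine hΦ.re_inner_mono (fun x _ => ?_) u
    change √|x| * tent t x * (√|x| * tent t x) ≤ 2 * |t| * (tent t x * tent t x)
    by_cases hx : tent t x = 0
    · simp [hx]
    have h := abs_bounds_of_tent_ne_zero hx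
    have : √|x| * √|x| = |x| := Real.mul_self_sqrt (abs_nonneg x)
    calc √|x| * tent t x * (√|x| * tent t x) = (√|x| * √|x|) * (tent t x * tent t x) := by ring
      _ = |x| * (tent t x * tent t x) := by rw [this]
      _ ≤ _ := mul_le_mul_of_nonneg_right h.2.2.le (mul_self_nonneg _)

theorem exists_seq_rapidly_decreasing {p : ℝ → Prop} (hp : ∀ ε > 0, ∃ t ∈ Set.Ioo 0 ε, p t) :
    ∃ t : ℕ → ℝ, (∀ n, 0 < t n ∧ p (t n)) ∧ (∀ n, 2 * t n ≤ (1 / 16) ^ n) ∧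
      ∀ m n, m < n → 3 * t n ≤ t m := by
  choose! φ hφ hφp using hp
  let t : ℕ → ℝ := fun n => n.rec (φ (1 / 2)) fun _ s => φ (s / 16)
  have hpos : ∀ n, 0 < t n := fun n => by
    induction n with
    | zero => exact (hφ _ (by norm_num)).1
    | succ n ih => exact (hφ (t n / 16) (by positivity)).1
  have hstep : ∀ n, t (n + 1) < t n / 16 := fun n =>
    (hφ (t n / 16) (div_pos (hpos n) (by norm_num))).2
  refine ⟨t, fun n => ⟨hpos n, ?_⟩, fun n => ?_, fun m n hmn => ?_⟩
  · cases n with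
    | zero => exact hφp _ (by norm_num)
    | succ n => exact hφp (t n / 16) (div_pos (hpos n) (by norm_num))
  · induction n with
    | zero =>
      have := (hφ (1 / 2) (by norm_num)).2
      change 2 * φ (1 / 2) ≤ _
      rw [pow_zero]
      linarith
    | succ n ih =>
      rw [pow_succ]
      linarith [hstep n]
  · have hanti : Antitone t := antitone_nat_of_succ_le fun n => by linarith [hstep n, hpos n]
    have h1 := hanti (Nat.succ_le_of_lt hmn)
    have h2 := hstep m
    have h3 := hpos m
    rw [Nat.succ_eq_add_one] at h1
    linarith

/-- A sequence of spectral points tending rapidly to zero gives an orthonormal sequence of vectors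
in the range of the square root. -/
theorem IsCalculus.exists_orthonormal_seq {G : E →L[𝕜] E} {Φ : C(ℝ, ℝ) →+* (E →L[𝕜] E)}
    (hΦ : IsCalculus G Φ) {t : ℕ → ℝ} (ht : ∀ n, t n ≠ 0 ∧ t n ∈ realSpectrum G)
    (hbound : ∀ n, 2 * |t n| ≤ (1 / 16) ^ n) (hdecay : ∀ m n, m < n → 3 * |t n| ≤ |t m|) :
    ∃ g : ℕ → E, Orthonormal 𝕜 (fun n => Φ sqrtAbs (g n)) ∧
      (∀ n, ‖Φ sqrtAbs (Φ sqrtAbs (g n))‖ ≤ (1 / 4) ^ n) ∧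
      ∀ (n : ℕ) (r : C(ℝ, ℝ)), r * tent (t n) = 0 → Φ r (g n) = 0 := by
  choose u g hu hg hr hn using fun n => hΦ.exists_tent_vector (ht n).2 (ht n).1
  have hmul : ∀ m n, m ≠ n → tent (t m) * tent (t n) = 0 := fun m n hmn => by
    rcases lt_or_gt_of_ne hmn with h | h
    · rw [mul_comm]
      exact tent_mul_tent (hdecay _ _ h)
    · exact tent_mul_tent (hdecay _ _ h)
  refine ⟨g, ⟨fun n => ?_, fun m n hmn => ?_⟩, fun n => ?_, hr⟩
  · exact (congrArg norm (hg n)).trans (hu n)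
  · change ⟪Φ sqrtAbs (g m), Φ sqrtAbs (g n)⟫_𝕜 = 0
    rw [hg, hg, hΦ.inner_comm, ← hΦ.map_mul_apply, hmul m n hmn, map_zero,
      zero_apply, inner_zero_right]
  · rw [hg]
    refine (sq_le_sq₀ (norm_nonneg _) (by positivity)).mp ((hn n).trans ((hbound n).trans ?_))
    rw [← pow_mul, mul_comm n 2, pow_mul]
    norm_num

/-- If zero is a two-sided accumulation point of the spectrum of a selfadjoint operator, then the
operator has two inequivalent factorisations through a Krein space. -/
theorem exists_inequivalent_krein_factorisations {G : E →L[𝕜] E} (hG : IsSelfAdjoint G)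
    (hpos : ∀ ε > 0, ∃ t ∈ Set.Ioo 0 ε, t ∈ realSpectrum G)
    (hneg : ∀ ε > 0, ∃ t ∈ Set.Ioo 0 ε, -t ∈ realSpectrum G) :
    ∃ (𝒦 : KSp.{u, w'} 𝕜) (S T : E →L[𝕜] 𝒦.carrier), DenseRange S ∧ DenseRange T ∧
      (∀ x y, ⟪𝒦.J (S x), S y⟫_𝕜 = ⟪G x, y⟫_𝕜) ∧ (∀ x y, ⟪𝒦.J (T x), T y⟫_𝕜 = ⟪G x, y⟫_𝕜) ∧
      ∀ U : 𝒦.carrier →L[𝕜] 𝒦.carrier, ¬ ∀ x, U (S x) = T x := by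
  obtain ⟨Φ, hΦ⟩ := exists_isCalculus hG
  let p : C(ℝ, ℝ) := ⟨fun x => √x, by fun_prop⟩
  let q : C(ℝ, ℝ) := ⟨fun x => √(-x), by fun_prop⟩
  have hpq : p * q = 0 := by
    ext x
    change √x * √(-x) = 0
    rcases le_total x 0 with h | h
    · rw [Real.sqrt_eq_zero_of_nonpos h, zero_mul]
    · rw [Real.sqrt_eq_zero_of_nonpos (neg_nonpos.mpr h), mul_zero]
  have hsum : p + q = sqrtAbs := by
    ext x
    change √x + √(-x) = √|x|
    rcases le_total x 0 with h | h
    · rw [Real.sqrt_eq_zero_of_nonpos h, abs_of_nonpos h, zero_add]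
    · rw [Real.sqrt_eq_zero_of_nonpos (neg_nonpos.mpr h), abs_of_nonneg h, add_zero]
  have hdiff : (p - q) * (p + q) = ContinuousMap.id ℝ := by
    ext x
    change (√x - √(-x)) * (√x + √(-x)) = x
    rcases le_total x 0 with h | h
    · rw [Real.sqrt_eq_zero_of_nonpos h]
      linear_combination -Real.mul_self_sqrt (neg_nonneg.mpr h)
    · rw [Real.sqrt_eq_zero_of_nonpos (neg_nonpos.mpr h)]
      linear_combination Real.mul_self_sqrt h
  obtain ⟨𝒦, ι, S, hS, hιS, hιJ⟩ := exists_krein_factorisation (hΦ.isSelfAdjoint p)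
    (hΦ.isSelfAdjoint q) fun x => by
      rw [← hΦ.map_mul_apply, hpq, map_zero, zero_apply]
  have hιS' : ∀ x, ι (S x) = Φ sqrtAbs x := fun x => by
    rw [hιS, ← hsum, map_add, add_apply]
  have hSG : ∀ x y, ⟪𝒦.J (S x), S y⟫_𝕜 = ⟪G x, y⟫_𝕜 := fun x y => by
    rw [← ι.inner_map_map, hιJ, hιS', ← hΦ.inner_comm, ← hsum, ← sub_apply,
      ← map_sub, ← hΦ.map_mul_apply, mul_comm, hdiff, hΦ.map_id]
  have hadj : ∀ z, ContinuousLinearMap.adjoint S z = Φ sqrtAbs (ι z) := fun z => by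
    refine ext_inner_right 𝕜 fun y => ?_
    rw [ContinuousLinearMap.adjoint_inner_left, ← ι.inner_map_map, hιS', hΦ.inner_comm]
  obtain ⟨t, ht, htb, htd⟩ := exists_seq_rapidly_decreasing hpos
  obtain ⟨s, hs, hsb, hsd⟩ := exists_seq_rapidly_decreasing hneg
  have hta : ∀ n, |t n| = t n := fun n => abs_of_pos (ht n).1
  have hsa : ∀ n, |-s n| = s n := fun n => by rw [abs_neg, abs_of_pos (hs n).1]
  obtain ⟨g, hgo, hgb, hgr⟩ := hΦ.exists_orthonormal_seq (t := t)
    (fun n => ⟨(ht n).1.ne', (ht n).2⟩) (by simpa only [hta] using htb)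
    (by simpa only [hta] using htd)
  obtain ⟨k, hko, hkb, hkr⟩ := hΦ.exists_orthonormal_seq (t := fun n => -s n)
    (fun n => ⟨neg_ne_zero.mpr (hs n).1.ne', (hs n).2⟩) (by simpa only [hsa] using hsb)
    (by simpa only [hsa] using hsd)
  have hqg : ∀ n, Φ q (g n) = 0 := fun n => hgr n q <| by
    ext x
    by_contra hc
    change √(-x) * tent (t n) x ≠ 0 at hc
    have h := (abs_lt.mp (abs_bounds_of_tent_ne_zero (right_ne_zero_of_mul hc)).1).1
    rw [hta] at h
    exact left_ne_zero_of_mul hc (Real.sqrt_eq_zero_of_nonpos (by linarith [(ht n).1]))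
  have hpk : ∀ n, Φ p (k n) = 0 := fun n => hkr n p <| by
    ext x
    by_contra hc
    change √x * tent (-s n) x ≠ 0 at hc
    have h := (abs_lt.mp (abs_bounds_of_tent_ne_zero (right_ne_zero_of_mul hc)).1).2
    rw [hsa] at h
    exact left_ne_zero_of_mul hc (Real.sqrt_eq_zero_of_nonpos (by linarith [(hs n).1]))
  have hortho : ∀ v : ℕ → E, Orthonormal 𝕜 (fun n => Φ sqrtAbs (v n)) →
      Orthonormal 𝕜 fun n => S (v n) := fun v hv => by
    simp only [← hιS'] at hv
    exact (ι.orthonormal_comp_iff).mp hv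
  obtain ⟨T, hT, hTS, hU⟩ := exists_inequivalent_factorisation 𝒦.J_adj hS
    (e := fun n => S (g n)) (f := fun n => S (k n)) (fun n => rfl) (fun n => rfl)
    (fun n => ι.injective (by rw [hιJ, hιS, hqg, sub_zero, add_zero]))
    (fun n => ι.injective (by rw [map_neg, hιJ, hιS, hpk, zero_sub, zero_add]))
    (hortho g hgo) (hortho k hko) (fun n => by rw [hadj, hιS']; exact hgb n)
    (fun n => by rw [hadj, hιS']; exact hkb n)
  exact ⟨𝒦, S, T, hS, hT, hSG, fun x y => by rw [hTS, hSG], hU⟩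

end TwoSidedAccumulation

section Linearisations

variable {E F : Type*} [NormedAddCommGroup E] [InnerProductSpace 𝕜 E]
  [NormedAddCommGroup F] [InnerProductSpace 𝕜 F]

theorem dense_span_range_comp {W : ∀ x : X, H x →L[𝕜] E}
    (hW : Dense (Submodule.span 𝕜 (⋃ x, Set.range (W x)) : Set E)) {S : E →L[𝕜] F}
    (hS : DenseRange S) :
    Dense (Submodule.span 𝕜 (⋃ x, Set.range (S.comp (W x))) : Set F) := by
  have h : (⋃ x, Set.range (S.comp (W x))) = S '' ⋃ x, Set.range (W x) := by
    simp only [Set.image_iUnion, ContinuousLinearMap.coe_comp, Set.range_comp]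
  have h' := hS.dense_image S.continuous hW
  rw [h, ← ContinuousLinearMap.coe_coe S, ← Submodule.map_span, Submodule.map_coe]
  exact h'

theorem denseRange_of_dense_span {V : ∀ x : X, H x →L[𝕜] F}
    (hV : Dense (Submodule.span 𝕜 (⋃ x, Set.range (V x)) : Set F)) {W : ∀ x : X, H x →L[𝕜] E}
    {A : E →L[𝕜] F} (hA : ∀ x h, A (W x h) = V x h) : DenseRange A := by
  have h : Submodule.span 𝕜 (⋃ x, Set.range (V x)) ≤ A.range := by
    refine Submodule.span_le.mpr (Set.iUnion_subset fun x => ?_)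
    rintro _ ⟨y, rfl⟩
    exact ⟨W x y, hA x y⟩
  exact hV.mono h

theorem clm_ext_of_dense_span {W : ∀ x : X, H x →L[𝕜] E}
    (hW : Dense (Submodule.span 𝕜 (⋃ x, Set.range (W x)) : Set E)) {S T : E →L[𝕜] F}
    (h : ∀ x y, S (W x y) = T (W x y)) : S = T := by
  refine ContinuousLinearMap.ext_on hW fun z hz => ?_
  obtain ⟨x, y, rfl⟩ := Set.mem_iUnion.mp hz
  exact h x y

theorem isPSDK_of_factorisation [CompleteSpace E] (W : ∀ x : X, H x →L[𝕜] E) {B : E →L[𝕜] E}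
    (hB : ContinuousLinearMap.adjoint B = B) (hpos : ∀ z, 0 ≤ RCLike.re ⟪B z, z⟫_𝕜) :
    IsPSDK fun y x => (ContinuousLinearMap.adjoint (W y)).comp (B.comp (W x)) := by
  refine ⟨fun x y => ?_, fun n x h => ?_⟩
  · rw [ContinuousLinearMap.adjoint_comp, ContinuousLinearMap.adjoint_comp, hB,
      ContinuousLinearMap.adjoint_adjoint]
    rfl
  · have key : ∑ i, ∑ j, ⟪(ContinuousLinearMap.adjoint (W (x j))).comp (B.comp (W (x i))) (h i),
        h j⟫_𝕜 = ⟪B (∑ i, W (x i) (h i)), ∑ i, W (x i) (h i)⟫_𝕜 := by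
      simp only [map_sum, sum_inner, inner_sum, ContinuousLinearMap.comp_apply,
        ContinuousLinearMap.adjoint_inner_left]
      exact Finset.sum_comm
    rw [key]
    exact hpos _

/-- Two bundles of operators on the same fibres, with values in two Hilbert spaces, factor jointly
isometrically through a minimal bundle. -/
theorem exists_joint_factorisation {F₁ F₂ : Type w'} [NormedAddCommGroup F₁]
    [InnerProductSpace 𝕜 F₁] [CompleteSpace F₁] [NormedAddCommGroup F₂] [InnerProductSpace 𝕜 F₂]
    [CompleteSpace F₂] (V₁ : ∀ x : X, H x →L[𝕜] F₁) (V₂ : ∀ x : X, H x →L[𝕜] F₂) :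
    ∃ (M : HSp.{u, w'} 𝕜) (W : ∀ x : X, H x →L[𝕜] M.carrier) (A₁ : M.carrier →L[𝕜] F₁)
      (A₂ : M.carrier →L[𝕜] F₂),
      Dense (Submodule.span 𝕜 (⋃ x, Set.range (W x)) : Set M.carrier) ∧
      (∀ x h, A₁ (W x h) = V₁ x h) ∧ (∀ x h, A₂ (W x h) = V₂ x h) ∧
      ∀ z, ‖z‖ ^ 2 = ‖A₁ z‖ ^ 2 + ‖A₂ z‖ ^ 2 := by
  let Z := WithLp 2 (F₁ × F₂)
  let W₀ : ∀ x : X, H x →L[𝕜] Z := fun x =>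
    ((WithLp.prodContinuousLinearEquiv 2 𝕜 F₁ F₂).symm : F₁ × F₂ →L[𝕜] Z).comp
      ((V₁ x).prod (V₂ x))
  let N : Submodule 𝕜 Z := (Submodule.span 𝕜 (⋃ x, Set.range (W₀ x))).topologicalClosure
  have : CompleteSpace N := (Submodule.isClosed_topologicalClosure _).completeSpace_coe
  have hmem : ∀ x h, W₀ x h ∈ N := fun x h => Submodule.le_topologicalClosure _
    (Submodule.subset_span (Set.mem_iUnion.mpr ⟨x, h, rfl⟩))
  let W : ∀ x : X, H x →L[𝕜] N := fun x => (W₀ x).codRestrict N (hmem x)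
  refine ⟨{ carrier := N }, W, (WithLp.fstL 2 𝕜 F₁ F₂).comp N.subtypeL,
    (WithLp.sndL 2 𝕜 F₁ F₂).comp N.subtypeL, ?_, fun x h => rfl, fun x h => rfl, fun z =>
    WithLp.prod_norm_sq_eq_of_L2 (z : Z)⟩
  intro z
  rw [Topology.IsInducing.subtypeVal.closure_eq_preimage_closure_image]
  change (z : Z) ∈ closure _
  have h : N.subtype '' (Submodule.span 𝕜 (⋃ x, Set.range (W x)) : Set N) =
      Submodule.span 𝕜 (⋃ x, Set.range (W₀ x)) := by
    rw [← Submodule.map_coe, Submodule.map_span, Set.image_iUnion]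
    simp only [← Set.range_comp]
    rfl
  have hz : (z : Z) ∈ N := z.2
  rw [← SetLike.mem_coe, Submodule.topologicalClosure_coe, ← h] at hz
  exact hz

end Linearisations

section SpectralGap

/-- If zero is a two-sided accumulation point of the spectrum of the Gram operator, then the kernel
has two inequivalent minimal Krein space linearisations. -/
theorem exists_inequivalent_linearisations {K : ∀ y x : X, H x →L[𝕜] H y} {E : Type w'}
    [NormedAddCommGroup E] [InnerProductSpace 𝕜 E] [CompleteSpace E] {W : ∀ x : X, H x →L[𝕜] E}
    (hW : Dense (Submodule.span 𝕜 (⋃ x, Set.range (W x)) : Set E)) {G : E →L[𝕜] E}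
    (hG : IsSelfAdjoint G)
    (hKG : ∀ (x y : X) (h : H y) (k : H x), ⟪K x y h, k⟫_𝕜 = ⟪G (W y h), W x k⟫_𝕜)
    (hpos : ∀ ε > 0, ∃ t ∈ Set.Ioo 0 ε, t ∈ realSpectrum G)
    (hneg : ∀ ε > 0, ∃ t ∈ Set.Ioo 0 ε, -t ∈ realSpectrum G) :
    ∃ (𝒦 : KSp.{u, w'} 𝕜) (V₁ V₂ : ∀ x : X, H x →L[𝕜] 𝒦.carrier),
      IsKreinLin K 𝒦 V₁ ∧ IsMinimalKLin 𝒦 V₁ ∧ IsKreinLin K 𝒦 V₂ ∧ IsMinimalKLin 𝒦 V₂ ∧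
      ∀ U : 𝒦.carrier →L[𝕜] 𝒦.carrier, ¬ ∀ x h, U (V₁ x h) = V₂ x h := by
  obtain ⟨𝒦, S, T, hS, hT, hSG, hTG, hU⟩ := exists_inequivalent_krein_factorisations hG hpos hneg
  have hlin : ∀ R : E →L[𝕜] 𝒦.carrier, (∀ x y, ⟪𝒦.J (R x), R y⟫_𝕜 = ⟪G x, y⟫_𝕜) →
      IsKreinLin K 𝒦 fun x => R.comp (W x) := fun R hR x y => by
    refine ContinuousLinearMap.ext fun h => ext_inner_right 𝕜 fun k => ?_
    rw [hKG, ← hR, ContinuousLinearMap.comp_apply, ContinuousLinearMap.adjoint_inner_left]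
    rfl
  refine ⟨𝒦, fun x => S.comp (W x), fun x => T.comp (W x), hlin S hSG,
    dense_span_range_comp hW hS, hlin T hTG, dense_span_range_comp hW hT, fun U h => hU U ?_⟩
  exact DFunLike.congr_fun (clm_ext_of_dense_span hW (S := U.comp S) (T := T) h)

/-- Jointly isometric factorisations that are both bijective give a Krein space unitary. -/
theorem exists_unitary_of_bijective {𝒦₁ 𝒦₂ : KSp.{u, w'} 𝕜} {E : Type w'} [NormedAddCommGroup E]
    [InnerProductSpace 𝕜 E] [CompleteSpace E] {A₁ : E →L[𝕜] 𝒦₁.carrier}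
    {A₂ : E →L[𝕜] 𝒦₂.carrier} (h₁ : Function.Bijective A₁) (h₂ : Function.Bijective A₂)
    (h : ∀ x y, ⟪𝒦₁.J (A₁ x), A₁ y⟫_𝕜 = ⟪𝒦₂.J (A₂ x), A₂ y⟫_𝕜) :
    ∃ U : 𝒦₁.carrier ≃L[𝕜] 𝒦₂.carrier,
      (∀ h k : 𝒦₁.carrier, ⟪𝒦₂.J (U h), U k⟫_𝕜 = ⟪𝒦₁.J h, k⟫_𝕜) ∧ ∀ z, U (A₁ z) = A₂ z := by
  let e₁ := ContinuousLinearEquiv.ofBijective A₁ (LinearMap.ker_eq_bot.mpr h₁.1)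
    (LinearMap.range_eq_top.mpr h₁.2)
  let e₂ := ContinuousLinearEquiv.ofBijective A₂ (LinearMap.ker_eq_bot.mpr h₂.1)
    (LinearMap.range_eq_top.mpr h₂.2)
  have hU : ∀ z, (e₁.symm.trans e₂) (A₁ z) = A₂ z := fun z => by
    change e₂ (e₁.symm (e₁ z)) = _
    rw [e₁.symm_apply_apply]
    rfl
  refine ⟨e₁.symm.trans e₂, fun p q => ?_, hU⟩
  obtain ⟨x, rfl⟩ := h₁.2 p
  obtain ⟨y, rfl⟩ := h₁.2 q
  rw [hU, hU, h]

/-- A one-sided spectral gap at zero of the Gram operator makes jointly isometric factorisations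
equivalent. -/
theorem exists_unitary_of_gap {𝒦₁ 𝒦₂ : KSp.{u, w'} 𝕜} {E : Type w'} [NormedAddCommGroup E]
    [InnerProductSpace 𝕜 E] [CompleteSpace E] {A₁ : E →L[𝕜] 𝒦₁.carrier}
    {A₂ : E →L[𝕜] 𝒦₂.carrier} {G : E →L[𝕜] E} (hG : IsSelfAdjoint G) (hA₁ : DenseRange A₁)
    (hA₂ : DenseRange A₂) (hG₁ : ∀ x y, ⟪𝒦₁.J (A₁ x), A₁ y⟫_𝕜 = ⟪G x, y⟫_𝕜)
    (hG₂ : ∀ x y, ⟪𝒦₂.J (A₂ x), A₂ y⟫_𝕜 = ⟪G x, y⟫_𝕜)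
    (hnorm : ∀ x, ‖x‖ ^ 2 = ‖A₁ x‖ ^ 2 + ‖A₂ x‖ ^ 2) {ε : ℝ} (hε : 0 < ε)
    (hgap : (∀ t ∈ Set.Ioo (-ε) 0, t ∉ realSpectrum G) ∨ ∀ t ∈ Set.Ioo 0 ε, t ∉ realSpectrum G) :
    ∃ U : 𝒦₁.carrier ≃L[𝕜] 𝒦₂.carrier,
      (∀ h k : 𝒦₁.carrier, ⟪𝒦₂.J (U h), U k⟫_𝕜 = ⟪𝒦₁.J h, k⟫_𝕜) ∧ ∀ z, U (A₁ z) = A₂ z := by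
  have hbij : Function.Bijective A₁ ∧ Function.Bijective A₂ := by
    rcases hgap with hgap | hgap
    · have hneg : ∀ 𝒦 : KSp.{u, w'} 𝕜, ContinuousLinearMap.adjoint (-𝒦.J) = -𝒦.J ∧
          (-𝒦.J).comp (-𝒦.J) = ContinuousLinearMap.id 𝕜 𝒦.carrier := fun 𝒦 => by
        rw [map_neg, 𝒦.J_adj, ContinuousLinearMap.neg_comp, ContinuousLinearMap.comp_neg, neg_neg,
          𝒦.J_sq]
        exact ⟨rfl, rfl⟩
      refine bijective_of_gap (hneg 𝒦₁).1 (hneg 𝒦₁).2 (hneg 𝒦₂).1 (hneg 𝒦₂).2 hG.neg hA₁ hA₂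
        (fun x y => ?_) (fun x y => ?_) hnorm hε fun t ht => ?_
      · rw [neg_apply, neg_apply, inner_neg_left, inner_neg_left, hG₁]
      · rw [neg_apply, neg_apply, inner_neg_left, inner_neg_left, hG₂]
      · rw [realSpectrum_neg]
        exact hgap _ ⟨neg_lt_neg ht.2, neg_lt_zero.mpr ht.1⟩
    · exact bijective_of_gap 𝒦₁.J_adj 𝒦₁.J_sq 𝒦₂.J_adj 𝒦₂.J_sq hG hA₁ hA₂ hG₁ hG₂ hnorm hε hgap
  exact exists_unitary_of_bijective hbij.1 hbij.2 fun x y => by rw [hG₁, hG₂]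

end SpectralGap

/-- for a Hermitian kernel `K` admitting a Krein space
linearisation, the following are equivalent:
(i) the minimal Krein space linearisation of `K` is unique modulo (Krein
space) unitary equivalence;
(ii) for every positive semidefinite kernel `L` with `-L ≤ K ≤ L`, every
minimal Hilbert space linearisation `(𝒦_L, W)` of `L` and the associated Gram
operator `G` of `K` (the selfadjoint contraction with
`⟨K(x,y)h,k⟩ = ⟨G W(y)h, W(x)k⟩`), there is `ε > 0` such that `(-ε,0)` or
`(0,ε)` lies in the resolvent set of `G`. -/
theorem krein_linearisation_uniqueness_iff_spectral_gap
    (K : ∀ y x : X, H x →L[𝕜] H y) (hK : IsHermitianK K)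
    (hexists : ∃ (𝒦 : KSp.{u, max v w} 𝕜) (V : ∀ x : X, H x →L[𝕜] 𝒦.carrier),
      IsKreinLin K 𝒦 V) :
    ((∀ (𝒦₁ : KSp.{u, max v w} 𝕜) (V₁ : ∀ x : X, H x →L[𝕜] 𝒦₁.carrier)
        (𝒦₂ : KSp.{u, max v w} 𝕜) (V₂ : ∀ x : X, H x →L[𝕜] 𝒦₂.carrier),
        IsKreinLin K 𝒦₁ V₁ → IsMinimalKLin 𝒦₁ V₁ →
        IsKreinLin K 𝒦₂ V₂ → IsMinimalKLin 𝒦₂ V₂ →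
        ∃ U : 𝒦₁.carrier ≃L[𝕜] 𝒦₂.carrier,
          (∀ h k : 𝒦₁.carrier, ⟪𝒦₂.J (U h), U k⟫_𝕜 = ⟪𝒦₁.J h, k⟫_𝕜) ∧
          (∀ (x : X) (h : H x), U (V₁ x h) = V₂ x h)) ↔
      (∀ L : ∀ y x : X, H x →L[𝕜] H y, IsPSDK L →
        KLE (fun y x => -(L y x)) K → KLE K L →
        ∀ (𝒦L : HSp.{u, max v w} 𝕜) (W : ∀ x : X, H x →L[𝕜] 𝒦L.carrier),
          (∀ x y : X, L x y =
            (ContinuousLinearMap.adjoint (W x)).comp (W y)) →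
          Dense (↑(Submodule.span 𝕜 (⋃ x : X, Set.range (W x))) :
            Set 𝒦L.carrier) →
          ∀ G : 𝒦L.carrier →L[𝕜] 𝒦L.carrier,
            ContinuousLinearMap.adjoint G = G → ‖G‖ ≤ 1 →
            (∀ (x y : X) (h : H y) (k : H x),
              ⟪K x y h, k⟫_𝕜 = ⟪G (W y h), W x k⟫_𝕜) →
            ∃ ε : ℝ, 0 < ε ∧
              ((∀ t : ℝ, t ∈ Set.Ioo (-ε) 0 → (t : 𝕜) ∉ spectrum 𝕜 G) ∨
                (∀ t : ℝ, t ∈ Set.Ioo 0 ε → (t : 𝕜) ∉ spectrum 𝕜 G)))) := by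
  constructor
  · intro huniq L _ _ _ 𝒦L W _ hW G hG _ hKG
    by_contra! hgap
    obtain ⟨𝒦, V₁, V₂, h₁, hm₁, h₂, hm₂, hU⟩ := exists_inequivalent_linearisations hW
      (ContinuousLinearMap.isSelfAdjoint_iff'.mpr hG) hKG (fun ε hε => (hgap ε hε).2) fun ε hε => by
        obtain ⟨t, ht, hts⟩ := (hgap ε hε).1
        exact ⟨-t, ⟨neg_pos.mpr ht.2, neg_lt.mp ht.1⟩, by rwa [neg_neg]⟩
    obtain ⟨U, -, hUV⟩ := huniq 𝒦 V₁ 𝒦 V₂ h₁ hm₁ h₂ hm₂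
    exact hU U hUV
  · intro hgap 𝒦₁ V₁ 𝒦₂ V₂ h₁ hm₁ h₂ hm₂
    obtain ⟨M, W, A₁, A₂, hW, hA₁, hA₂, hnorm⟩ := exists_joint_factorisation V₁ V₂
    let G := (ContinuousLinearMap.adjoint A₁).comp (𝒦₁.J.comp A₁)
    have hG : ContinuousLinearMap.adjoint G = G := by
      rw [ContinuousLinearMap.adjoint_comp, ContinuousLinearMap.adjoint_comp, 𝒦₁.J_adj,
        ContinuousLinearMap.adjoint_adjoint]
      rfl
    have hG₁ : ∀ x y, ⟪𝒦₁.J (A₁ x), A₁ y⟫_𝕜 = ⟪G x, y⟫_𝕜 := fun x y =>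
      (ContinuousLinearMap.adjoint_inner_left A₁ y (𝒦₁.J (A₁ x))).symm
    have hKG : ∀ x y, K x y = (ContinuousLinearMap.adjoint (W x)).comp (G.comp (W y)) := fun x y => by
      refine ContinuousLinearMap.ext fun h => ext_inner_right 𝕜 fun k => ?_
      simp only [h₁ x y, ContinuousLinearMap.comp_apply, ContinuousLinearMap.adjoint_inner_left,
        ← hG₁, hA₁]
    have hG₂ : ∀ x y, ⟪𝒦₂.J (A₂ x), A₂ y⟫_𝕜 = ⟪G x, y⟫_𝕜 := fun x y => by
      have hA : (ContinuousLinearMap.adjoint A₂).comp (𝒦₂.J.comp A₂) = G := by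
        refine clm_ext_of_dense_span hW fun b h => ?_
        refine ext_inner_right 𝕜 (DFunLike.congr_fun (clm_ext_of_dense_span hW
          (S := innerSL 𝕜 _) (T := innerSL 𝕜 _) fun a k => ?_))
        rw [innerSL_apply_apply, innerSL_apply_apply, ← hG₁, hA₁, hA₁,
          ContinuousLinearMap.comp_apply, ContinuousLinearMap.adjoint_inner_left,
          ContinuousLinearMap.comp_apply, hA₂, hA₂, ← ContinuousLinearMap.adjoint_inner_left,
          ← ContinuousLinearMap.adjoint_inner_left]
        exact congrArg (fun T : H b →L[𝕜] H a => ⟪T h, k⟫_𝕜) ((h₂ a b).symm.trans (h₁ a b))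
      rw [← hA]
      exact (ContinuousLinearMap.adjoint_inner_left A₂ y (𝒦₂.J (A₂ x))).symm
    have hGle : ∀ z, ‖G z‖ ≤ 1 * ‖z‖ := fun z => by
      have hA : ∀ y, ‖A₁ y‖ ≤ 1 * ‖y‖ := fun y => by
        rw [one_mul]
        exact (sq_le_sq₀ (norm_nonneg _) (norm_nonneg _)).mp
          (by rw [hnorm y]; exact le_add_of_nonneg_right (sq_nonneg _))
      have hA' : ‖A₁‖ ≤ 1 := A₁.opNorm_le_bound zero_le_one hA
      calc ‖G z‖ ≤ ‖ContinuousLinearMap.adjoint A₁‖ * ‖𝒦₁.J (A₁ z)‖ :=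
            (ContinuousLinearMap.adjoint A₁).le_opNorm _
        _ ≤ 1 * (1 * ‖z‖) := by
            rw [LinearIsometryEquiv.norm_map, norm_apply_of_symmetry 𝒦₁.J_adj 𝒦₁.J_sq]
            gcongr
            exact hA z
        _ = _ := one_mul _
    have hGre : ∀ z, |RCLike.re ⟪G z, z⟫_𝕜| ≤ RCLike.re ⟪z, z⟫_𝕜 := fun z => by
      rw [inner_self_eq_norm_sq]
      calc |RCLike.re ⟪G z, z⟫_𝕜| ≤ ‖⟪G z, z⟫_𝕜‖ := RCLike.abs_re_le_norm _
        _ ≤ ‖G z‖ * ‖z‖ := norm_inner_le_norm _ _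
        _ ≤ 1 * ‖z‖ * ‖z‖ := by gcongr; exact hGle z
        _ = ‖z‖ ^ 2 := by ring
    let L : ∀ y x : X, H x →L[𝕜] H y := fun y x => (ContinuousLinearMap.adjoint (W y)).comp (W x)
    have hone : ContinuousLinearMap.adjoint (1 : M.carrier →L[𝕜] M.carrier) = 1 :=
      ContinuousLinearMap.adjoint_id
    have hL : IsPSDK L := 
      isPSDK_of_factorisation W (B := 1) hone fun z => inner_self_nonneg (𝕜 := 𝕜) (x := z)
    have hLK : KLE (fun y x => -(L y x)) K := by
      have h := isPSDK_of_factorisation W (B := G + 1) (by rw [map_add, hG, hone]) fun z => by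
        rw [add_apply, inner_add_left, map_add, one_apply_eq_self]
        linarith [neg_le_of_abs_le (hGre z)]
      simp only [ContinuousLinearMap.add_comp, ContinuousLinearMap.comp_add, ← hKG] at h
      simp only [KLE, sub_neg_eq_add]
      exact h
    have hKL : KLE K L := by
      have h := isPSDK_of_factorisation W (B := 1 - G) (by rw [map_sub, hG, hone]) fun z => by
        rw [sub_apply, inner_sub_left, map_sub, one_apply_eq_self]
        linarith [le_of_abs_le (hGre z)]
      simp only [ContinuousLinearMap.sub_comp, ContinuousLinearMap.comp_sub, ← hKG] at h
      exact h
    obtain ⟨ε, hε, hgap⟩ := hgap L hL hLK hKL M W (fun _ _ => rfl) hW G hG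
      (G.opNorm_le_bound zero_le_one hGle) fun x y h k => by
        rw [hKG, ContinuousLinearMap.comp_apply, ContinuousLinearMap.adjoint_inner_left]
        rfl
    obtain ⟨U, hU, hUA⟩ := exists_unitary_of_gap (ContinuousLinearMap.isSelfAdjoint_iff'.mpr hG)
      (denseRange_of_dense_span hm₁ hA₁) (denseRange_of_dense_span hm₂ hA₂) hG₁ hG₂ hnorm hε hgap
    exact ⟨U, hU, fun x h => by rw [← hA₁, hUA, hA₂]⟩
end
end

section
/- Let K be an H-operator-valued kernel on X which is partially Hermitian with respect to the partition {X_s}_{s∈S} induced by the anchor, and assume K is Γ-invariant. The following are equivalent: (1) there exists a partially positive semidefinite kernel L, Γ-invariant and of bounded shift type, with −L ≤_P K ≤_P L; (2) there exists a partially positive semidefinite kernel L, Γ-invariant and of bounded shift type, such that for each s ∈ S, |[f,g]_K| ≤ ⟨f,f⟩_L^{1/2} ⟨g,g⟩_L^{1/2} for all f,g ∈ F⁰(X_s;H); (3) K = K₁ − K₂ for some partially positive semidefinite kernels K₁, K₂, both Γ-invariant and of bounded shift type; (3′) K = K₊ − K₋ for some disjoint partially positive semidefinite kernels K₊, K₋,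 both Γ-invariant and of bounded shift type; (4) there exists a triple ({(𝒦_s, J_s)}, {V_x}, Ψ) where ({(𝒦_s, J_s)}, {V_x}) is a minimal Krein space partial linearisation of K, Ψ(α) : 𝒦_{d(α)} → 𝒦_{c(α)} are bounded linear operators with Ψ(αβ) = Ψ(α)Ψ(β) for composable pairs, Ψ(α*) = J_{d(α)}Ψ(α)*J_{c(α)} for all α, Ψ(α)V_x = V_{α·x} for all x ∈ X_{d(α)}, and, in addition, Ψ(α)J_{d(α)} = J_{c(α)}Ψ(α) for all α ∈ Γ (the representation commutes with a distinguished bundle of fundamental symmetries). -/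
open scoped InnerProductSpace

noncomputable section

universe u uΓ uS v vO w

/-- A `*`-semigroupoid: partially defined multiplication (the product `mul α β`
is subject to the axioms only when `d α = c β`) together with an involution. -/
structure StarSgd (Γ : Type uΓ) (S : Type uS) where
  d : Γ → S
  c : Γ → S
  mul : Γ → Γ → Γ
  star : Γ → Γ
  d_mul : ∀ {α β : Γ}, d α = c β → d (mul α β) = d β
  c_mul : ∀ {α β : Γ}, d α = c β → c (mul α β) = c α
  mul_assoc : ∀ {α β γ : Γ}, d α = c β → d β = c γ →
    mul α (mul β γ) = mul (mul α β) γ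
  d_star : ∀ α, d (star α) = c α
  c_star : ∀ α, c (star α) = d α
  star_star : ∀ α, star (star α) = α
  star_mul : ∀ {α β : Γ}, d α = c β → star (mul α β) = mul (star β) (star α)

/-- A left action of a semigroupoid on a set `X`, with surjective anchor `a`;
`act α x` is subject to the axioms only when `d α = a x`. -/
structure SgdAction (Γ : Type uΓ) (S : Type uS) (X : Type v) (G : StarSgd Γ S) where
  a : X → S
  a_surj : Function.Surjective a
  act : Γ → X → X
  a_act : ∀ {α : Γ} {x : X}, G.d α = a x → a (act α x) = G.c α
  act_mul : ∀ {α β : Γ} {x : X}, G.d β = a x → G.d α = G.c β →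
    act (G.mul α β) x = act α (act β x)

variable {𝕜 : Type u} [RCLike 𝕜] {Γ : Type uΓ} {S : Type uS} {X : Type v}
  {O : Type vO} {E : O → Type w}
  [∀ o, NormedAddCommGroup (E o)] [∀ o, InnerProductSpace 𝕜 (E o)]
  [∀ o, CompleteSpace (E o)]

/-- Transport along an equality of indices: since the Hilbert bundle over `X`
is given as a pullback `x ↦ E (p x)`, equal indices give literally the same
Hilbert space, and the transport is a linear isometry. -/
def castE (𝕜 : Type u) [RCLike 𝕜] {O : Type vO} (E : O → Type w)
    [∀ o, NormedAddCommGroup (E o)] [∀ o, InnerProductSpace 𝕜 (E o)]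
    {o o' : O} (h : o = o') : E o ≃ₗᵢ[𝕜] E o' := by
  subst h; exact LinearIsometryEquiv.refl 𝕜 (E o)

variable {G : StarSgd Γ S} (A : SgdAction Γ S X G) (p : X → O)

/-- `K` is partially Hermitian with respect to the partition of `X` into the
fibres of the anchor map. -/
def PartHermitian (K : ∀ y x : X, E (p x) →L[𝕜] E (p y)) : Prop :=
  ∀ x y : X, A.a x = A.a y → ContinuousLinearMap.adjoint (K x y) = K y x

/-- `K` is partially positive semidefinite with respect to the partition of
`X` into the fibres of the anchor map. -/
def PartPSD (K : ∀ y x : X, E (p x) →L[𝕜] E (p y)) : Prop :=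
  PartHermitian A p K ∧
  ∀ (s : S) (n : ℕ) (x : Fin n → X), (∀ i, A.a (x i) = s) →
    ∀ h : ∀ i, E (p (x i)),
      0 ≤ RCLike.re (∑ i, ∑ j, ⟪K (x j) (x i) (h i), h j⟫_𝕜)

variable (hp : ∀ {α : Γ} {x : X}, G.d α = A.a x → p (A.act α x) = p x)

/-- `K` is `Γ`-invariant: `K(α·x, y) = K(x, α*·y)`, expressed using the
transport isometries coming from the constancy of the bundle on orbits. -/
def GammaInvariant (K : ∀ y x : X, E (p x) →L[𝕜] E (p y)) : Prop :=
  ∀ (α : Γ) (x y : X) (hx : G.d α = A.a x) (hy : G.c α = A.a y) (k : E (p y)),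
    castE 𝕜 E (hp hx) (K (A.act α x) y k) =
      K x (A.act (G.star α) y)
        ((castE 𝕜 E (hp ((G.d_star α).trans hy))).symm k)

/-- `K` is of bounded shift type: for every `α` there is `M_α ≥ 0` dominating
the shifted quadratic forms by the original ones (stated via finite families of
points in the fibre `X_{d(α)}`). -/
def BoundedShiftType (K : ∀ y x : X, E (p x) →L[𝕜] E (p y)) : Prop :=
  ∀ α : Γ, ∃ M : ℝ, 0 ≤ M ∧
    ∀ (n : ℕ) (z : Fin n → X) (hz : ∀ i, G.d α = A.a (z i))
      (g : ∀ i, E (p (z i))),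
      RCLike.re (∑ i, ∑ j, ⟪K (A.act α (z j)) (A.act α (z i))
          ((castE 𝕜 E (hp (hz i))).symm (g i)),
          (castE 𝕜 E (hp (hz j))).symm (g j)⟫_𝕜) ≤
        M * RCLike.re (∑ i, ∑ j, ⟪K (z j) (z i) (g i), g j⟫_𝕜)

universe w'

/-- The partial order on partially Hermitian kernels with respect to the
anchor partition: `K ≤_P L` iff `L - K` is partially positive semidefinite. -/
def PKLE (K L : ∀ y x : X, E (p x) →L[𝕜] E (p y)) : Prop :=
  PartPSD A p (fun y x => L y x - K y x)

/-- Disjointness of two partially positive semidefinite kernels. -/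
def PDisjoint (K₁ K₂ : ∀ y x : X, E (p x) →L[𝕜] E (p y)) : Prop :=
  ∀ P : ∀ y x : X, E (p x) →L[𝕜] E (p y),
    PartPSD A p P → PKLE A p P K₁ → PKLE A p P K₂ →
    ∀ y x : X, A.a x = A.a y → P y x = 0

/-- Transport between the members of a bundle of Krein spaces along an
equality of indices. -/
def castK (𝕜 : Type u) [RCLike 𝕜] {S : Type uS} (𝒦 : S → KSp.{u, w'} 𝕜)
    {s t : S} (h : s = t) : (𝒦 s).carrier ≃ₗᵢ[𝕜] (𝒦 t).carrier := by
  subst h; exact LinearIsometryEquiv.refl 𝕜 (𝒦 s).carrier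

/-- A Krein space partial linearisation of `K` with respect to the anchor
partition: `K(x,y) = V_x* J_s V_y` on each fibre. -/
def IsPartKreinLin (K : ∀ y x : X, E (p x) →L[𝕜] E (p y))
    (𝒦 : S → KSp.{u, w'} 𝕜)
    (V : ∀ x : X, E (p x) →L[𝕜] (𝒦 (A.a x)).carrier) : Prop :=
  ∀ (x y : X) (hxy : A.a y = A.a x) (k : E (p y)) (h : E (p x)),
    ⟪(K x y) k, h⟫_𝕜 = ⟪(𝒦 (A.a x)).J (castK 𝕜 𝒦 hxy (V y k)), V x h⟫_𝕜

/-- Minimality of a Krein space partial linearisation. -/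
def IsMinimalPartKLin (𝒦 : S → KSp.{u, w'} 𝕜)
    (V : ∀ x : X, E (p x) →L[𝕜] (𝒦 (A.a x)).carrier) : Prop :=
  ∀ s : S, Dense (↑(Submodule.span 𝕜 (⋃ x : {x : X // A.a x = s},
    Set.range fun h : E (p x.val) => castK 𝕜 𝒦 x.2 (V x.val h))) :
      Set (𝒦 s).carrier)

/-- A reproducing kernel Krein space of sections over the fibre `X_s`, with
kernel the restriction of `K`: a Krein space embedded injectively and linearly
into the sections on `X_s`, containing the kernel sections and with the Krein
reproducing property `⟨f(x), h⟩ = [f, K_x h] = ⟪J f, K_x h⟫`. -/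
structure RKKSOn (𝕜 : Type u) [RCLike 𝕜] {Γ : Type uΓ} {S : Type uS}
    {X : Type v} {O : Type vO} (E : O → Type w)
    [∀ o, NormedAddCommGroup (E o)] [∀ o, InnerProductSpace 𝕜 (E o)]
    [∀ o, CompleteSpace (E o)]
    {G : StarSgd Γ S} (A : SgdAction Γ S X G) (p : X → O)
    (K : ∀ y x : X, E (p x) →L[𝕜] E (p y)) (s : S) :
    Type (max u v w (w' + 1)) where
  carrier : Type w'
  [ng : NormedAddCommGroup carrier]
  [ip : InnerProductSpace 𝕜 carrier]
  [cs : CompleteSpace carrier]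
  J : carrier →L[𝕜] carrier
  J_adj : ContinuousLinearMap.adjoint J = J
  J_sq : J.comp J = ContinuousLinearMap.id 𝕜 carrier
  emb : carrier →ₗ[𝕜] ∀ x : {x : X // A.a x = s}, E (p x.val)
  emb_inj : Function.Injective emb
  Kx : ∀ x : {x : X // A.a x = s}, E (p x.val) → carrier
  emb_Kx : ∀ (x : {x : X // A.a x = s}) (h : E (p x.val))
    (y : {x : X // A.a x = s}), emb (Kx x h) y = K y.val x.val h
  repro : ∀ (f : carrier) (x : {x : X // A.a x = s}) (h : E (p x.val)),
    ⟪emb f x, h⟫_𝕜 = ⟪J f, Kx x h⟫_𝕜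

attribute [instance] RKKSOn.ng RKKSOn.ip RKKSOn.cs

/-- The subspaces `D_s := span{K^s_x h}` of the reproducing kernel Krein
spaces. -/
def DspanK (K : ∀ y x : X, E (p x) →L[𝕜] E (p y))
    (R : ∀ s : S, RKKSOn.{u, uΓ, uS, v, vO, w, w'} 𝕜 E A p K s) (s : S) :
    Submodule 𝕜 (R s).carrier :=
  Submodule.span 𝕜 (⋃ x : {x : X // A.a x = s}, Set.range ((R s).Kx x))

/-- Transport between the subspaces `D_s` along an equality of indices. -/
def castDK {K : ∀ y x : X, E (p x) →L[𝕜] E (p y)}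
    {R : ∀ s : S, RKKSOn.{u, uΓ, uS, v, vO, w, w'} 𝕜 E A p K s}
    {s t : S} (h : s = t) : ↥(DspanK A p K R s) ≃ₗ[𝕜] ↥(DspanK A p K R t) := by
  subst h; exact LinearEquiv.refl 𝕜 _

/-- Transport between the members of a bundle of subspaces of a bundle of
Krein spaces along an equality of indices. -/
def castSubK {𝕜 : Type u} [RCLike 𝕜] {S : Type uS} {𝒦 : S → KSp.{u, w'} 𝕜}
    (D : ∀ s : S, Submodule 𝕜 (𝒦 s).carrier) {s t : S} (h : s = t) :
    ↥(D s) ≃ₗ[𝕜] ↥(D t) := by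
  subst h; exact LinearEquiv.refl 𝕜 ↥(D s)

/-- Transport between the members of a bundle of reproducing kernel Krein
spaces along an equality of indices. -/
def castRK {K : ∀ y x : X, E (p x) →L[𝕜] E (p y)}
    (R : ∀ s : S, RKKSOn.{u, uΓ, uS, v, vO, w, w'} 𝕜 E A p K s)
    {s t : S} (h : s = t) : (R s).carrier ≃ₗᵢ[𝕜] (R t).carrier := by
  subst h; exact LinearIsometryEquiv.refl 𝕜 (R s).carrier

/-- A `Γ`-invariant Krein space linearisation of `K`: a Krein space partial
linearisation carrying a bounded `*`-representation `Ψ` of `Γ` (with the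
Krein space adjoint relation `Ψ(α*) = J_{d(α)} Ψ(α)* J_{c(α)}`) such that
`Ψ(α) V_x = V_{α·x}`. -/
structure InvKLin (𝕜 : Type u) [RCLike 𝕜] {Γ : Type uΓ} {S : Type uS}
    {X : Type v} {O : Type vO} (E : O → Type w)
    [∀ o, NormedAddCommGroup (E o)] [∀ o, InnerProductSpace 𝕜 (E o)]
    [∀ o, CompleteSpace (E o)]
    {G : StarSgd Γ S} (A : SgdAction Γ S X G) (p : X → O)
    (hp : ∀ {α : Γ} {x : X}, G.d α = A.a x → p (A.act α x) = p x)
    (K : ∀ y x : X, E (p x) →L[𝕜] E (p y)) :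
    Type (max u uΓ uS v w (w' + 1)) where
  Ksp : S → KSp.{u, w'} 𝕜
  V : ∀ x : X, E (p x) →L[𝕜] (Ksp (A.a x)).carrier
  lin : ∀ (x y : X) (hxy : A.a y = A.a x) (k : E (p y)) (h : E (p x)),
    ⟪(K x y) k, h⟫_𝕜 = ⟪(Ksp (A.a x)).J (castK 𝕜 Ksp hxy (V y k)), V x h⟫_𝕜
  Ψ : ∀ α : Γ, (Ksp (G.d α)).carrier →L[𝕜] (Ksp (G.c α)).carrier
  Ψ_mul : ∀ (α β : Γ) (hc : G.d α = G.c β) (f : (Ksp (G.d β)).carrier),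
    Ψ (G.mul α β) (castK 𝕜 Ksp (G.d_mul hc).symm f) =
      castK 𝕜 Ksp (G.c_mul hc).symm (Ψ α (castK 𝕜 Ksp hc.symm (Ψ β f)))
  Ψ_star : ∀ (α : Γ) (g : (Ksp (G.c α)).carrier),
    castK 𝕜 Ksp (G.c_star α) (Ψ (G.star α) (castK 𝕜 Ksp (G.d_star α).symm g)) =
      (Ksp (G.d α)).J (ContinuousLinearMap.adjoint (Ψ α) ((Ksp (G.c α)).J g))
  Ψ_shift : ∀ (α : Γ) (x : X) (hx : G.d α = A.a x) (h : E (p x)),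
    Ψ α (castK 𝕜 Ksp hx.symm (V x h)) =
      castK 𝕜 Ksp (A.a_act hx) (V (A.act α x) ((castE 𝕜 E (hp hx)).symm h))


section SquareRoot

open Filter Topology

variable {𝕜 R : Type*} [RCLike 𝕜] [NormedRing R] [NormedAlgebra 𝕜 R]

variable (𝕜) in
/-- The iteration `Y ↦ (b + Y²) / 2` started at `0`; its limit `Y` satisfies `(1 - Y)² = 1 - b`. -/
def sqrtIter (b : R) : ℕ → R
  | 0 => 0
  | n + 1 => (2⁻¹ : 𝕜) • (b + sqrtIter b n * sqrtIter b n)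

/-- The scalar majorant of `sqrtIter`. -/
def sqrtMajorant : ℕ → ℝ
  | 0 => 0
  | n + 1 => (1 + sqrtMajorant n ^ 2) / 2

lemma sqrtMajorant_mem (n : ℕ) : 0 ≤ sqrtMajorant n ∧ sqrtMajorant n ≤ 1 := by
  induction n with
  | zero => simp [sqrtMajorant]
  | succ n ih => constructor <;> simp only [sqrtMajorant] <;> nlinarith [ih.1, ih.2]

lemma commute_sqrtIter {z b : R} (h : Commute z b) (n : ℕ) : Commute z (sqrtIter 𝕜 b n) := by
  induction n with
  | zero => exact Commute.zero_right z
  | succ n ih => exact (h.add_right (ih.mul_right ih)).smul_right _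

lemma norm_sqrtIter_le {b : R} (hb : ‖b‖ ≤ 1) (n : ℕ) :
    ‖sqrtIter 𝕜 b n‖ ≤ sqrtMajorant n := by
  induction n with
  | zero => simp [sqrtIter, sqrtMajorant]
  | succ n ih =>
    have h1 : ‖b + sqrtIter 𝕜 b n * sqrtIter 𝕜 b n‖ ≤ 1 + sqrtMajorant n ^ 2 := by
      refine (norm_add_le _ _).trans (add_le_add hb ((norm_mul_le _ _).trans ?_))
      rw [sq]
      exact mul_le_mul ih ih (norm_nonneg _) (sqrtMajorant_mem n).1
    simp only [sqrtIter, sqrtMajorant]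
    rw [norm_smul, norm_inv, RCLike.norm_ofNat]
    linarith

lemma norm_sqrtIter_succ_sub_le {b : R} (hb : ‖b‖ ≤ 1) (n : ℕ) :
    ‖sqrtIter 𝕜 b (n + 1) - sqrtIter 𝕜 b n‖ ≤ sqrtMajorant (n + 1) - sqrtMajorant n := by
  induction n with
  | zero =>
    have := norm_sqrtIter_le (𝕜 := 𝕜) hb 1
    simpa [sqrtIter, sqrtMajorant] using this
  | succ n ih =>
    have hc : Commute (sqrtIter 𝕜 b (n + 1)) (sqrtIter 𝕜 b n) :=
      commute_sqrtIter (commute_sqrtIter (Commute.refl b) _).symm _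
    have heq : sqrtIter 𝕜 b (n + 2) - sqrtIter 𝕜 b (n + 1) =
        (2⁻¹ : 𝕜) • ((sqrtIter 𝕜 b (n + 1) + sqrtIter 𝕜 b n) *
          (sqrtIter 𝕜 b (n + 1) - sqrtIter 𝕜 b n)) := by
      rw [← hc.mul_self_sub_mul_self_eq]
      conv_lhs => rw [sqrtIter, sqrtIter, ← smul_sub, add_sub_add_left_eq_sub]
      simp only [sqrtIter]
    rw [heq, norm_smul, norm_inv, RCLike.norm_ofNat]
    have h1 : ‖sqrtIter 𝕜 b (n + 1) + sqrtIter 𝕜 b n‖ ≤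
        sqrtMajorant (n + 1) + sqrtMajorant n :=
      (norm_add_le _ _).trans (add_le_add (norm_sqrtIter_le hb _) (norm_sqrtIter_le hb _))
    have h2 := (norm_mul_le (sqrtIter 𝕜 b (n + 1) + sqrtIter 𝕜 b n)
      (sqrtIter 𝕜 b (n + 1) - sqrtIter 𝕜 b n)).trans
      (mul_le_mul h1 ih (norm_nonneg _)
        (add_nonneg (sqrtMajorant_mem _).1 (sqrtMajorant_mem _).1))
    have h3 : sqrtMajorant (n + 2) - sqrtMajorant (n + 1) =
        2⁻¹ * ((sqrtMajorant (n + 1) + sqrtMajorant n) *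
          (sqrtMajorant (n + 1) - sqrtMajorant n)) := by
      have e1 : sqrtMajorant (n + 2) = (1 + sqrtMajorant (n + 1) ^ 2) / 2 := rfl
      have e2 : sqrtMajorant (n + 1) = (1 + sqrtMajorant n ^ 2) / 2 := rfl
      rw [e1]
      linear_combination -e2
    rw [h3]
    gcongr

variable (𝕜) in
/-- The square root of an element `a` of a Banach algebra with `‖1 - a‖ ≤ 1`. -/
def algSqrt (a : R) : R := 1 - limUnder atTop (sqrtIter 𝕜 (1 - a))

variable [CompleteSpace R]

lemma tendsto_algSqrt {a : R} (ha : ‖1 - a‖ ≤ 1) :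
    Tendsto (fun n => 1 - sqrtIter 𝕜 (1 - a) n) atTop (𝓝 (algSqrt 𝕜 a)) := by
  have hs : Summable fun n => sqrtMajorant (n + 1) - sqrtMajorant n := by
    refine summable_of_sum_range_le (c := 1)
      (fun n => (norm_nonneg _).trans (norm_sqrtIter_succ_sub_le (𝕜 := 𝕜) ha n)) fun n => ?_
    rw [Finset.sum_range_sub]
    simpa [sqrtMajorant] using (sqrtMajorant_mem n).2
  have hcs : CauchySeq (sqrtIter 𝕜 (1 - a)) :=
    cauchySeq_of_dist_le_of_summable _ (fun n => by
      rw [dist_comm, dist_eq_norm]; exact norm_sqrtIter_succ_sub_le ha n) hs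
  exact tendsto_const_nhds.sub hcs.tendsto_limUnder

lemma algSqrt_mul_self {a : R} (ha : ‖1 - a‖ ≤ 1) : algSqrt 𝕜 a * algSqrt 𝕜 a = a := by
  have h := tendsto_algSqrt (𝕜 := 𝕜) ha
  have h1 : Tendsto (fun n => (1 - sqrtIter 𝕜 (1 - a) n) * (1 - sqrtIter 𝕜 (1 - a) n)
      - (2 : 𝕜) • (1 - sqrtIter 𝕜 (1 - a) n) + (2 : 𝕜) • (1 - sqrtIter 𝕜 (1 - a) (n + 1)))
      atTop (𝓝 (algSqrt 𝕜 a * algSqrt 𝕜 a - (2 : 𝕜) • algSqrt 𝕜 a +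
        (2 : 𝕜) • algSqrt 𝕜 a)) :=
    ((h.mul h).sub (h.const_smul _)).add ((h.comp (tendsto_add_atTop_nat 1)).const_smul _)
  have h2 : ∀ n, (1 - sqrtIter 𝕜 (1 - a) n) * (1 - sqrtIter 𝕜 (1 - a) n)
      - (2 : 𝕜) • (1 - sqrtIter 𝕜 (1 - a) n) + (2 : 𝕜) • (1 - sqrtIter 𝕜 (1 - a) (n + 1)) = a := by
    intro n
    simp only [sqrtIter, smul_sub, smul_smul, ne_eq, OfNat.ofNat_ne_zero, not_false_eq_true,
      mul_inv_cancel₀, one_smul, two_smul]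
    noncomm_ring
  simp only [h2, sub_add_cancel] at h1
  exact tendsto_nhds_unique h1 tendsto_const_nhds

lemma norm_one_sub_algSqrt_le {a : R} (ha : ‖1 - a‖ ≤ 1) : ‖1 - algSqrt 𝕜 a‖ ≤ 1 := by
  refine le_of_tendsto ((tendsto_algSqrt (𝕜 := 𝕜) ha).const_sub 1).norm
    (Eventually.of_forall fun n => ?_)
  rw [sub_sub_cancel]
  exact (norm_sqrtIter_le ha n).trans (sqrtMajorant_mem n).2

end SquareRoot

section OperatorSign

open Filter Topology

variable {𝕜 H H' : Type*} [RCLike 𝕜]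
  [NormedAddCommGroup H] [InnerProductSpace 𝕜 H] [CompleteSpace H]
  [NormedAddCommGroup H'] [InnerProductSpace 𝕜 H'] [CompleteSpace H']

lemma isSelfAdjoint_algSqrt {a : H →L[𝕜] H} (ha : ‖1 - a‖ ≤ 1) (hs : IsSelfAdjoint a) :
    IsSelfAdjoint (algSqrt 𝕜 a) := by
  have h := tendsto_algSqrt (𝕜 := 𝕜) ha
  have hn : ∀ n, IsSelfAdjoint (sqrtIter 𝕜 (1 - a) n) := by
    intro n
    induction n with
    | zero => exact IsSelfAdjoint.zero _
    | succ n ih =>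
      refine IsSelfAdjoint.smul ?_ ((IsSelfAdjoint.one _).sub hs |>.add ?_)
      · simp [IsSelfAdjoint]
      · exact ih.commute_iff ih |>.1 (Commute.refl _)
  have h' : Tendsto (fun n => 1 - sqrtIter 𝕜 (1 - a) n) atTop (𝓝 (star (algSqrt 𝕜 a))) := by
    refine (((continuous_star.tendsto _).comp h)).congr fun n => ?_
    exact ((IsSelfAdjoint.one _).sub (hn n)).star_eq
  exact tendsto_nhds_unique h' h

lemma algSqrt_intertwines {a : H →L[𝕜] H} {a' : H' →L[𝕜] H'} (ha : ‖1 - a‖ ≤ 1)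
    (ha' : ‖1 - a'‖ ≤ 1) {T : H →L[𝕜] H'} (hT : T ∘L a = a' ∘L T) :
    T ∘L algSqrt 𝕜 a = algSqrt 𝕜 a' ∘L T := by
  have hn : ∀ n, T ∘L sqrtIter 𝕜 (1 - a) n = sqrtIter 𝕜 (1 - a') n ∘L T := by
    intro n
    induction n with
    | zero => simp [sqrtIter]
    | succ n ih =>
      ext x
      have h1 := fun x => congrArg (fun S : H →L[𝕜] H' => S x) ih
      have h2 := fun x => congrArg (fun S : H →L[𝕜] H' => S x) hT
      simp only [ContinuousLinearMap.comp_apply] at h1 h2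
      simp [sqrtIter, h1, h2]
  ext x
  have h := ((ContinuousLinearMap.apply 𝕜 H x).continuous.tendsto _).comp
    (tendsto_algSqrt (𝕜 := 𝕜) ha)
  have h' := ((ContinuousLinearMap.apply 𝕜 H' (T x)).continuous.tendsto _).comp
    (tendsto_algSqrt (𝕜 := 𝕜) ha')
  refine tendsto_nhds_unique ((T.continuous.tendsto _).comp h) (h'.congr fun n => ?_)
  have := congrArg (fun S : H →L[𝕜] H' => S x) (hn n)
  simp only [ContinuousLinearMap.comp_apply] at this
  simp [this]

/-- The absolute value of a selfadjoint contraction. -/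
def absOp (g : H →L[𝕜] H) : H →L[𝕜] H := algSqrt 𝕜 (g * g)

/-- The square root of the absolute value of a selfadjoint contraction. -/
def sqrtAbsOp (g : H →L[𝕜] H) : H →L[𝕜] H := algSqrt 𝕜 (absOp g)

/-- A symmetry `j` with `j |g| = g`: the reflection in the kernel of `|g| - g`. -/
def signOp (g : H →L[𝕜] H) : H →L[𝕜] H :=
  (2 : 𝕜) • (LinearMap.ker (absOp g - g).toLinearMap).starProjection - 1

variable {g : H →L[𝕜] H} {g' : H' →L[𝕜] H'}

lemma norm_one_sub_sq_le (hs : IsSelfAdjoint g) (hg : ‖g‖ ≤ 1) : ‖1 - g * g‖ ≤ 1 := by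
  refine ContinuousLinearMap.opNorm_le_bound _ zero_le_one fun x => ?_
  rw [one_mul]
  refine (sq_le_sq₀ (norm_nonneg _) (norm_nonneg _)).1 ?_
  have h1 : ‖g (g x)‖ ≤ ‖g x‖ := (g.le_opNorm _).trans (mul_le_of_le_one_left (norm_nonneg _) hg)
  have h2 : RCLike.re ⟪x, g (g x)⟫_𝕜 = ‖g x‖ ^ 2 := by
    rw [← ContinuousLinearMap.adjoint_inner_left, ← ContinuousLinearMap.star_eq_adjoint,
      hs.star_eq, inner_self_eq_norm_sq]
  have h3 : ‖(1 - g * g) x‖ ^ 2 = ‖x‖ ^ 2 - 2 * ‖g x‖ ^ 2 + ‖g (g x)‖ ^ 2 := by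
    rw [← h2, ← norm_sub_sq (𝕜 := 𝕜)]; rfl
  have h4 : ‖g (g x)‖ ^ 2 ≤ ‖g x‖ ^ 2 := by gcongr
  rw [h3]
  nlinarith [sq_nonneg ‖g x‖]

lemma absOp_mul_self (hs : IsSelfAdjoint g) (hg : ‖g‖ ≤ 1) : absOp g * absOp g = g * g :=
  algSqrt_mul_self (norm_one_sub_sq_le hs hg)

lemma isSelfAdjoint_absOp (hs : IsSelfAdjoint g) (hg : ‖g‖ ≤ 1) : IsSelfAdjoint (absOp g) :=
  isSelfAdjoint_algSqrt (norm_one_sub_sq_le hs hg) (hs.commute_iff hs |>.1 (Commute.refl _))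

lemma norm_one_sub_absOp_le (hs : IsSelfAdjoint g) (hg : ‖g‖ ≤ 1) : ‖1 - absOp g‖ ≤ 1 :=
  norm_one_sub_algSqrt_le (norm_one_sub_sq_le hs hg)

lemma absOp_intertwines (hs : IsSelfAdjoint g) (hg : ‖g‖ ≤ 1) (hs' : IsSelfAdjoint g')
    (hg' : ‖g'‖ ≤ 1) {T : H →L[𝕜] H'} (hT : T ∘L g = g' ∘L T) :
    T ∘L absOp g = absOp g' ∘L T := by
  refine algSqrt_intertwines (norm_one_sub_sq_le hs hg) (norm_one_sub_sq_le hs' hg') ?_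
  have h := fun x => congrArg (fun S : H →L[𝕜] H' => S x) hT
  simp only [ContinuousLinearMap.comp_apply] at h
  ext x
  simp [h]

lemma sqrtAbsOp_mul_self (hs : IsSelfAdjoint g) (hg : ‖g‖ ≤ 1) :
    sqrtAbsOp g * sqrtAbsOp g = absOp g :=
  algSqrt_mul_self (norm_one_sub_absOp_le hs hg)

lemma isSelfAdjoint_sqrtAbsOp (hs : IsSelfAdjoint g) (hg : ‖g‖ ≤ 1) :
    IsSelfAdjoint (sqrtAbsOp g) :=
  isSelfAdjoint_algSqrt (norm_one_sub_absOp_le hs hg) (isSelfAdjoint_absOp hs hg)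

lemma sqrtAbsOp_intertwines (hs : IsSelfAdjoint g) (hg : ‖g‖ ≤ 1) (hs' : IsSelfAdjoint g')
    (hg' : ‖g'‖ ≤ 1) {T : H →L[𝕜] H'} (hT : T ∘L g = g' ∘L T) :
    T ∘L sqrtAbsOp g = sqrtAbsOp g' ∘L T :=
  algSqrt_intertwines (norm_one_sub_absOp_le hs hg) (norm_one_sub_absOp_le hs' hg')
    (absOp_intertwines hs hg hs' hg' hT)

lemma isSelfAdjoint_signOp (g : H →L[𝕜] H) : IsSelfAdjoint (signOp g) := by
  refine (IsSelfAdjoint.smul ?_ ?_).sub (IsSelfAdjoint.one _)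
  · simp [IsSelfAdjoint]
  · exact isSelfAdjoint_starProjection _

lemma signOp_mul_self (g : H →L[𝕜] H) : signOp g * signOp g = 1 := by
  have h := (LinearMap.ker (absOp g - g).toLinearMap).isIdempotentElem_starProjection.eq
  unfold signOp
  set P := (LinearMap.ker (absOp g - g).toLinearMap).starProjection
  rw [mul_sub, sub_mul, smul_mul_smul_comm, h, two_smul]
  have : (2 * 2 : 𝕜) = 2 + 2 := by norm_num
  rw [this, add_smul, two_smul]
  noncomm_ring

lemma absOp_comm (hs : IsSelfAdjoint g) (hg : ‖g‖ ≤ 1) : g * absOp g = absOp g * g :=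
  absOp_intertwines hs hg hs hg rfl

lemma signOp_mul_absOp (hs : IsSelfAdjoint g) (hg : ‖g‖ ≤ 1) : signOp g * absOp g = g := by
  have hsub : IsSelfAdjoint (absOp g - g) := (isSelfAdjoint_absOp hs hg).sub hs
  ext x
  have hcomm := congrArg (fun S : H →L[𝕜] H => S x) (absOp_comm hs hg)
  have hsq := congrArg (fun S : H →L[𝕜] H => S x) (absOp_mul_self hs hg)
  simp only [mul_apply_eq_comp] at hcomm hsq
  have hP : (LinearMap.ker (absOp g - g).toLinearMap).starProjection (absOp g x) =
      (2⁻¹ : 𝕜) • (absOp g x + g x) := by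
    refine Submodule.eq_starProjection_of_mem_orthogonal'
      (K := LinearMap.ker (absOp g - g).toLinearMap) (z := (2⁻¹ : 𝕜) • (absOp g x - g x))
      ?_ ?_ ?_
    · refine Submodule.smul_mem _ _ ?_
      simp [hcomm, hsq, add_comm]
    · refine Submodule.smul_mem _ _ ?_
      intro y hy
      have hy' : (absOp g - g) y = 0 := hy
      change ⟪y, (absOp g - g) x⟫_𝕜 = 0
      rw [← ContinuousLinearMap.adjoint_inner_left, ← ContinuousLinearMap.star_eq_adjoint,
        hsub.star_eq, hy', inner_zero_left]
    · rw [← smul_add, add_add_sub_cancel, ← two_smul 𝕜, smul_smul]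
      simp
  simp only [signOp, mul_apply_eq_comp, sub_apply,
    smul_apply, hP, smul_smul, one_apply_eq_self]
  simp

lemma signOp_intertwines (hs : IsSelfAdjoint g) (hg : ‖g‖ ≤ 1) (hs' : IsSelfAdjoint g')
    (hg' : ‖g'‖ ≤ 1) {T : H →L[𝕜] H'} (hT : T ∘L g = g' ∘L T) :
    T ∘L signOp g = signOp g' ∘L T := by
  have hT2 : ContinuousLinearMap.adjoint T ∘L g' = g ∘L ContinuousLinearMap.adjoint T := by
    have := congrArg ContinuousLinearMap.adjoint hT
    rw [ContinuousLinearMap.adjoint_comp, ContinuousLinearMap.adjoint_comp,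
      ← ContinuousLinearMap.star_eq_adjoint g, ← ContinuousLinearMap.star_eq_adjoint g',
      hs.star_eq, hs'.star_eq] at this
    exact this.symm
  have hR := fun x => congrArg (fun S : H →L[𝕜] H' => S x) (absOp_intertwines hs hg hs' hg' hT)
  have hR2 := fun x => congrArg (fun S : H' →L[𝕜] H => S x)
    (absOp_intertwines hs' hg' hs hg hT2)
  have hG := fun x => congrArg (fun S : H →L[𝕜] H' => S x) hT
  have hG2 := fun x => congrArg (fun S : H' →L[𝕜] H => S x) hT2
  simp only [ContinuousLinearMap.comp_apply] at hR hR2 hG hG2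
  ext x
  have hP : (LinearMap.ker (absOp g' - g').toLinearMap).starProjection (T x) =
      T ((LinearMap.ker (absOp g - g).toLinearMap).starProjection x) := by
    refine Submodule.eq_starProjection_of_mem_orthogonal'
      (K := LinearMap.ker (absOp g' - g').toLinearMap)
      (z := T (x - (LinearMap.ker (absOp g - g).toLinearMap).starProjection x)) ?_ ?_ ?_
    · have h1 := (LinearMap.ker (absOp g - g).toLinearMap).starProjection_apply_mem x
      have h2 : (absOp g - g) ((LinearMap.ker (absOp g - g).toLinearMap).starProjection x) = 0 := h1
      change (absOp g' - g') (T _) = 0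
      rw [sub_apply, ← hR, ← hG, ← map_sub, ← sub_apply,
        h2, map_zero]
    · intro y hy
      have hy' : (absOp g' - g') y = 0 := hy
      rw [← ContinuousLinearMap.adjoint_inner_left]
      refine Submodule.sub_starProjection_mem_orthogonal x _ ?_
      change (absOp g - g) _ = 0
      rw [sub_apply, ← hR2, ← hG2, ← map_sub, ← sub_apply,
        hy', map_zero]
    · rw [← map_add]; simp
  simp only [signOp, ContinuousLinearMap.comp_apply, sub_apply, smul_apply, hP, map_sub, map_smul,
    one_apply_eq_self]

end OperatorSign

section HilbertModels

universe u₁ v₁ w₁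

variable {𝕜 : Type u₁} [RCLike 𝕜] {ι : Type v₁} {F : ι → Type w₁}
  [∀ i, NormedAddCommGroup (F i)] [∀ i, InnerProductSpace 𝕜 (F i)]

section FiniteSections

variable {H H' : Type*} [NormedAddCommGroup H] [InnerProductSpace 𝕜 H]
  [NormedAddCommGroup H'] [InnerProductSpace 𝕜 H']

lemma DFinsupp.exists_eq_fin_sum_single [DecidableEq ι] (d : Π₀ i, F i) :
    ∃ (n : ℕ) (x : Fin n → ι) (h : ∀ k, F (x k)), d = ∑ k, DFinsupp.single (x k) (h k) := by
  classical
  refine ⟨d.support.card, fun k => d.support.equivFin.symm k, fun k => d _, ?_⟩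
  have h := (DFinsupp.sum_single (f := d)).symm
  rw [DFinsupp.sum, ← Finset.sum_coe_sort] at h
  rw [Equiv.sum_comp d.support.equivFin.symm (fun i : d.support => DFinsupp.single (i : ι) (d i))]
  exact h

lemma denseRange_lsum [DecidableEq ι] {V : ∀ i, F i →L[𝕜] H}
    (hd : Dense (Submodule.span 𝕜 (⋃ i, Set.range (V i)) : Set H)) :
    DenseRange (DFinsupp.lsum ℕ (fun i => (V i).toLinearMap)) := by
  refine hd.mono ?_
  rw [← LinearMap.coe_range, SetLike.coe_subset_coe, Submodule.span_le]
  refine Set.iUnion_subset fun i => ?_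
  rintro _ ⟨h, rfl⟩
  exact ⟨DFinsupp.single i h, by simp⟩

/-- A closed property of vectors can be checked on finite sums from a total family. -/
lemma forall_of_fin_sum {V : ∀ i, F i →L[𝕜] H}
    (hd : Dense (Submodule.span 𝕜 (⋃ i, Set.range (V i)) : Set H)) {P : H → Prop}
    (hP : IsClosed {v | P v})
    (h : ∀ (n : ℕ) (x : Fin n → ι) (h : ∀ k, F (x k)), P (∑ k, V (x k) (h k))) (v : H) : P v := by
  classical
  refine (denseRange_lsum hd).induction_on v hP fun d => ?_
  obtain ⟨n, x, f, rfl⟩ := DFinsupp.exists_eq_fin_sum_single d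
  simpa [map_sum] using h n x f

lemma ext_of_total {V : ∀ i, F i →L[𝕜] H}
    (hd : Dense (Submodule.span 𝕜 (⋃ i, Set.range (V i)) : Set H)) {T T' : H →L[𝕜] H'}
    (h : ∀ i k, T (V i k) = T' (V i k)) : T = T' := by
  ext v
  refine forall_of_fin_sum hd (isClosed_eq T.continuous T'.continuous) (fun n x f => ?_) v
  simp [map_sum, h]

lemma exists_extension [CompleteSpace H'] {V : ∀ i, F i →L[𝕜] H}
    (hd : Dense (Submodule.span 𝕜 (⋃ i, Set.range (V i)) : Set H)) {W : ∀ i, F i →L[𝕜] H'} {C : ℝ}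
    (hC : ∀ (n : ℕ) (x : Fin n → ι) (h : ∀ k, F (x k)),
      ‖∑ k, W (x k) (h k)‖ ≤ C * ‖∑ k, V (x k) (h k)‖) :
    ∃ T : H →L[𝕜] H', ∀ i k, T (V i k) = W i k := by
  classical
  refine ⟨(DFinsupp.lsum ℕ fun i => (W i).toLinearMap).extendOfNorm
    (DFinsupp.lsum ℕ fun i => (V i).toLinearMap), fun i k => ?_⟩
  have h := LinearMap.extendOfNorm_eq (f := DFinsupp.lsum ℕ fun i => (W i).toLinearMap)
    (denseRange_lsum hd) ⟨C, fun d => ?_⟩ (DFinsupp.single i k)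
  · simpa using h
  · obtain ⟨n, x, f, rfl⟩ := DFinsupp.exists_eq_fin_sum_single d
    simpa [map_sum] using hC n x f

/-- The quadratic form of a kernel represented by a family of operators is a squared norm. -/
lemma sum_inner_eq_inner {m n : ℕ} {x : Fin n → ι} {y : Fin m → ι} (V : ∀ i, F i →L[𝕜] H)
    (V' : ∀ i, F i →L[𝕜] H)
    {L : ∀ j i, F i →L[𝕜] F j} (hV : ∀ i j k h, ⟪L i j k, h⟫_𝕜 = ⟪V j k, V' i h⟫_𝕜)
    (f : ∀ k, F (x k)) (g : ∀ k, F (y k)) :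
    ∑ k, ∑ l, ⟪L (y l) (x k) (f k), g l⟫_𝕜 = ⟪∑ k, V (x k) (f k), ∑ l, V' (y l) (g l)⟫_𝕜 := by
  simp only [sum_inner, inner_sum, hV]
  exact Finset.sum_comm

end FiniteSections

/-- A Hilbert space linearisation of a positive semidefinite kernel. -/
structure HilbertModel (L : ∀ j i, F i →L[𝕜] F j) where
  carrier : Type (max v₁ w₁)
  [ng : NormedAddCommGroup carrier]
  [ip : InnerProductSpace 𝕜 carrier]
  [cs : CompleteSpace carrier]
  V : ∀ i, F i →L[𝕜] carrier
  inner_V : ∀ i j k h, ⟪L i j k, h⟫_𝕜 = ⟪V j k, V i h⟫_𝕜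
  total : Dense (Submodule.span 𝕜 (⋃ i, Set.range (V i)) : Set carrier)

attribute [instance] HilbertModel.ng HilbertModel.ip HilbertModel.cs

variable {L K : ∀ j i, F i →L[𝕜] F j}

lemma HilbertModel.re_sum_eq_norm_sq (M : HilbertModel L) {n : ℕ} (x : Fin n → ι)
    (f : ∀ k, F (x k)) :
    RCLike.re (∑ k, ∑ l, ⟪L (x l) (x k) (f k), f l⟫_𝕜) = ‖∑ k, M.V (x k) (f k)‖ ^ 2 := by
  rw [sum_inner_eq_inner M.V M.V M.inner_V, inner_self_eq_norm_sq]

open Classical in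
/-- The sesquilinear form of a kernel on finitely supported sections. -/
def kernelForm (L : ∀ j i, F i →L[𝕜] F j) (f g : Π₀ i, F i) : 𝕜 :=
  ∑ i ∈ f.support, ∑ j ∈ g.support, ⟪L j i (f i), g j⟫_𝕜

open Classical in
lemma kernelForm_eq (L : ∀ j i, F i →L[𝕜] F j) {f g : Π₀ i, F i} {s t : Finset ι}
    (hs : f.support ⊆ s) (ht : g.support ⊆ t) :
    kernelForm L f g = ∑ i ∈ s, ∑ j ∈ t, ⟪L j i (f i), g j⟫_𝕜 := by
  rw [kernelForm, Finset.sum_subset hs]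
  · refine Finset.sum_congr rfl fun i _ => Finset.sum_subset ht fun j _ hj => ?_
    rw [DFinsupp.notMem_support_iff.1 hj, inner_zero_right]
  · intro i _ hi
    simp [DFinsupp.notMem_support_iff.1 hi]

variable [∀ i, CompleteSpace (F i)]

open Classical in
/-- The pre-inner product defined by a positive semidefinite kernel. -/
@[reducible]
def kernelCore (L : ∀ j i, F i →L[𝕜] F j)
    (herm : ∀ i j, ContinuousLinearMap.adjoint (L i j) = L j i)
    (psd : ∀ (n : ℕ) (x : Fin n → ι) (h : ∀ k, F (x k)),
      0 ≤ RCLike.re (∑ k, ∑ l, ⟪L (x l) (x k) (h k), h l⟫_𝕜)) :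
    PreInnerProductSpace.Core 𝕜 (Π₀ i, F i) where
  inner := kernelForm L
  conj_inner_symm f g := by
    rw [kernelForm, kernelForm, Finset.sum_comm]
    simp only [map_sum, inner_conj_symm]
    refine Finset.sum_congr rfl fun i _ => Finset.sum_congr rfl fun j _ => ?_
    rw [← herm i j, ContinuousLinearMap.adjoint_inner_left]
  re_inner_nonneg f := by
    have h := psd f.support.card (fun k => f.support.equivFin.symm k) fun k => f _
    rw [kernelForm, ← Finset.sum_coe_sort]
    simp only [← Finset.sum_coe_sort f.support]
    rw [← Equiv.sum_comp f.support.equivFin.symm]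
    simp only [← Equiv.sum_comp f.support.equivFin.symm (fun j : f.support => ⟪L j _ (f _), f j⟫_𝕜)]
    exact h
  add_left f f' g := by
    rw [kernelForm_eq L (s := f.support ∪ f'.support ∪ (f + f').support)
        Finset.subset_union_right subset_rfl,
      kernelForm_eq L (s := f.support ∪ f'.support ∪ (f + f').support)
        (Finset.subset_union_left.trans Finset.subset_union_left) subset_rfl,
      kernelForm_eq L (s := f.support ∪ f'.support ∪ (f + f').support)
        (Finset.subset_union_right.trans Finset.subset_union_left) subset_rfl]
    simp [inner_add_left, Finset.sum_add_distrib]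
  smul_left f g r := by
    rw [kernelForm_eq L (s := f.support ∪ (r • f).support)
        Finset.subset_union_right subset_rfl,
      kernelForm_eq L (s := f.support ∪ (r • f).support)
        Finset.subset_union_left subset_rfl]
    simp [inner_smul_left, Finset.mul_sum]

/-- Kolmogorov decomposition of a positive semidefinite kernel. -/
theorem HilbertModel.nonempty (L : ∀ j i, F i →L[𝕜] F j)
    (herm : ∀ i j, ContinuousLinearMap.adjoint (L i j) = L j i)
    (psd : ∀ (n : ℕ) (x : Fin n → ι) (h : ∀ k, F (x k)),
      0 ≤ RCLike.re (∑ k, ∑ l, ⟪L (x l) (x k) (h k), h l⟫_𝕜)) :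
    Nonempty (HilbertModel L) := by
  classical
  let core := kernelCore L herm psd
  let : SeminormedAddCommGroup (Π₀ i, F i) :=
    InnerProductSpace.Core.toSeminormedAddCommGroup (𝕜 := 𝕜)
  let : InnerProductSpace 𝕜 (Π₀ i, F i) := .ofCore core
  have hinner : ∀ i j (k : F j) (h : F i),
      ⟪(DFinsupp.single j k : Π₀ i, F i), DFinsupp.single i h⟫_𝕜 = ⟪L i j k, h⟫_𝕜 := by
    intro i j k h
    change kernelForm L _ _ = _
    rw [kernelForm_eq L (DFinsupp.support_single_subset) (DFinsupp.support_single_subset)]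
    simp
  let V₀ : ∀ i, F i →ₗ[𝕜] UniformSpace.Completion (Π₀ i, F i) := fun i =>
    (UniformSpace.Completion.toComplₗᵢ (𝕜 := 𝕜) (E := Π₀ i, F i)).toLinearMap ∘ₗ
      DFinsupp.lsingle i
  have hV₀ : ∀ i j (k : F j) (h : F i), ⟪L i j k, h⟫_𝕜 = ⟪V₀ j k, V₀ i h⟫_𝕜 := by
    intro i j k h
    rw [← hinner]
    exact (UniformSpace.Completion.inner_coe _ _).symm
  refine ⟨⟨UniformSpace.Completion (Π₀ i, F i), fun i => (V₀ i).mkContinuous (√‖L i i‖)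
    fun k => ?_, hV₀, ?_⟩⟩
  · refine (sq_le_sq₀ (norm_nonneg _) (by positivity)).1 ?_
    rw [← inner_self_eq_norm_sq (𝕜 := 𝕜), ← hV₀, mul_pow, Real.sq_sqrt (norm_nonneg _), sq,
      ← mul_assoc]
    exact (RCLike.re_le_norm _).trans ((norm_inner_le_norm _ _).trans
      (mul_le_mul_of_nonneg_right ((L i i).le_opNorm k) (norm_nonneg _)))
  · refine (UniformSpace.Completion.denseRange_coe (α := Π₀ i, F i)).mono ?_
    rintro _ ⟨d, rfl⟩
    obtain ⟨n, x, f, rfl⟩ := DFinsupp.exists_eq_fin_sum_single d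
    have : ((∑ k, DFinsupp.single (x k) (f k) : Π₀ i, F i) :
        UniformSpace.Completion (Π₀ i, F i)) = ∑ k, V₀ (x k) (f k) :=
      map_sum (UniformSpace.Completion.toComplₗᵢ (𝕜 := 𝕜) (E := Π₀ i, F i)) _ _
    rw [this]
    exact Submodule.sum_mem _ fun k _ =>
      Submodule.subset_span (Set.mem_iUnion.2 ⟨x k, f k, rfl⟩)

/-- The Gram operator of a Hermitian kernel `K` with `-L ≤ K ≤ L`. -/
theorem HilbertModel.exists_gram (M : HilbertModel L)
    (hermL : ∀ i j, ContinuousLinearMap.adjoint (L i j) = L j i)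
    (hermK : ∀ i j, ContinuousLinearMap.adjoint (K i j) = K j i)
    (hadd : ∀ (n : ℕ) (x : Fin n → ι) (h : ∀ k, F (x k)),
      0 ≤ RCLike.re (∑ k, ∑ l, ⟪(L (x l) (x k) + K (x l) (x k)) (h k), h l⟫_𝕜))
    (hsub : ∀ (n : ℕ) (x : Fin n → ι) (h : ∀ k, F (x k)),
      0 ≤ RCLike.re (∑ k, ∑ l, ⟪(L (x l) (x k) - K (x l) (x k)) (h k), h l⟫_𝕜)) :
    ∃ g : M.carrier →L[𝕜] M.carrier, IsSelfAdjoint g ∧ ‖g‖ ≤ 1 ∧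
      ∀ i j k h, ⟪K i j k, h⟫_𝕜 = ⟪g (M.V j k), M.V i h⟫_𝕜 := by
  obtain ⟨N⟩ := HilbertModel.nonempty (fun i j => L i j + K i j)
    (fun i j => by simp [hermL, hermK]) hadd
  have hbd : ∀ (n : ℕ) (x : Fin n → ι) (f : ∀ k, F (x k)),
      ‖∑ k, N.V (x k) (f k)‖ ^ 2 ≤ 2 * ‖∑ k, M.V (x k) (f k)‖ ^ 2 := by
    intro n x f
    rw [← N.re_sum_eq_norm_sq, ← M.re_sum_eq_norm_sq]
    have h := hsub n x f
    simp only [sub_apply, add_apply, inner_sub_left, inner_add_left,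
      Finset.sum_sub_distrib, Finset.sum_add_distrib, map_sub, map_add] at h ⊢
    linarith
  obtain ⟨T, hT⟩ := exists_extension M.total (W := N.V) (C := √2) fun n x f => by
    refine (sq_le_sq₀ (norm_nonneg _) (by positivity)).1 ?_
    rw [mul_pow, Real.sq_sqrt zero_le_two]
    exact hbd n x f
  have hTn : ∀ v, ‖T v‖ ^ 2 ≤ 2 * ‖v‖ ^ 2 := by
    refine forall_of_fin_sum M.total (isClosed_le (by fun_prop) (by fun_prop)) fun n x f => ?_
    simpa [map_sum, hT] using hbd n x f
  have hTn' : ‖T‖ ≤ √2 := T.opNorm_le_bound (by positivity) fun v =>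
    (sq_le_sq₀ (norm_nonneg _) (by positivity)).1 (by
      rw [mul_pow, Real.sq_sqrt zero_le_two]; exact hTn v)
  refine ⟨ContinuousLinearMap.adjoint T ∘L T - 1, ?_, ?_, ?_⟩
  · exact IsSelfAdjoint.sub (by
      rw [IsSelfAdjoint, ContinuousLinearMap.star_eq_adjoint, ContinuousLinearMap.adjoint_comp,
        ContinuousLinearMap.adjoint_adjoint]) (IsSelfAdjoint.one _)
  · refine ContinuousLinearMap.opNorm_le_bound _ zero_le_one fun v => ?_
    rw [one_mul]
    refine (sq_le_sq₀ (norm_nonneg _) (norm_nonneg _)).1 ?_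
    have h1 : ‖ContinuousLinearMap.adjoint T (T v)‖ ^ 2 ≤ 2 * ‖T v‖ ^ 2 := by
      rw [← Real.sq_sqrt (zero_le_two (α := ℝ)), ← mul_pow]
      gcongr
      refine (ContinuousLinearMap.le_opNorm _ _).trans ?_
      gcongr
      rwa [LinearIsometryEquiv.norm_map]
    have h2 : ‖(ContinuousLinearMap.adjoint T ∘L T - 1) v‖ ^ 2 =
        ‖ContinuousLinearMap.adjoint T (T v)‖ ^ 2 - 2 * ‖T v‖ ^ 2 + ‖v‖ ^ 2 := by
      rw [← inner_self_eq_norm_sq (𝕜 := 𝕜) (T v), ← ContinuousLinearMap.adjoint_inner_left,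
        ← norm_sub_sq (𝕜 := 𝕜)]
      rfl
    rw [h2]
    linarith
  · intro i j k h
    have h1 := N.inner_V i j k h
    have h2 := M.inner_V i j k h
    rw [add_apply, inner_add_left] at h1
    simp only [sub_apply, ContinuousLinearMap.comp_apply, one_apply_eq_self, inner_sub_left,
      ContinuousLinearMap.adjoint_inner_left, hT, ← h1, ← h2]
    ring

end HilbertModels

section Fibres

/-- The fibre of the anchor map. -/
abbrev Fib (s : S) : Type v := {x : X // A.a x = s}

variable {A p}

/-- The action of a semigroupoid element from one fibre to another. -/
def actF (α : Γ) {s t : S} (hs : G.d α = s) (ht : G.c α = t) (x : Fib A s) : Fib A t :=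
  ⟨A.act α x, (A.a_act (hs.trans x.2.symm)).trans ht⟩

/-- The identification of the Hilbert spaces at `x` and at `α·x`. -/
def liftE (𝕜 : Type u) [RCLike 𝕜] {E : O → Type w}
    [∀ o, NormedAddCommGroup (E o)] [∀ o, InnerProductSpace 𝕜 (E o)]
    (hp : ∀ {α : Γ} {x : X}, G.d α = A.a x → p (A.act α x) = p x)
    (α : Γ) {s t : S} (hs : G.d α = s) (ht : G.c α = t) (x : Fib A s) :
    E (p x) ≃ₗᵢ[𝕜] E (p (actF α hs ht x)) :=
  (castE 𝕜 E (hp (hs.trans x.2.symm))).symm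

/-- The restriction of a kernel to a fibre. -/
abbrev fibK (K : ∀ y x : X, E (p x) →L[𝕜] E (p y)) (s : S) (y x : Fib A s) :
    E (p x) →L[𝕜] E (p y) := K y x

lemma GammaInvariant.inner_eq {K : ∀ y x : X, E (p x) →L[𝕜] E (p y)}
    (hK : GammaInvariant A p hp K) (α : Γ) {s t : S} (hs : G.d α = s) (ht : G.c α = t)
    (x : Fib A s) (y : Fib A t) (k : E (p y)) (h : E (p x)) :
    ⟪fibK K t (actF α hs ht x) y k, liftE 𝕜 hp α hs ht x h⟫_𝕜 =
      ⟪fibK K s x (actF (G.star α) ((G.d_star α).trans ht) ((G.c_star α).trans hs) y)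
        (liftE 𝕜 hp (G.star α) ((G.d_star α).trans ht) ((G.c_star α).trans hs) y k), h⟫_𝕜 := by
  have h1 := hK α x y (hs.trans x.2.symm) (ht.trans y.2.symm) k
  change _ = ⟪K x (A.act (G.star α) y) 
    ((castE 𝕜 E (hp ((G.d_star α).trans (ht.trans y.2.symm)))).symm k), h⟫_𝕜
  rw [← h1]
  exact (LinearIsometryEquiv.inner_map_eq_flip (castE 𝕜 E (hp (hs.trans x.2.symm))) _ h).symm

lemma PartHermitian.fib {K : ∀ y x : X, E (p x) →L[𝕜] E (p y)} (hK : PartHermitian A p K) {s : S}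
    (x y : Fib A s) : ContinuousLinearMap.adjoint (fibK K s x y) = fibK K s y x :=
  hK x y (x.2.trans y.2.symm)

lemma PartPSD.fib {K : ∀ y x : X, E (p x) →L[𝕜] E (p y)} (hK : PartPSD A p K) {s : S}
    (n : ℕ) (x : Fin n → Fib A s) (h : ∀ k, E (p (x k))) :
    0 ≤ RCLike.re (∑ k, ∑ l, ⟪fibK K s (x l) (x k) (h k), h l⟫_𝕜) :=
  hK.2 s n (fun k => x k) (fun k => (x k).2) h

theorem PartPSD.exists_model {L : ∀ y x : X, E (p x) →L[𝕜] E (p y)} (hL : PartPSD A p L) (s : S) :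
    Nonempty (HilbertModel (fibK (A := A) L s)) :=
  HilbertModel.nonempty _ hL.1.fib hL.fib

/-- A kernel represented fibrewise by a family of operators which is covariant under a
`*`-representation is partially positive semidefinite, `Γ`-invariant and of bounded shift type. -/
theorem isPSD_invariant_bounded_of_rep {L : ∀ y x : X, E (p x) →L[𝕜] E (p y)}
    {H : S → Type*} [∀ s, NormedAddCommGroup (H s)] [∀ s, InnerProductSpace 𝕜 (H s)]
    [∀ s, CompleteSpace (H s)] (W : ∀ s (x : Fib A s), E (p x) →L[𝕜] H s)
    (hW : ∀ s (x y : Fib A s) k h, ⟪fibK L s x y k, h⟫_𝕜 = ⟪W s y k, W s x h⟫_𝕜)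
    (Ψ : ∀ (α : Γ) {s t : S}, G.d α = s → G.c α = t → (H s →L[𝕜] H t))
    (hshift : ∀ (α : Γ) {s t : S} (hs : G.d α = s) (ht : G.c α = t) (x : Fib A s) (k : E (p x)),
      Ψ α hs ht (W s x k) = W t (actF α hs ht x) (liftE 𝕜 hp α hs ht x k))
    (hstar : ∀ (α : Γ) {s t : S} (hs : G.d α = s) (ht : G.c α = t),
      Ψ (G.star α) ((G.d_star α).trans ht) ((G.c_star α).trans hs) =
        ContinuousLinearMap.adjoint (Ψ α hs ht)) :
    PartPSD A p L ∧ GammaInvariant A p hp L ∧ BoundedShiftType A p hp L := by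
  refine ⟨⟨fun x y hxy => ?_, fun s n x hx h => ?_⟩, fun α x y hx hy k => ?_, fun α => ?_⟩
  · refine ContinuousLinearMap.ext fun k => ext_inner_right 𝕜 fun h => ?_
    rw [ContinuousLinearMap.adjoint_inner_left, ← inner_conj_symm]
    rw [hW (A.a x) ⟨x, rfl⟩ ⟨y, hxy.symm⟩, inner_conj_symm]
    exact (hW (A.a x) ⟨y, hxy.symm⟩ ⟨x, rfl⟩ k h).symm
  · have h1 := sum_inner_eq_inner (W s) (W s) (hW s) (x := fun k => ⟨x k, hx k⟩)
      (y := fun k => ⟨x k, hx k⟩) h h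
    change 0 ≤ RCLike.re (∑ k, ∑ l, ⟪fibK L s ⟨x l, hx l⟩ ⟨x k, hx k⟩ (h k), h l⟫_𝕜)
    rw [h1]
    exact inner_self_nonneg
  · refine ext_inner_right 𝕜 fun h => ?_
    have h1 := hW (G.c α) (actF α rfl rfl ⟨x, hx.symm⟩) ⟨y, hy.symm⟩ k
      (liftE 𝕜 hp α rfl rfl (⟨x, hx.symm⟩ : Fib A (G.d α)) h)
    rw [← hshift, ← ContinuousLinearMap.adjoint_inner_left, ← hstar, hshift, ← hW] at h1
    rw [LinearIsometryEquiv.inner_map_eq_flip]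
    exact h1
  · refine ⟨‖Ψ α rfl rfl‖ ^ 2, sq_nonneg _, fun n z hz g => ?_⟩
    have h1 := sum_inner_eq_inner (W (G.d α)) (W (G.d α)) (hW (G.d α))
      (x := fun k => ⟨z k, (hz k).symm⟩) (y := fun k => ⟨z k, (hz k).symm⟩) g g
    have h2 := sum_inner_eq_inner (W (G.c α)) (W (G.c α)) (hW (G.c α))
      (x := fun k => actF α rfl rfl (⟨z k, (hz k).symm⟩ : Fib A (G.d α)))
      (y := fun k => actF α rfl rfl (⟨z k, (hz k).symm⟩ : Fib A (G.d α)))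
      (fun k => liftE 𝕜 hp α rfl rfl (⟨z k, (hz k).symm⟩ : Fib A (G.d α)) (g k))
      (fun k => liftE 𝕜 hp α rfl rfl (⟨z k, (hz k).symm⟩ : Fib A (G.d α)) (g k))
    simp only [← hshift, ← map_sum] at h2
    change RCLike.re (∑ i, ∑ j, ⟪fibK L (G.c α)
      (actF α rfl rfl (⟨z j, (hz j).symm⟩ : Fib A (G.d α)))
      (actF α rfl rfl (⟨z i, (hz i).symm⟩ : Fib A (G.d α)))
      (liftE 𝕜 hp α rfl rfl (⟨z i, (hz i).symm⟩ : Fib A (G.d α)) (g i)),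
      liftE 𝕜 hp α rfl rfl (⟨z j, (hz j).symm⟩ : Fib A (G.d α)) (g j)⟫_𝕜) ≤
      _ * RCLike.re (∑ i, ∑ j, ⟪fibK L (G.d α) ⟨z j, (hz j).symm⟩ ⟨z i, (hz i).symm⟩ (g i), g j⟫_𝕜)
    rw [h1, h2, inner_self_eq_norm_sq, inner_self_eq_norm_sq, ← mul_pow]
    gcongr
    exact ContinuousLinearMap.le_opNorm _ _

variable (A p) in
/-- A Krein space linearisation with a representation commuting with the fundamental
symmetries, indexed by fibres so that no transport is needed. -/
structure FibKLin (K : ∀ y x : X, E (p x) →L[𝕜] E (p y)) where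
  Ksp : S → KSp.{u, w'} 𝕜
  V : ∀ s (x : Fib A s), E (p x) →L[𝕜] (Ksp s).carrier
  lin : ∀ s (x y : Fib A s) k h, ⟪fibK K s x y k, h⟫_𝕜 = ⟪(Ksp s).J (V s y k), V s x h⟫_𝕜
  total : ∀ s, Dense (Submodule.span 𝕜 (⋃ x, Set.range (V s x)) : Set (Ksp s).carrier)
  Ψ : ∀ (α : Γ) {s t : S}, G.d α = s → G.c α = t → ((Ksp s).carrier →L[𝕜] (Ksp t).carrier)
  mul : ∀ (α β : Γ) {r s t : S} (hr : G.d β = r) (hs : G.c β = s) (hs' : G.d α = s)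
    (ht : G.c α = t), Ψ (G.mul α β) ((G.d_mul (hs'.trans hs.symm)).trans hr)
      ((G.c_mul (hs'.trans hs.symm)).trans ht) = Ψ α hs' ht ∘L Ψ β hr hs
  star : ∀ (α : Γ) {s t : S} (hs : G.d α = s) (ht : G.c α = t),
    Ψ (G.star α) ((G.d_star α).trans ht) ((G.c_star α).trans hs) =
      ContinuousLinearMap.adjoint (Ψ α hs ht)
  shift : ∀ (α : Γ) {s t : S} (hs : G.d α = s) (ht : G.c α = t) (x : Fib A s) (k : E (p x)),
    Ψ α hs ht (V s x k) = V t (actF α hs ht x) (liftE 𝕜 hp α hs ht x k)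
  comm : ∀ (α : Γ) {s t : S} (hs : G.d α = s) (ht : G.c α = t),
    Ψ α hs ht ∘L (Ksp s).J = (Ksp t).J ∘L Ψ α hs ht

variable {K : ∀ y x : X, E (p x) →L[𝕜] E (p y)}

lemma KSp.J_J (𝒦 : KSp.{u, w'} 𝕜) (f : 𝒦.carrier) : 𝒦.J (𝒦.J f) = f :=
  congrArg (fun T : 𝒦.carrier →L[𝕜] 𝒦.carrier => T f) 𝒦.J_sq

lemma KSp.inner_J (𝒦 : KSp.{u, w'} 𝕜) (f g : 𝒦.carrier) : ⟪𝒦.J f, g⟫_𝕜 = ⟪f, 𝒦.J g⟫_𝕜 := by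
  conv_lhs => rw [← 𝒦.J_adj]
  exact ContinuousLinearMap.adjoint_inner_left _ _ _

lemma castK_castK {𝒦 : S → KSp.{u, w'} 𝕜} {r s t : S} (h : r = s) (h' : s = t)
    (f : (𝒦 r).carrier) : castK 𝕜 𝒦 h' (castK 𝕜 𝒦 h f) = castK 𝕜 𝒦 (h.trans h') f := by
  subst h h'; rfl

lemma InvKLin.nonempty_fibKLin (T : InvKLin.{u, uΓ, uS, v, vO, w, w'} 𝕜 E A p hp K)
    (hmin : IsMinimalPartKLin A p T.Ksp T.V)
    (hcomm : ∀ (α : Γ) (g : (T.Ksp (G.d α)).carrier),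
      T.Ψ α ((T.Ksp (G.d α)).J g) = (T.Ksp (G.c α)).J (T.Ψ α g)) :
    Nonempty (FibKLin.{u, uΓ, uS, v, vO, w, w'} A p hp K) := by
  refine ⟨⟨T.Ksp, fun s x => (castK 𝕜 T.Ksp x.2).toContinuousLinearEquiv.toContinuousLinearMap ∘L
    T.V x, ?_, hmin, fun α s t hs ht =>
    (castK 𝕜 T.Ksp ht).toContinuousLinearEquiv.toContinuousLinearMap ∘L T.Ψ α ∘L
      (castK 𝕜 T.Ksp hs.symm).toContinuousLinearEquiv.toContinuousLinearMap, ?_, ?_, ?_, ?_⟩⟩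
  · rintro s ⟨x, rfl⟩ ⟨y, hy⟩ k h
    exact T.lin x y hy k h
  · intro α β r s t hr hs hs' ht
    subst hr hs ht
    ext f
    have h := T.Ψ_mul α β hs' f
    change castK 𝕜 T.Ksp _ (T.Ψ _ (castK 𝕜 T.Ksp _ f)) = T.Ψ α (castK 𝕜 T.Ksp _ (T.Ψ β f))
    rw [h, castK_castK]
    rfl
  · intro α s t hs ht
    subst hs ht
    ext g
    have h := T.Ψ_star α g
    change castK 𝕜 T.Ksp _ (T.Ψ _ (castK 𝕜 T.Ksp _ g)) = ContinuousLinearMap.adjoint (T.Ψ α) g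
    rw [h]
    refine ext_inner_right 𝕜 fun f => ?_
    rw [KSp.inner_J, ContinuousLinearMap.adjoint_inner_left,
      ContinuousLinearMap.adjoint_inner_left, hcomm, KSp.inner_J, KSp.J_J]
  · rintro α s t hs ht ⟨x, rfl⟩ k
    subst ht
    exact T.Ψ_shift α x hs k
  · intro α s t hs ht
    subst hs ht
    ext g
    exact hcomm α g

lemma FibKLin.castK_V (T : FibKLin.{u, uΓ, uS, v, vO, w, w'} A p hp K) {s t : S} (h : s = t)
    (x : Fib A s) (k : E (p x)) :
    castK 𝕜 T.Ksp h (T.V s x k) = T.V t ⟨x, x.2.trans h⟩ k := by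
  subst h; rfl

lemma FibKLin.castK_Ψ (T : FibKLin.{u, uΓ, uS, v, vO, w, w'} A p hp K) (α : Γ) {s s' t t' : S}
    (hs : G.d α = s) (ht : G.c α = t) (h : s' = s) (h' : t = t') (f : (T.Ksp s').carrier) :
    castK 𝕜 T.Ksp h' (T.Ψ α hs ht (castK 𝕜 T.Ksp h f)) =
      T.Ψ α (hs.trans h.symm) (ht.trans h') f := by
  subst h h'; rfl

lemma FibKLin.Ψ_castK (T : FibKLin.{u, uΓ, uS, v, vO, w, w'} A p hp K) (α : Γ) {s s' t : S}
    (hs : G.d α = s) (ht : G.c α = t) (h : s' = s) (f : (T.Ksp s').carrier) :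
    T.Ψ α hs ht (castK 𝕜 T.Ksp h f) = T.Ψ α (hs.trans h.symm) ht f :=
  T.castK_Ψ hp α hs ht h rfl f

/-- The linearisation with transports associated with a fibre-indexed one. -/
def FibKLin.toInvKLin (T : FibKLin.{u, uΓ, uS, v, vO, w, w'} A p hp K) :
    InvKLin.{u, uΓ, uS, v, vO, w, w'} 𝕜 E A p hp K where
  Ksp := T.Ksp
  V x := T.V (A.a x) ⟨x, rfl⟩
  lin x y hxy k h := by
    rw [T.castK_V]
    exact T.lin (A.a x) ⟨x, rfl⟩ ⟨y, hxy⟩ k h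
  Ψ α := T.Ψ α rfl rfl
  Ψ_mul α β hc f := by
    rw [T.Ψ_castK, T.Ψ_castK, T.mul α β rfl rfl hc (G.c_mul hc).symm]
    exact (T.castK_Ψ hp α _ _ rfl (G.c_mul hc).symm _).symm
  Ψ_star α g := by
    rw [T.castK_Ψ, T.star α rfl rfl]
    refine ext_inner_right 𝕜 fun f => ?_
    have h := congrArg (fun S => S f) (T.comm α rfl rfl)
    simp only [ContinuousLinearMap.comp_apply] at h
    rw [KSp.inner_J, ContinuousLinearMap.adjoint_inner_left,
      ContinuousLinearMap.adjoint_inner_left, h, KSp.inner_J, KSp.J_J]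
  Ψ_shift α x hx h := by
    rw [T.Ψ_castK, T.castK_V]
    exact T.shift α hx rfl ⟨x, rfl⟩ h

lemma FibKLin.isMinimal (T : FibKLin.{u, uΓ, uS, v, vO, w, w'} A p hp K) :
    IsMinimalPartKLin A p (T.toInvKLin hp).Ksp (T.toInvKLin hp).V := by
  intro s
  have h : ∀ x : Fib A s, (fun k => castK 𝕜 T.Ksp x.2 (T.V (A.a x) ⟨x, rfl⟩ k)) = T.V s x :=
    fun x => funext fun k => T.castK_V hp x.2 ⟨x, rfl⟩ k
  have hd := T.total s
  simp only [← h] at hd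
  exact hd

end Fibres

section Decomposition

variable {A p} {K : ∀ y x : X, E (p x) →L[𝕜] E (p y)}

open Classical in
/-- The kernel represented on each fibre by `V_y* B V_x`, and equal to `K₀` off the fibres. -/
def FibKLin.compress (T : FibKLin.{u, uΓ, uS, v, vO, w, w'} A p hp K)
    (B : ∀ s, (T.Ksp s).carrier →L[𝕜] (T.Ksp s).carrier)
    (K₀ : ∀ y x : X, E (p x) →L[𝕜] E (p y)) (y x : X) : E (p x) →L[𝕜] E (p y) :=
  if h : A.a x = A.a y then
    ContinuousLinearMap.adjoint (T.V (A.a y) ⟨y, rfl⟩) ∘L B (A.a y) ∘L T.V (A.a y) ⟨x, h⟩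
  else K₀ y x

lemma FibKLin.inner_compress (T : FibKLin.{u, uΓ, uS, v, vO, w, w'} A p hp K)
    (B : ∀ s, (T.Ksp s).carrier →L[𝕜] (T.Ksp s).carrier)
    (K₀ : ∀ y x : X, E (p x) →L[𝕜] E (p y)) (s : S) (y x : Fib A s) (k : E (p x)) (h : E (p y)) :
    ⟪fibK (T.compress hp B K₀) s y x k, h⟫_𝕜 = ⟪B s (T.V s x k), T.V s y h⟫_𝕜 := by
  obtain ⟨y, rfl⟩ := y
  obtain ⟨x, hx⟩ := x
  simp only [fibK, compress, dif_pos hx, ContinuousLinearMap.comp_apply,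
    ContinuousLinearMap.adjoint_inner_left]

theorem FibKLin.compress_spec (T : FibKLin.{u, uΓ, uS, v, vO, w, w'} A p hp K)
    (B : ∀ s, (T.Ksp s).carrier →L[𝕜] (T.Ksp s).carrier)
    (hB : ∀ s f g, ⟪B s f, g⟫_𝕜 = ⟪B s f, B s g⟫_𝕜)
    (hcomm : ∀ (α : Γ) {s t : S} (hs : G.d α = s) (ht : G.c α = t) f,
      T.Ψ α hs ht (B s f) = B t (T.Ψ α hs ht f))
    (K₀ : ∀ y x : X, E (p x) →L[𝕜] E (p y)) :
    PartPSD A p (T.compress hp B K₀) ∧ GammaInvariant A p hp (T.compress hp B K₀) ∧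
      BoundedShiftType A p hp (T.compress hp B K₀) := by
  refine isPSD_invariant_bounded_of_rep hp (fun s x => B s ∘L T.V s x) (fun s x y k h => ?_) T.Ψ
    (fun α s t hs ht x k => ?_) T.star
  · rw [T.inner_compress, hB]
    rfl
  · simp only [ContinuousLinearMap.comp_apply, hcomm, T.shift]

/-- The fundamental projections of a Krein space. -/
def KSp.proj (𝒦 : KSp.{u, w'} 𝕜) (ε : 𝕜) : 𝒦.carrier →L[𝕜] 𝒦.carrier :=
  (2⁻¹ : 𝕜) • (1 + ε • 𝒦.J)

lemma KSp.proj_apply (𝒦 : KSp.{u, w'} 𝕜) (ε : 𝕜) (f : 𝒦.carrier) :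
    𝒦.proj ε f = (2⁻¹ : 𝕜) • (f + ε • 𝒦.J f) := rfl

lemma KSp.inner_proj (𝒦 : KSp.{u, w'} 𝕜) {ε : 𝕜} (h1 : ε * ε = 1)
    (h2 : (starRingEnd 𝕜) ε = ε) (f g : 𝒦.carrier) :
    ⟪𝒦.proj ε f, g⟫_𝕜 = ⟪𝒦.proj ε f, 𝒦.proj ε g⟫_𝕜 := by
  have h3 : ⟪𝒦.J f, 𝒦.J g⟫_𝕜 = ⟪f, g⟫_𝕜 := by rw [𝒦.inner_J, 𝒦.J_J]
  have h4 := (𝒦.inner_J f g).symm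
  simp only [proj_apply, inner_smul_left, inner_smul_right, inner_add_left, inner_add_right, h2,
    h3, h4, map_inv₀, map_ofNat]
  linear_combination -(4⁻¹ : 𝕜) * ⟪f, g⟫_𝕜 * h1

lemma KSp.proj_one_add_proj (𝒦 : KSp.{u, w'} 𝕜) (f : 𝒦.carrier) :
    𝒦.proj 1 f + 𝒦.proj (-1) f = f := by
  simp only [proj_apply]
  module

lemma KSp.proj_one_sub_proj (𝒦 : KSp.{u, w'} 𝕜) (f : 𝒦.carrier) :
    𝒦.proj 1 f - 𝒦.proj (-1) f = 𝒦.J f := by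
  simp only [proj_apply]
  module

lemma KSp.proj_proj_neg (𝒦 : KSp.{u, w'} 𝕜) {ε : 𝕜} (h1 : ε * ε = 1) (f : 𝒦.carrier) :
    𝒦.proj ε (𝒦.proj (-ε) f) = 0 := by
  have : (ε * ε) • f = f := by rw [h1, one_smul]
  simp only [proj_apply, map_smul, map_add, 𝒦.J_J, map_neg, neg_smul, smul_neg, smul_add, smul_smul]
  linear_combination (norm := module) (-(4⁻¹ : 𝕜)) • this

/-- A positive semidefinite kernel dominated by both parts of the fundamental decomposition
vanishes on the fibres. -/
theorem FibKLin.disjoint_compress (T : FibKLin.{u, uΓ, uS, v, vO, w, w'} A p hp K)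
    (K₁ K₂ : ∀ y x : X, E (p x) →L[𝕜] E (p y)) :
    PDisjoint A p (T.compress hp (fun s => (T.Ksp s).proj 1) K₁)
      (T.compress hp (fun s => (T.Ksp s).proj (-1)) K₂) := by
  intro P hP hP₁ hP₂ y x hyx
  obtain ⟨N⟩ := hP.exists_model (A.a y)
  have hbd : ∀ (ε : 𝕜) (K₀ : ∀ y x : X, E (p x) →L[𝕜] E (p y)), ε * ε = 1 →
      (starRingEnd 𝕜) ε = ε → PKLE A p P (T.compress hp (fun s => (T.Ksp s).proj ε) K₀) →
      ∀ (n : ℕ) (z : Fin n → Fib A (A.a y)) (h : ∀ k, E (p (z k))),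
        ‖∑ k, N.V (z k) (h k)‖ ≤
          ‖(T.Ksp (A.a y)).proj ε (∑ k, T.V (A.a y) (z k) (h k))‖ := by
    intro ε K₀ h1 h2 hle n z h
    have h3 := PartPSD.fib hle n z h
    have h4 := sum_inner_eq_inner (x := z) (y := z)
      (L := fibK (T.compress hp (fun s => (T.Ksp s).proj ε) K₀) (A.a y))
      (fun x => (T.Ksp (A.a y)).proj ε ∘L T.V (A.a y) x)
      (fun x => (T.Ksp (A.a y)).proj ε ∘L T.V (A.a y) x)
      (fun x y k h => by
        rw [T.inner_compress, KSp.inner_proj _ h1 h2]; rfl) h h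
    simp only [sub_apply, inner_sub_left, Finset.sum_sub_distrib, map_sub] at h3
    rw [h4, N.re_sum_eq_norm_sq, inner_self_eq_norm_sq] at h3
    simp only [ContinuousLinearMap.comp_apply, ← map_sum] at h3
    exact (sq_le_sq₀ (norm_nonneg _) (norm_nonneg _)).1 (sub_nonneg.1 h3)
  obtain ⟨W, hW⟩ := exists_extension (T.total (A.a y)) (W := N.V)
    (C := ‖(T.Ksp (A.a y)).proj (1 : 𝕜)‖) fun n z h =>
      (hbd 1 K₁ (one_mul _) (map_one _) hP₁ n z h).trans (ContinuousLinearMap.le_opNorm _ _)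
  have hzero : ∀ (ε : 𝕜) (K₀ : ∀ y x : X, E (p x) →L[𝕜] E (p y)), ε * ε = 1 →
      (starRingEnd 𝕜) ε = ε → PKLE A p P (T.compress hp (fun s => (T.Ksp s).proj ε) K₀) →
      ∀ v, W ((T.Ksp (A.a y)).proj (-ε) v) = 0 := by
    intro ε K₀ h1 h2 hle v
    have h3 : ∀ v, ‖W v‖ ≤ ‖(T.Ksp (A.a y)).proj ε v‖ :=
      forall_of_fin_sum (T.total (A.a y)) (isClosed_le (by fun_prop) (by fun_prop)) fun n z h => by
        rw [map_sum]
        simp only [hW]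
        exact hbd ε K₀ h1 h2 hle n z h
    have h4 := h3 ((T.Ksp (A.a y)).proj (-ε) v)
    rw [KSp.proj_proj_neg _ h1, norm_zero] at h4
    exact norm_le_zero_iff.1 h4
  have hW0 : ∀ v, W v = 0 := fun v => by
    have h1 := hzero 1 K₁ (one_mul _) (map_one _) hP₁ v
    have h2 := hzero (-1) K₂ (by ring) (by simp) hP₂ v
    rw [neg_neg] at h2
    rw [← (T.Ksp (A.a y)).proj_one_add_proj v, map_add, h1, h2, add_zero]
  refine ContinuousLinearMap.ext fun k => ext_inner_right 𝕜 fun h => ?_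
  have h1 := N.inner_V ⟨y, rfl⟩ ⟨x, hyx⟩ k h
  rw [← hW, hW0, inner_zero_left] at h1
  rw [zero_apply, inner_zero_left]
  exact h1

theorem FibKLin.exists_disjoint_decomposition (T : FibKLin.{u, uΓ, uS, v, vO, w, w'} A p hp K) :
    ∃ K₁ K₂ : ∀ y x : X, E (p x) →L[𝕜] E (p y),
      PartPSD A p K₁ ∧ PartPSD A p K₂ ∧ GammaInvariant A p hp K₁ ∧ GammaInvariant A p hp K₂ ∧
      BoundedShiftType A p hp K₁ ∧ BoundedShiftType A p hp K₂ ∧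
      PDisjoint A p K₁ K₂ ∧ ∀ y x : X, K y x = K₁ y x - K₂ y x := by
  have hcomm : ∀ (ε : 𝕜) (α : Γ) {s t : S} (hs : G.d α = s) (ht : G.c α = t) f,
      T.Ψ α hs ht ((T.Ksp s).proj ε f) = (T.Ksp t).proj ε (T.Ψ α hs ht f) := by
    intro ε α s t hs ht f
    have h := congrArg (fun S => S f) (T.comm α hs ht)
    simp only [ContinuousLinearMap.comp_apply] at h
    simp only [KSp.proj_apply, map_smul, map_add, h]
  obtain ⟨h1, h2, h3⟩ := T.compress_spec hp (fun s => (T.Ksp s).proj 1)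
    (fun s => (T.Ksp s).inner_proj (one_mul _) (map_one _)) (hcomm 1) K
  obtain ⟨h1', h2', h3'⟩ := T.compress_spec hp (fun s => (T.Ksp s).proj (-1))
    (fun s => (T.Ksp s).inner_proj (by ring) (by simp)) (hcomm (-1)) 0
  refine ⟨_, _, h1, h1', h2, h2', h3, h3', T.disjoint_compress hp _ _, fun y x => ?_⟩
  by_cases h : A.a x = A.a y
  · refine ContinuousLinearMap.ext fun k => ext_inner_right 𝕜 fun l => ?_
    have e1 := T.inner_compress hp (fun s => (T.Ksp s).proj 1) K (A.a y) ⟨y, rfl⟩ ⟨x, h⟩ k l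
    have e2 := T.inner_compress hp (fun s => (T.Ksp s).proj (-1)) 0 (A.a y) ⟨y, rfl⟩ ⟨x, h⟩ k l
    rw [sub_apply, inner_sub_left]
    refine (T.lin (A.a y) ⟨y, rfl⟩ ⟨x, h⟩ k l).trans ?_
    rw [← KSp.proj_one_sub_proj, inner_sub_left, ← e1, ← e2]
  · simp [FibKLin.compress, dif_neg h]

end Decomposition

section InducedKreinSpace

universe w₁

variable {𝕜 : Type u} {H H' : Type w₁} [RCLike 𝕜]
  [NormedAddCommGroup H] [InnerProductSpace 𝕜 H] [CompleteSpace H]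
  [NormedAddCommGroup H'] [InnerProductSpace 𝕜 H'] [CompleteSpace H']

/-- The closure of the range of `|g|^{1/2}`. -/
def suppOp (g : H →L[𝕜] H) : Submodule 𝕜 H :=
  (LinearMap.range (sqrtAbsOp g).toLinearMap).topologicalClosure

instance (g : H →L[𝕜] H) : CompleteSpace (suppOp g) :=
  (Submodule.isClosed_topologicalClosure _).completeSpace_coe

variable {g : H →L[𝕜] H} {g' : H' →L[𝕜] H'}

lemma sqrtAbsOp_mem_suppOp (g : H →L[𝕜] H) (v : H) : sqrtAbsOp g v ∈ suppOp g :=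
  Submodule.le_topologicalClosure _ ⟨v, rfl⟩

lemma mapsTo_suppOp {T : H →L[𝕜] H'} (hT : T ∘L sqrtAbsOp g = sqrtAbsOp g' ∘L T) (v : suppOp g) :
    T v ∈ suppOp g' := by
  refine map_mem_closure T.continuous v.2 ?_
  rintro _ ⟨w, rfl⟩
  exact ⟨T w, (congrArg (fun S : H →L[𝕜] H' => S w) hT).symm⟩

/-- The operator induced between the supports by an intertwining operator. -/
def restrictSupp (T : H →L[𝕜] H') (hT : T ∘L sqrtAbsOp g = sqrtAbsOp g' ∘L T) :
    suppOp g →L[𝕜] suppOp g' :=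
  (T ∘L (suppOp g).subtypeL).codRestrict (suppOp g') (mapsTo_suppOp hT)

/-- The operator `|g|^{1/2}` with values in the support of `g`. -/
def sqrtAbsSupp (g : H →L[𝕜] H) : H →L[𝕜] suppOp g :=
  (sqrtAbsOp g).codRestrict (suppOp g) (sqrtAbsOp_mem_suppOp g)

lemma denseRange_sqrtAbsSupp (g : H →L[𝕜] H) : DenseRange (sqrtAbsSupp g) := by
  intro v
  rw [closure_subtype, ← Set.range_comp]
  exact v.2

lemma dense_span_sqrtAbsSupp {ι : Type*} {F : ι → Type*} [∀ i, NormedAddCommGroup (F i)]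
    [∀ i, InnerProductSpace 𝕜 (F i)] {V : ∀ i, F i →L[𝕜] H}
    (hV : Dense (Submodule.span 𝕜 (⋃ i, Set.range (V i)) : Set H)) :
    Dense (Submodule.span 𝕜 (⋃ i, Set.range (sqrtAbsSupp g ∘L V i)) : Set (suppOp g)) := by
  refine ((denseRange_sqrtAbsSupp g).dense_image (sqrtAbsSupp g).continuous hV).mono ?_
  rintro _ ⟨v, hv, rfl⟩
  have h : Submodule.span 𝕜 (⋃ i, Set.range (V i)) ≤
      (Submodule.span 𝕜 (⋃ i, Set.range (sqrtAbsSupp g ∘L V i))).comap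
        (sqrtAbsSupp g).toLinearMap := by
    rw [Submodule.span_le]
    refine Set.iUnion_subset fun i => ?_
    rintro _ ⟨k, rfl⟩
    exact Submodule.subset_span (Set.mem_iUnion.2 ⟨i, k, rfl⟩)
  exact h hv

lemma restrictSupp_eq_adjoint {T : H →L[𝕜] H'} {T' : H' →L[𝕜] H}
    (hT : T ∘L sqrtAbsOp g = sqrtAbsOp g' ∘L T) (hT' : T' ∘L sqrtAbsOp g' = sqrtAbsOp g ∘L T')
    (h : T' = ContinuousLinearMap.adjoint T) :
    restrictSupp T' hT' = ContinuousLinearMap.adjoint (restrictSupp T hT) := by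
  refine ContinuousLinearMap.ext fun f => ext_inner_right 𝕜 fun k => ?_
  rw [ContinuousLinearMap.adjoint_inner_left]
  change ⟪T' f.1, k.1⟫_𝕜 = ⟪f.1, T k.1⟫_𝕜
  rw [h, ContinuousLinearMap.adjoint_inner_left]

lemma sqrtAbsOp_comp_signOp (hs : IsSelfAdjoint g) (hg : ‖g‖ ≤ 1) :
    sqrtAbsOp g ∘L signOp g = signOp g ∘L sqrtAbsOp g :=
  signOp_intertwines hs hg hs hg (sqrtAbsOp_intertwines hs hg hs hg rfl).symm

lemma inner_signOp_sqrtAbsOp (hs : IsSelfAdjoint g) (hg : ‖g‖ ≤ 1) (v w : H) :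
    ⟪signOp g (sqrtAbsOp g v), sqrtAbsOp g w⟫_𝕜 = ⟪g v, w⟫_𝕜 := by
  have h1 := isSelfAdjoint_sqrtAbsOp hs hg
  rw [ContinuousLinearMap.isSelfAdjoint_iff'] at h1
  have h2 := congrArg (fun S : H →L[𝕜] H => S (sqrtAbsOp g v)) (sqrtAbsOp_comp_signOp hs hg)
  have h3 := congrArg (fun S : H →L[𝕜] H => S v) (sqrtAbsOp_mul_self hs hg)
  have h4 := congrArg (fun S : H →L[𝕜] H => S v) (signOp_mul_absOp hs hg)
  simp only [ContinuousLinearMap.comp_apply, mul_apply_eq_comp] at h2 h3 h4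
  rw [← ContinuousLinearMap.adjoint_inner_left, h1, h2, h3, h4]

/-- The Krein space induced by a selfadjoint contraction. -/
def inducedKSp (hs : IsSelfAdjoint g) (hg : ‖g‖ ≤ 1) : KSp.{u, w₁} 𝕜 where
  carrier := suppOp g
  J := restrictSupp (signOp g) (sqrtAbsOp_comp_signOp hs hg).symm
  J_adj := by
    refine ContinuousLinearMap.ext fun f => ext_inner_right 𝕜 fun k => ?_
    have h := isSelfAdjoint_signOp g
    rw [ContinuousLinearMap.isSelfAdjoint_iff'] at h
    rw [ContinuousLinearMap.adjoint_inner_left]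
    change ⟪(f : H), signOp g k⟫_𝕜 = ⟪signOp g f, (k : H)⟫_𝕜
    rw [← ContinuousLinearMap.adjoint_inner_left, h]
  J_sq := by
    refine ContinuousLinearMap.ext fun f => Subtype.ext ?_
    exact congrArg (fun S : H →L[𝕜] H => S f) (signOp_mul_self g)

end InducedKreinSpace

section Linearisation

variable {A p} {K L : ∀ y x : X, E (p x) →L[𝕜] E (p y)}

lemma castE_castE {o o' o'' : O} (h : o = o') (h' : o' = o'') (k : E o) :
    castE 𝕜 E h' (castE 𝕜 E h k) = castE 𝕜 E (h.trans h') k := by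
  subst h h'; rfl

lemma castE_symm {o o' : O} (h : o = o') : (castE 𝕜 E h).symm = castE 𝕜 E h.symm := by
  subst h; rfl

lemma apply_castE {H : Type*} [NormedAddCommGroup H] [InnerProductSpace 𝕜 H] {s : S}
    (V : ∀ x : Fib A s, E (p x) →L[𝕜] H) {x x' : Fib A s} (h : (x : X) = x')
    (k : E (p x)) : V x' (castE 𝕜 E (congrArg p h) k) = V x k := by
  obtain ⟨x, hx⟩ := x
  obtain ⟨x', hx'⟩ := x'
  obtain rfl : x = x' := h
  rfl

lemma apply_liftE_mul {H : Type*} [NormedAddCommGroup H] [InnerProductSpace 𝕜 H] (α β : Γ)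
    {r s t : S} (hr : G.d β = r) (hs : G.c β = s) (hs' : G.d α = s) (ht : G.c α = t)
    (V : ∀ x : Fib A t, E (p x) →L[𝕜] H) (x : Fib A r) (k : E (p x)) :
    V (actF (G.mul α β) ((G.d_mul (hs'.trans hs.symm)).trans hr)
        ((G.c_mul (hs'.trans hs.symm)).trans ht) x)
      (liftE 𝕜 hp (G.mul α β) ((G.d_mul (hs'.trans hs.symm)).trans hr)
        ((G.c_mul (hs'.trans hs.symm)).trans ht) x k) =
    V (actF α hs' ht (actF β hr hs x))
      (liftE 𝕜 hp α hs' ht (actF β hr hs x) (liftE 𝕜 hp β hr hs x k)) := by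
  have h : A.act (G.mul α β) x = A.act α (A.act β x) :=
    A.act_mul (hr.trans x.2.symm) (hs'.trans hs.symm)
  rw [← apply_castE (𝕜 := 𝕜) V (x' := actF α hs' ht (actF β hr hs x)) h]
  simp only [liftE, castE_symm]
  congr 1
  exact (castE_castE _ _ _).trans (castE_castE _ _ _).symm

lemma BoundedShiftType.exists_shift (hL : BoundedShiftType A p hp L)
    (M : ∀ s, HilbertModel (fibK (A := A) L s)) (α : Γ) {s t : S} (hs : G.d α = s)
    (ht : G.c α = t) :
    ∃ T : (M s).carrier →L[𝕜] (M t).carrier, ∀ x k,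
      T ((M s).V x k) = (M t).V (actF α hs ht x) (liftE 𝕜 hp α hs ht x k) := by
  obtain ⟨C, hC, h⟩ := hL α
  refine exists_extension (M s).total (C := √C) (W := fun x => (M t).V (actF α hs ht x) ∘L
    (liftE 𝕜 hp α hs ht x).toContinuousLinearEquiv.toContinuousLinearMap) fun n x f => ?_
  refine (sq_le_sq₀ (norm_nonneg _) (by positivity)).1 ?_
  rw [mul_pow, Real.sq_sqrt hC, ← (M s).re_sum_eq_norm_sq]
  refine le_trans (le_of_eq ?_) (h n (fun k => x k) (fun k => hs.trans (x k).2.symm) f)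
  exact ((M t).re_sum_eq_norm_sq (fun k => actF α hs ht (x k))
    fun k => liftE 𝕜 hp α hs ht (x k) (f k)).symm

lemma HilbertModel.exists_gram_of_dominated (hK : PartHermitian A p K) (hL : PartPSD A p L)
    (hneg : PKLE A p (fun y x => -(L y x)) K) (hle : PKLE A p K L) {s : S}
    (M : HilbertModel (fibK (A := A) L s)) :
    ∃ g : M.carrier →L[𝕜] M.carrier, IsSelfAdjoint g ∧ ‖g‖ ≤ 1 ∧
      ∀ x y k h, ⟪fibK K s x y k, h⟫_𝕜 = ⟪g (M.V y k), M.V x h⟫_𝕜 := by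
  refine M.exists_gram hL.1.fib hK.fib (fun n x f => ?_) fun n x f => hle.fib n x f
  have h := hneg.fib n x f
  simp only [fibK, sub_neg_eq_add] at h
  simpa only [add_comm] using h

/-- The linearisation of an invariant kernel dominated by an invariant kernel of bounded shift
type. -/
theorem exists_fibKLin (hK : PartHermitian A p K) (hKinv : GammaInvariant A p hp K)
    (hL : PartPSD A p L) (hLinv : GammaInvariant A p hp L) (hLbd : BoundedShiftType A p hp L)
    (hneg : PKLE A p (fun y x => -(L y x)) K) (hle : PKLE A p K L) :
    Nonempty (FibKLin.{u, uΓ, uS, v, vO, w, max v w} A p hp K) := by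
  have M := fun s => (hL.exists_model s).some
  choose g hgs hg1 hgK using fun s => 
    (M s).exists_gram_of_dominated hK hL hneg hle
  choose Φ hΦ using fun α s t hs ht => hLbd.exists_shift hp M α (s := s) (t := t) hs ht
  have hstar : ∀ α s t (hs : G.d α = s) (ht : G.c α = t),
      Φ (G.star α) t s ((G.d_star α).trans ht) ((G.c_star α).trans hs) =
        ContinuousLinearMap.adjoint (Φ α s t hs ht) := by
    intro α s t hs ht
    refine ext_of_total (M t).total fun y k => ?_
    have h1 : ∀ v, ⟪Φ (G.star α) t s ((G.d_star α).trans ht) ((G.c_star α).trans hs)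
        ((M t).V y k), v⟫_𝕜 =
        ⟪ContinuousLinearMap.adjoint (Φ α s t hs ht) ((M t).V y k), v⟫_𝕜 := by
      refine forall_of_fin_sum (M s).total (isClosed_eq (by fun_prop) (by fun_prop)) fun n x f => ?_
      simp only [inner_sum, ContinuousLinearMap.adjoint_inner_left, hΦ, ← (M _).inner_V]
      exact Finset.sum_congr rfl fun i _ => (hLinv.inner_eq hp α hs ht (x i) y k (f i)).symm
    exact ext_inner_right 𝕜 h1
  have hgΦ : ∀ α s t (hs : G.d α = s) (ht : G.c α = t),
      Φ α s t hs ht ∘L g s = g t ∘L Φ α s t hs ht := by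
    intro α s t hs ht
    refine ext_of_total (M s).total fun x k => ?_
    have h1 : ∀ v, ⟪Φ α s t hs ht (g s ((M s).V x k)), v⟫_𝕜 =
        ⟪g t (Φ α s t hs ht ((M s).V x k)), v⟫_𝕜 := by
      refine forall_of_fin_sum (M t).total (isClosed_eq (by fun_prop) (by fun_prop)) fun n y f => ?_
      simp only [inner_sum]
      refine Finset.sum_congr rfl fun i _ => ?_
      rw [← ContinuousLinearMap.adjoint_inner_right, ← hstar, hΦ, hΦ, ← hgK, ← hgK,
        ← hK.fib, ← hK.fib _ (y i), ContinuousLinearMap.adjoint_inner_left,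
        ContinuousLinearMap.adjoint_inner_left, ← inner_conj_symm,
        ← inner_conj_symm (liftE 𝕜 hp α hs ht x k)]
      exact congrArg _ (hKinv.inner_eq hp α hs ht x (y i) (f i) k).symm
    exact ext_inner_right 𝕜 h1
  have hQ := fun α s t hs ht =>
    sqrtAbsOp_intertwines (hgs s) (hg1 s) (hgs t) (hg1 t) (hgΦ α s t hs ht)
  exact ⟨{
    Ksp := fun s => inducedKSp (hgs s) (hg1 s)
    V := fun s x => sqrtAbsSupp (g s) ∘L (M s).V x
    lin := fun s x y k h => (hgK s x y k h).trans
      (inner_signOp_sqrtAbsOp (hgs s) (hg1 s) _ _).symm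
    total := fun s => dense_span_sqrtAbsSupp (M s).total
    Ψ := fun α s t hs ht => restrictSupp (Φ α s t hs ht) (hQ α s t hs ht)
    mul := fun α β r s t hr hs hs' ht => by
      have h : Φ (G.mul α β) r t ((G.d_mul (hs'.trans hs.symm)).trans hr)
          ((G.c_mul (hs'.trans hs.symm)).trans ht) = Φ α s t hs' ht ∘L Φ β r s hr hs := by
        refine ext_of_total (M r).total fun x k => ?_
        rw [ContinuousLinearMap.comp_apply, hΦ, hΦ, hΦ]
        exact apply_liftE_mul hp α β hr hs hs' ht (M t).V x k
      refine ContinuousLinearMap.ext fun f => Subtype.ext ?_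
      exact congrArg (fun S => S f.1) h
    star := fun α s t hs ht => restrictSupp_eq_adjoint _ _ (hstar α s t hs ht)
    shift := fun α s t hs ht x k => by
      refine Subtype.ext ?_
      refine (congrArg (fun S => S ((M s).V x k)) (hQ α s t hs ht)).trans ?_
      exact congrArg (sqrtAbsOp (g t)) (hΦ α s t hs ht x k)
    comm := fun α s t hs ht => by
      refine ContinuousLinearMap.ext fun f => Subtype.ext ?_
      exact congrArg (fun S => S f.1)
        (signOp_intertwines (hgs s) (hg1 s) (hgs t) (hg1 t) (hgΦ α s t hs ht)) }⟩

end Linearisation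

section Domination

variable {A p} {K K₁ K₂ L : ∀ y x : X, E (p x) →L[𝕜] E (p y)}

lemma PartPSD.add (h₁ : PartPSD A p K₁) (h₂ : PartPSD A p K₂) :
    PartPSD A p (fun y x => K₁ y x + K₂ y x) := by
  refine ⟨fun x y hxy => ?_, fun s n x hx h => ?_⟩
  · rw [map_add, h₁.1 x y hxy, h₂.1 x y hxy]
  · simp only [add_apply, inner_add_left, Finset.sum_add_distrib, map_add]
    exact add_nonneg (h₁.2 s n x hx h) (h₂.2 s n x hx h)

lemma GammaInvariant.add (h₁ : GammaInvariant A p hp K₁) (h₂ : GammaInvariant A p hp K₂) :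
    GammaInvariant A p hp (fun y x => K₁ y x + K₂ y x) := by
  intro α x y hx hy k
  simp only [add_apply, map_add, h₁ α x y hx hy k, h₂ α x y hx hy k]

lemma BoundedShiftType.add (h₁ : BoundedShiftType A p hp K₁) (h₂ : BoundedShiftType A p hp K₂)
    (hK₁ : PartPSD A p K₁) (hK₂ : PartPSD A p K₂) :
    BoundedShiftType A p hp (fun y x => K₁ y x + K₂ y x) := by
  intro α
  obtain ⟨C₁, hC₁, h₁⟩ := h₁ α
  obtain ⟨C₂, hC₂, h₂⟩ := h₂ α
  refine ⟨max C₁ C₂, le_max_of_le_left hC₁, fun n z hz g => ?_⟩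
  simp only [add_apply, inner_add_left, Finset.sum_add_distrib, map_add, mul_add]
  refine add_le_add ((h₁ n z hz g).trans ?_) ((h₂ n z hz g).trans ?_)
  · exact mul_le_mul_of_nonneg_right (le_max_left _ _) (hK₁.2 _ n z (fun i => (hz i).symm) g)
  · exact mul_le_mul_of_nonneg_right (le_max_right _ _) (hK₂.2 _ n z (fun i => (hz i).symm) g)

lemma schwarz_of_dominated (hK : PartHermitian A p K) (hL : PartPSD A p L)
    (hneg : PKLE A p (fun y x => -(L y x)) K) (hle : PKLE A p K L) {s : S} {n m : ℕ}
    (x : Fin n → Fib A s) (y : Fin m → Fib A s) (f : ∀ i, E (p (x i))) (g : ∀ j, E (p (y j))) :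
    ‖∑ i, ∑ j, ⟪fibK K s (y j) (x i) (f i), g j⟫_𝕜‖ ≤
      √(RCLike.re (∑ i, ∑ i', ⟪fibK L s (x i') (x i) (f i), f i'⟫_𝕜)) *
      √(RCLike.re (∑ j, ∑ j', ⟪fibK L s (y j') (y j) (g j), g j'⟫_𝕜)) := by
  obtain ⟨M⟩ := hL.exists_model s
  obtain ⟨T, -, hT, hTK⟩ := M.exists_gram_of_dominated hK hL hneg hle
  rw [M.re_sum_eq_norm_sq, M.re_sum_eq_norm_sq, Real.sqrt_sq (norm_nonneg _),
    Real.sqrt_sq (norm_nonneg _), sum_inner_eq_inner (fun i => T ∘L M.V i) M.V hTK]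
  simp only [ContinuousLinearMap.comp_apply, ← map_sum]
  refine (norm_inner_le_norm _ _).trans ?_
  gcongr
  exact (T.le_opNorm _).trans (mul_le_of_le_one_left (norm_nonneg _) hT)

lemma dominated_of_schwarz (hK : PartHermitian A p K) (hL : PartPSD A p L)
    (h : ∀ (s : S) (n : ℕ) (x : Fin n → X), (∀ i, A.a (x i) = s) → ∀ f : ∀ i, E (p (x i)),
      ‖∑ i, ∑ j, ⟪K (x j) (x i) (f i), f j⟫_𝕜‖ ≤
        RCLike.re (∑ i, ∑ j, ⟪L (x j) (x i) (f i), f j⟫_𝕜)) :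
    PKLE A p (fun y x => -(L y x)) K ∧ PKLE A p K L := by
  refine ⟨⟨fun x y hxy => ?_, fun s n x hx f => ?_⟩, ⟨fun x y hxy => ?_, fun s n x hx f => ?_⟩⟩
  · simp only [map_sub, map_neg, hK x y hxy, hL.1 x y hxy]
  · have h1 := (abs_le.1 ((RCLike.abs_re_le_norm _).trans (h s n x hx f))).1
    simp only [sub_neg_eq_add, add_apply, inner_add_left, Finset.sum_add_distrib, map_add]
    linarith
  · simp only [map_sub, hK x y hxy, hL.1 x y hxy]
  · have h1 := (abs_le.1 ((RCLike.abs_re_le_norm _).trans (h s n x hx f))).2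
    simp only [sub_apply, inner_sub_left, Finset.sum_sub_distrib, map_sub]
    linarith

end Domination

/-- for a partially Hermitian, `Γ`-invariant kernel `K` the
following are equivalent: (1) `-L ≤_P K ≤_P L` for some partially positive
semidefinite `L` which is `Γ`-invariant and of bounded shift type; (2) the
fibrewise Schwarz inequality holds for some such `L`; (3) `K = K₁ - K₂` with
both partially positive semidefinite, `Γ`-invariant and of bounded shift type;
(3′) the same with `K₁, K₂` disjoint; (4) `K` has a minimal Krein space
partial linearisation carrying a bounded `*`-representation `Ψ` of `Γ` with
`Ψ(α) V_x = V_{α·x}` which, in addition, commutes with the distinguished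
bundle of fundamental symmetries: `Ψ(α) J_{d(α)} = J_{c(α)} Ψ(α)`. -/
theorem invariant_hermitian_invariant_domination_tfae
    (K : ∀ y x : X, E (p x) →L[𝕜] E (p y))
    (hK : PartHermitian A p K) (hKinv : GammaInvariant A p hp K) :
    ((∃ L : ∀ y x : X, E (p x) →L[𝕜] E (p y), PartPSD A p L ∧
        GammaInvariant A p hp L ∧ BoundedShiftType A p hp L ∧
        PKLE A p (fun y x => -(L y x)) K ∧ PKLE A p K L) ↔
      (∃ L : ∀ y x : X, E (p x) →L[𝕜] E (p y), PartPSD A p L ∧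
        GammaInvariant A p hp L ∧ BoundedShiftType A p hp L ∧
        ∀ (s : S) (n m : ℕ) (x : Fin n → X) (y : Fin m → X),
          (∀ i, A.a (x i) = s) → (∀ j, A.a (y j) = s) →
          ∀ (f : ∀ i, E (p (x i))) (g : ∀ j, E (p (y j))),
            ‖∑ i, ∑ j, ⟪K (y j) (x i) (f i), g j⟫_𝕜‖ ≤
              Real.sqrt
                (RCLike.re (∑ i, ∑ i', ⟪L (x i') (x i) (f i), f i'⟫_𝕜)) *
              Real.sqrt
                (RCLike.re (∑ j, ∑ j', ⟪L (y j') (y j) (g j), g j'⟫_𝕜)))) ∧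
    ((∃ L : ∀ y x : X, E (p x) →L[𝕜] E (p y), PartPSD A p L ∧
        GammaInvariant A p hp L ∧ BoundedShiftType A p hp L ∧
        PKLE A p (fun y x => -(L y x)) K ∧ PKLE A p K L) ↔
      (∃ K₁ K₂ : ∀ y x : X, E (p x) →L[𝕜] E (p y),
        PartPSD A p K₁ ∧ PartPSD A p K₂ ∧
        GammaInvariant A p hp K₁ ∧ GammaInvariant A p hp K₂ ∧
        BoundedShiftType A p hp K₁ ∧ BoundedShiftType A p hp K₂ ∧
        ∀ y x : X, K y x = K₁ y x - K₂ y x)) ∧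
    ((∃ L : ∀ y x : X, E (p x) →L[𝕜] E (p y), PartPSD A p L ∧
        GammaInvariant A p hp L ∧ BoundedShiftType A p hp L ∧
        PKLE A p (fun y x => -(L y x)) K ∧ PKLE A p K L) ↔
      (∃ K₁ K₂ : ∀ y x : X, E (p x) →L[𝕜] E (p y),
        PartPSD A p K₁ ∧ PartPSD A p K₂ ∧
        GammaInvariant A p hp K₁ ∧ GammaInvariant A p hp K₂ ∧
        BoundedShiftType A p hp K₁ ∧ BoundedShiftType A p hp K₂ ∧
        PDisjoint A p K₁ K₂ ∧ ∀ y x : X, K y x = K₁ y x - K₂ y x)) ∧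
    ((∃ L : ∀ y x : X, E (p x) →L[𝕜] E (p y), PartPSD A p L ∧
        GammaInvariant A p hp L ∧ BoundedShiftType A p hp L ∧
        PKLE A p (fun y x => -(L y x)) K ∧ PKLE A p K L) ↔
      (∃ T : InvKLin.{u, uΓ, uS, v, vO, w, max v w} 𝕜 E A p hp K,
        IsMinimalPartKLin A p T.Ksp T.V ∧
        ∀ (α : Γ) (g : (T.Ksp (G.d α)).carrier),
          T.Ψ α ((T.Ksp (G.d α)).J g) = (T.Ksp (G.c α)).J (T.Ψ α g))) := by
  have h12 : ∀ L : ∀ y x : X, E (p x) →L[𝕜] E (p y), PartPSD A p L →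
      PKLE A p (fun y x => -(L y x)) K → PKLE A p K L →
      ∀ (s : S) (n m : ℕ) (x : Fin n → X) (y : Fin m → X),
        (∀ i, A.a (x i) = s) → (∀ j, A.a (y j) = s) →
        ∀ (f : ∀ i, E (p (x i))) (g : ∀ j, E (p (y j))),
          ‖∑ i, ∑ j, ⟪K (y j) (x i) (f i), g j⟫_𝕜‖ ≤
            Real.sqrt (RCLike.re (∑ i, ∑ i', ⟪L (x i') (x i) (f i), f i'⟫_𝕜)) *
            Real.sqrt (RCLike.re (∑ j, ∑ j', ⟪L (y j') (y j) (g j), g j'⟫_𝕜)) :=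
    fun L hL hneg hle s n m x y hx hy f g =>
      schwarz_of_dominated hK hL hneg hle (fun i => ⟨x i, hx i⟩) (fun j => ⟨y j, hy j⟩) f g
  have h31 : ∀ K₁ K₂ : ∀ y x : X, E (p x) →L[𝕜] E (p y), PartPSD A p K₁ → PartPSD A p K₂ →
      GammaInvariant A p hp K₁ → GammaInvariant A p hp K₂ →
      BoundedShiftType A p hp K₁ → BoundedShiftType A p hp K₂ →
      (∀ y x : X, K y x = K₁ y x - K₂ y x) →
      ∃ L : ∀ y x : X, E (p x) →L[𝕜] E (p y), PartPSD A p L ∧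
        GammaInvariant A p hp L ∧ BoundedShiftType A p hp L ∧
        PKLE A p (fun y x => -(L y x)) K ∧ PKLE A p K L := by
    intro K₁ K₂ h₁ h₂ hi₁ hi₂ hb₁ hb₂ hsub
    refine ⟨_, h₁.add h₂, hi₁.add hp hi₂, hb₁.add hp hb₂ h₁ h₂, ?_, ?_⟩
    · have h := h₁.add h₁
      unfold PKLE
      convert h using 3 with y x
      rw [hsub, sub_neg_eq_add, sub_add_add_cancel]
    · have h := h₂.add h₂
      unfold PKLE
      convert h using 3 with y x
      rw [hsub, add_sub_sub_cancel]
  refine ⟨⟨?_, ?_⟩, ⟨?_, ?_⟩, ⟨?_, ?_⟩, ⟨?_, ?_⟩⟩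
  · rintro ⟨L, hL, hi, hb, hneg, hle⟩
    exact ⟨L, hL, hi, hb, h12 L hL hneg hle⟩
  · rintro ⟨L, hL, hi, hb, hS⟩
    refine ⟨L, hL, hi, hb, dominated_of_schwarz hK hL fun s n x hx f => ?_⟩
    have h := hS s n n x x hx hx f f
    rwa [Real.mul_self_sqrt (hL.2 s n x hx f)] at h
  · rintro ⟨L, hL, hi, hb, hneg, hle⟩
    obtain ⟨T⟩ := exists_fibKLin hp hK hKinv hL hi hb hneg hle
    obtain ⟨K₁, K₂, h₁, h₂, hi₁, hi₂, hb₁, hb₂, -, hsub⟩ := T.exists_disjoint_decomposition hp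
    exact ⟨K₁, K₂, h₁, h₂, hi₁, hi₂, hb₁, hb₂, hsub⟩
  · rintro ⟨K₁, K₂, h₁, h₂, hi₁, hi₂, hb₁, hb₂, hsub⟩
    exact h31 K₁ K₂ h₁ h₂ hi₁ hi₂ hb₁ hb₂ hsub
  · rintro ⟨L, hL, hi, hb, hneg, hle⟩
    obtain ⟨T⟩ := exists_fibKLin hp hK hKinv hL hi hb hneg hle
    exact T.exists_disjoint_decomposition hp
  · rintro ⟨K₁, K₂, h₁, h₂, hi₁, hi₂, hb₁, hb₂, -, hsub⟩
    exact h31 K₁ K₂ h₁ h₂ hi₁ hi₂ hb₁ hb₂ hsub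
  · rintro ⟨L, hL, hi, hb, hneg, hle⟩
    obtain ⟨T⟩ := exists_fibKLin hp hK hKinv hL hi hb hneg hle
    exact ⟨T.toInvKLin hp, T.isMinimal hp, fun α g =>
      congrArg (fun R => R g) (T.comm α rfl rfl)⟩
  · rintro ⟨T, hmin, hcomm⟩
    obtain ⟨T'⟩ := T.nonempty_fibKLin hp hmin hcomm
    obtain ⟨K₁, K₂, h₁, h₂, hi₁, hi₂, hb₁, hb₂, -, hsub⟩ := T'.exists_disjoint_decomposition hp
    exact h31 K₁ K₂ h₁ h₂ hi₁ hi₂ hb₁ hb₂ hsub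
end
end
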